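/- For every integer k ≥ 1 and every α ∈ ( (1/log 2) log((k+1)²/(k(k+2))) , 1 ], the limit lim_{n→∞} (1/n) log Leb{ x ∈ (0,1)\ℚ : (1/n)F_{k,n}(x) ≥ α } exists, equals -inf{ I(μ) : μ ∈ M, ∫ 1_{(1/(k+1),1/k)} d(μ∘π^{-1}) = α }, and lies in (-∞, 0); likewise, for every α ∈ [0, (1/log 2) log((k+1)²/(k(k+2))) ), the limit lim_{n→∞} (1/n) log Leb{ x ∈ (0,1)\ℚ : (1/n)F_{k,n}(x) ≤ α } exists, equals -inf{ I(μ) : μ ∈ M, ∫ 1_{(1/(k+1),1/k)} d(μ∘π^{-1}) = α }, and lies in (-∞, 0). -/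

import Mathlib

open MeasureTheory Filter Topology Set
open scoped ENNReal NNReal

namespace CMS

/-! ### Generic dynamical notions -/

variable {X : Type*}

/-- Birkhoff sum `S_n φ`. -/
noncomputable def birkhoff (T : X → X) (φ : X → ℝ) (n : ℕ) (x : X) : ℝ :=
  ∑ i ∈ Finset.range n, φ (T^[i] x)

/-- A measure is invariant under `T`. -/
def Invariant [MeasurableSpace X] (T : X → X) (μ : Measure X) : Prop :=
  Measure.map T μ = μ

/-- `∫ φ dμ > -∞`, i.e. the negative part of `φ` is integrable. -/
def IntegralGtBot [MeasurableSpace X] (φ : X → ℝ) (μ : Measure X) : Prop :=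
  (∫⁻ x, ENNReal.ofReal (-φ x) ∂μ) ≠ ⊤

/-- The integral of `φ`, with values in `EReal` (defined whenever one of the parts is finite). -/
noncomputable def eintegral [MeasurableSpace X] (φ : X → ℝ) (μ : Measure X) : EReal :=
  ((∫⁻ x, ENNReal.ofReal (φ x) ∂μ : ℝ≥0∞) : EReal) -
    ((∫⁻ x, ENNReal.ofReal (-φ x) ∂μ : ℝ≥0∞) : EReal)

/-- Entropy of the countable partition induced by a map `g` with countable range. -/
noncomputable def partitionEntropy [MeasurableSpace X] {α : Type*} (μ : Measure X) (g : X → α) :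
    ℝ≥0∞ :=
  ∑' a : α, ENNReal.ofReal (-((μ (g ⁻¹' {a})).toReal * Real.log ((μ (g ⁻¹' {a})).toReal)))

/-- Kolmogorov–Sinaĭ entropy of `T` with respect to `μ`: the supremum over finite measurable
partitions (coded by maps `X → ℕ` with finite range) of the asymptotic entropy of iterated
joins of the partition. -/
noncomputable def entropy [MeasurableSpace X] (T : X → X) (μ : Measure X) : ℝ≥0∞ :=
  ⨆ (p : X → ℕ) (_ : Measurable p ∧ (Set.range p).Finite),
    atTop.liminf fun n : ℕ =>
      ENNReal.ofReal ((n : ℝ)⁻¹) * partitionEntropy μ (fun x => fun i : Fin n => p (T^[i] x))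

/-- The empirical measure `δ_x^n = (1/n) ∑_{i<n} δ_{T^i x}` (with junk convention `n = 0 ↦ n = 1`,
irrelevant since only `n ≥ 1` is ever used). -/
noncomputable def empirical [MeasurableSpace X] (T : X → X) (x : X) (n : ℕ) :
    ProbabilityMeasure X :=
  ⟨((max n 1 : ℕ) : ℝ≥0∞)⁻¹ • ∑ i ∈ Finset.range (max n 1), Measure.dirac (T^[i] x), by
    refine ⟨?_⟩
    have h1 : (∑ i ∈ Finset.range (max n 1), Measure.dirac (T^[i] x)) Set.univ
        = ((max n 1 : ℕ) : ℝ≥0∞) := by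
      rw [Measure.finset_sum_apply]
      simp
    rw [Measure.smul_apply, h1, smul_eq_mul, ENNReal.inv_mul_cancel] <;> simp⟩

noncomputable instance [MeasurableSpace X] [TopologicalSpace X] [OpensMeasurableSpace X] :
    MeasurableSpace (ProbabilityMeasure X) := borel _

/-- Sets of periodic points. -/
def perSet (T : X → X) (n : ℕ) : Set X := {x | T^[n] x = x}

/-- Sets of iterated preimages of a point. -/
def preimSet (T : X → X) (n : ℕ) (y : X) : Set X := {x | T^[n] x = y}

/-- The partition function `Z_n(φ, C)` over a subset `C`. -/
noncomputable def Zfn [MeasurableSpace X] (T : X → X) (φ : X → ℝ) (n : ℕ) (C : Set X) : ℝ≥0∞ :=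
  ∑' x : C, ENNReal.ofReal (Real.exp (birkhoff T φ n x))

/-- The distribution of the empirical measures under `μ`. -/
noncomputable def empDistr [MeasurableSpace X] [TopologicalSpace X] [OpensMeasurableSpace X]
    (T : X → X) (μ : Measure X) (n : ℕ) : Measure (ProbabilityMeasure X) :=
  Measure.map (fun x => empirical T x n) μ

/-- The distribution `Z_n(φ,C)⁻¹ ∑_{x ∈ C} e^{S_nφ(x)} δ_{δ_x^n}` on the space of probability
measures, for a countable set `C` (of weighted periodic points or iterated preimages). -/
noncomputable def weightedDistr [MeasurableSpace X] [TopologicalSpace X] [OpensMeasurableSpace X]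
    (T : X → X) (φ : X → ℝ) (n : ℕ) (C : Set X) : Measure (ProbabilityMeasure X) :=
  (Zfn T φ n C)⁻¹ •
    Measure.sum (fun x : C =>
      ENNReal.ofReal (Real.exp (birkhoff T φ n x)) • Measure.dirac (empirical T (x : X) n))

/-! ### Large deviations notions -/

variable {Y : Type*}

/-- The large deviation principle for a sequence of (sub)probability measures with rate
function `J`. -/
def HasLDP [TopologicalSpace Y] [MeasurableSpace Y] (μ : ℕ → Measure Y) (J : Y → EReal) : Prop :=
  (∀ G : Set Y, IsOpen G →
      -(⨅ y ∈ G, J y) ≤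
        atTop.liminf fun n : ℕ => (((n : ℝ)⁻¹ : ℝ) : EReal) * ENNReal.log (μ n G)) ∧
  (∀ K : Set Y, IsClosed K →
      atTop.limsup (fun n : ℕ => (((n : ℝ)⁻¹ : ℝ) : EReal) * ENNReal.log (μ n K)) ≤
        -(⨅ y ∈ K, J y))

/-- Exponential tightness of a sequence of measures. -/
def ExpTight [TopologicalSpace Y] [MeasurableSpace Y] (μ : ℕ → Measure Y) : Prop :=
  ∀ L : ℝ, 0 < L → ∃ K : Set Y, IsCompact K ∧
    atTop.limsup (fun n : ℕ => (((n : ℝ)⁻¹ : ℝ) : EReal) * ENNReal.log (μ n Kᶜ)) ≤ ((-L : ℝ) : EReal)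

/-- A good rate function: lower semicontinuous with compact sublevel sets. -/
def GoodRate [TopologicalSpace Y] (J : Y → EReal) : Prop :=
  LowerSemicontinuous J ∧ ∀ α : ℝ, 0 ≤ α → IsCompact {y | J y ≤ (α : EReal)}

/-- The rate function `I(μ) = - inf_{G ∋ μ} sup_G F`. -/
noncomputable def rateOf [TopologicalSpace Y] (F : Y → EReal) (μ : Y) : EReal :=
  -(⨅ (G : Set Y) (_ : IsOpen G ∧ μ ∈ G), ⨆ ν ∈ G, F ν)

/-- The convex combination `t μ + (1-t) ν` of two probability measures. -/
noncomputable def mix [MeasurableSpace X] (t : ℝ) (h0 : 0 ≤ t) (h1 : t ≤ 1)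
    (μ ν : ProbabilityMeasure X) : ProbabilityMeasure X :=
  ⟨ENNReal.ofReal t • (μ : Measure X) + ENNReal.ofReal (1 - t) • (ν : Measure X), by
    refine ⟨?_⟩
    simp only [Measure.add_apply, Measure.smul_apply, smul_eq_mul, measure_univ, mul_one]
    rw [← ENNReal.ofReal_add h0 (by linarith)]
    norm_num⟩

/-- Convexity of a rate function on probability measures. -/
def ConvexRate [MeasurableSpace X] (J : ProbabilityMeasure X → EReal) : Prop :=
  ∀ μ ν : ProbabilityMeasure X, ∀ t : ℝ, ∀ (h0 : 0 ≤ t) (h1 : t ≤ 1),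
    J (mix t h0 h1 μ ν) ≤ ((t : ℝ) : EReal) * J μ + ((1 - t : ℝ) : EReal) * J ν

-- The free energy functional `F`.
open Classical in
noncomputable def freeEnergy [MeasurableSpace X] (T : X → X) (φ : X → ℝ) (P : ℝ)
    (ν : ProbabilityMeasure X) : EReal :=
  if Invariant T (ν : Measure X) ∧ IntegralGtBot φ (ν : Measure X)
  then ((entropy T (ν : Measure X) : ℝ≥0∞) : EReal) + eintegral φ (ν : Measure X) - ((P : ℝ) : EReal)
  else ⊥

/-! ### Countable Markov shifts -/

variable {S : Type*}

/-- The topological Markov shift with alphabet `S` and transition relation `A`. -/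
def Space (A : S → S → Prop) : Type _ := {x : ℕ → S // ∀ i, A (x i) (x (i + 1))}

variable (A : S → S → Prop)

instance [TopologicalSpace S] : TopologicalSpace (Space A) :=
  inferInstanceAs (TopologicalSpace {x : ℕ → S // ∀ i, A (x i) (x (i + 1))})

noncomputable instance [TopologicalSpace S] : MeasurableSpace (Space A) := borel _

instance [TopologicalSpace S] : BorelSpace (Space A) := ⟨rfl⟩

/-- The left shift. -/
def shift : Space A → Space A := fun x => ⟨fun i => x.1 (i + 1), fun i => x.2 (i + 1)⟩

/-- Admissible words. -/
def Admissible (w : List S) : Prop := w ≠ [] ∧ w.Chain' A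

/-- The cylinder set of a word. -/
def cylinder (w : List S) : Set (Space A) := {x | ∀ i : Fin w.length, x.1 i = w.get i}

variable {A}

/-- The initial word of length `n` of a point. -/
def word (x : Space A) (n : ℕ) : List S := List.ofFn (fun i : Fin n => x.1 i)

variable (A)

/-- `μ` is a Gibbs state for the potential `φ` with constants `c₀` and `P`. -/
def IsGibbsWith [TopologicalSpace S] (φ : Space A → ℝ) (μ : Measure (Space A)) (c₀ P : ℝ) :
    Prop :=
  ∀ n : ℕ, 1 ≤ n → ∀ x : Space A,
    c₀⁻¹ * Real.exp (-(P * n) + birkhoff (shift A) φ n x)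
        ≤ (μ (cylinder A (word x n))).toReal ∧
      (μ (cylinder A (word x n))).toReal
        ≤ c₀ * Real.exp (-(P * n) + birkhoff (shift A) φ n x)

/-- `μ` is a Gibbs state for `φ`. -/
def IsGibbs [TopologicalSpace S] (φ : Space A → ℝ) (μ : Measure (Space A)) : Prop :=
  ∃ c₀ P : ℝ, 1 ≤ c₀ ∧ IsGibbsWith A φ μ c₀ P

/-- The transition matrix has no row or column identically zero. -/
def NoZeroRowCol : Prop := (∀ a : S, ∃ b, A a b) ∧ ∀ b : S, ∃ a, A a b

/-- Finite irreducibility. -/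
def FinitelyIrreducible : Prop :=
  ∃ Λ : Finset (List S), ∀ v w : List S, Admissible A v → Admissible A w →
    ∃ l ∈ Λ, Admissible A (v ++ l ++ w)

/-- Finite primitiveness. -/
def FinitelyPrimitive : Prop :=
  ∃ Λ : Finset (List S), (∃ N : ℕ, ∀ l ∈ Λ, l.length = N) ∧
    ∀ v w : List S, Admissible A v → Admissible A w →
      ∃ l ∈ Λ, Admissible A (v ++ l ++ w)

/-- Topological transitivity. -/
def TopTransitive : Prop :=
  ∀ a b : S, ∃ n : ℕ, 1 ≤ n ∧
    (cylinder A [a] ∩ (shift A)^[n] ⁻¹' (cylinder A [b])).Nonempty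

/-- Varadhan's functional `Q(ψ) = sup_μ (∫ψ dμ - I(μ))`. -/
noncomputable def varQ {X : Type*} [MeasurableSpace X] (I : ProbabilityMeasure X → EReal)
    (ψ : X → ℝ) : EReal :=
  ⨆ μ : ProbabilityMeasure X, (((∫ x, ψ x ∂(μ : Measure X)) : ℝ) : EReal) - I μ

/-- `φ` is uniformly continuous for the standard metric of the shift space. -/
def UnifCont (φ : Space A → ℝ) : Prop :=
  ∀ ε : ℝ, 0 < ε → ∃ N : ℕ, ∀ x y : Space A, (∀ i < N, x.1 i = y.1 i) → |φ x - φ y| ≤ ε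

/-- `φ` is bounded. -/
def Bdd (φ : Space A → ℝ) : Prop := ∃ C : ℝ, ∀ x : Space A, |φ x| ≤ C

end CMS

open CMS MeasureTheory Filter Topology Set
open scoped ENNReal

/-- The Gauss map `T x = 1/x - ⌊1/x⌋`. -/
noncomputable def gaussMap : ℝ → ℝ := fun x => Int.fract x⁻¹

/-- The left shift on the full shift `ℕ^ℕ`. -/
def fullShift : (ℕ → ℕ) → ℕ → ℕ := fun x i => x (i + 1)

/-- The value of the finite continued fraction `[0; a₀ + 1, a₁ + 1, …]`. -/
noncomputable def finCF : List ℕ → ℝ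
  | [] => 0
  | a :: l => ((a : ℝ) + 1 + finCF l)⁻¹

/-- The coding map `π` conjugating the full shift over `ℕ` with the Gauss map: `x` is sent to
the infinite continued fraction with digits `x_i + 1`. -/
noncomputable def cfPi (x : ℕ → ℕ) : ℝ :=
  limUnder atTop (fun n : ℕ => finCF (List.ofFn fun i : Fin n => x i))

/-- The counting function `F_{k,n}(x) = #{1 ≤ i ≤ n : a_i(x) = k}`, expressed via the Gauss
map: `a_i(x) = k` iff `T^{i-1} x ∈ (1/(k+1), 1/k)`. -/
noncomputable def digitCount (k n : ℕ) (x : ℝ) : ℕ :=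
  Set.ncard {i : ℕ | i < n ∧ gaussMap^[i] x ∈ Set.Ioo (((k : ℝ) + 1)⁻¹) ((k : ℝ)⁻¹)}

/-- The potential `φ = -log |DT ∘ π|` on the full shift. -/
noncomputable def gaussPotential (x : ℕ → ℕ) : ℝ :=
  -Real.log |deriv gaussMap (cfPi x)|

/-- The infimum `inf {I(μ) : μ ∈ M, ∫ 1_{(1/(k+1),1/k)} d(μ∘π⁻¹) = α}` of the rate function of
Theorem A for the Gauss system (whose pressure is `0`) over the measures giving the digit `k`
asymptotic frequency `α`. -/
noncomputable def cfRateInf (k : ℕ) (α : ℝ) : EReal :=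
  ⨅ (μ : ProbabilityMeasure (ℕ → ℕ))
    (_ : ((Measure.map cfPi (μ : Measure (ℕ → ℕ)))
        (Set.Ioo (((k : ℝ) + 1)⁻¹) ((k : ℝ)⁻¹))).toReal = α),
    rateOf (freeEnergy fullShift gaussPotential 0) μ

namespace GaussLDP

/-- The inverse branch of the `n`-th iterate of the Gauss map coded by the first `n` digits
of `u`. -/
noncomputable def branch : ℕ → (ℕ → ℕ) → ℝ → ℝ
  | 0, _, y => y
  | n + 1, u, y => ((u 0 : ℝ) + 1 + branch n (fullShift u) y)⁻¹

/-- The inverse square root of the derivative of `branch`, that is the continuant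
`q_n + y q_{n-1}`. -/
noncomputable def contin : ℕ → (ℕ → ℕ) → ℝ → ℝ
  | 0, _, _ => 1
  | n + 1, u, y => ((u 0 : ℝ) + 1 + branch n (fullShift u) y) * contin n (fullShift u) y

/-- The length of the cylinder interval of the first `n` digits of `u`. -/
noncomputable def len (n : ℕ) (u : ℕ → ℕ) : ℝ := (contin n u 0 * contin n u 1)⁻¹

lemma fullShift_iterate (n : ℕ) (u : ℕ → ℕ) (i : ℕ) : (fullShift^[n] u) i = u (i + n) := by
  induction n generalizing u with
  | zero => rfl
  | succ n ih => rw [Function.iterate_succ_apply, ih]; simp [fullShift]; ring_nf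

lemma branch_nonneg (n : ℕ) (u : ℕ → ℕ) {y : ℝ} (hy : 0 ≤ y) : 0 ≤ branch n u y := by
  induction n generalizing u with
  | zero => exact hy
  | succ n ih => have := ih (fullShift u); simp only [branch]; positivity

lemma branch_le_one (n : ℕ) (u : ℕ → ℕ) {y : ℝ} (hy : 0 ≤ y) (hy1 : y ≤ 1) :
    branch n u y ≤ 1 := by
  cases n with
  | zero => exact hy1
  | succ n =>
    have := branch_nonneg n (fullShift u) hy
    simp only [branch]
    apply inv_le_one_of_one_le₀
    have : (0 : ℝ) ≤ u 0 := by positivity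
    linarith

lemma contin_pos (n : ℕ) (u : ℕ → ℕ) {y : ℝ} (hy : 0 ≤ y) : 0 < contin n u y := by
  induction n generalizing u with
  | zero => simp [contin]
  | succ n ih =>
    have := ih (fullShift u)
    have := branch_nonneg n (fullShift u) hy
    simp only [contin]; positivity

lemma branch_sub (n : ℕ) (u : ℕ → ℕ) {y z : ℝ} (hy : 0 ≤ y) (hz : 0 ≤ z) :
    |branch n u y - branch n u z| = |y - z| / (contin n u y * contin n u z) := by
  induction n generalizing u with
  | zero => simp [branch, contin]
  | succ n ih =>
    have h1 := branch_nonneg n (fullShift u) hy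
    have h2 := branch_nonneg n (fullShift u) hz
    have h3 := contin_pos n (fullShift u) hy
    have h4 := contin_pos n (fullShift u) hz
    have e : branch (n + 1) u y - branch (n + 1) u z
        = (branch n (fullShift u) z - branch n (fullShift u) y) /
          (((u 0 : ℝ) + 1 + branch n (fullShift u) y) *
            ((u 0 : ℝ) + 1 + branch n (fullShift u) z)) := by
      simp only [branch]; field_simp; ring
    have hp : 0 < ((u 0 : ℝ) + 1 + branch n (fullShift u) y) *
            ((u 0 : ℝ) + 1 + branch n (fullShift u) z) := by positivity
    rw [e, abs_div, abs_sub_comm, ih, abs_of_pos hp, div_div]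
    simp only [contin]
    congr 1; ring

lemma branch_add (n m : ℕ) (u : ℕ → ℕ) (y : ℝ) :
    branch (n + m) u y = branch n u (branch m (fullShift^[n] u) y) := by
  induction n generalizing u with
  | zero => simp [branch]
  | succ n ih =>
    rw [Nat.succ_add]; simp only [branch]; rw [ih, Function.iterate_succ_apply]

lemma contin_add (n m : ℕ) (u : ℕ → ℕ) (y : ℝ) :
    contin (n + m) u y
      = contin n u (branch m (fullShift^[n] u) y) * contin m (fullShift^[n] u) y := by
  induction n generalizing u with
  | zero => simp [contin]
  | succ n ih =>
    rw [Nat.succ_add]; simp only [contin]; rw [ih, branch_add, Function.iterate_succ_apply]; ring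

lemma contin_affine (n : ℕ) (u : ℕ → ℕ) :
    ∃ A B : ℝ, 1 ≤ A ∧ 0 ≤ B ∧ B ≤ A ∧ ((n : ℝ) ≤ A ∧ (n : ℝ) + 1 ≤ A + B) ∧
      ∀ y : ℝ, 0 ≤ y → contin n u y = A + y * B := by
  induction n with
  | zero => exact ⟨1, 0, by simp [contin]⟩
  | succ n ih =>
    obtain ⟨A, B, hA, hB, hBA, ⟨hn, hn'⟩, h⟩ := ih
    have hu : (0 : ℝ) ≤ u n := by positivity
    refine ⟨(u n + 1) * A + B, A, ?_, by linarith, ?_, ⟨?_, ?_⟩, fun y hy => ?_⟩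
    · nlinarith
    · nlinarith
    · push_cast; nlinarith
    · push_cast; nlinarith
    · rw [contin_add]
      have e : fullShift^[n] u 0 = u n := by rw [fullShift_iterate]; simp
      simp only [branch, contin, e]
      rw [h _ (by positivity)]
      field_simp
      ring

lemma contin_zero_le (n : ℕ) (u : ℕ → ℕ) {y : ℝ} (hy : 0 ≤ y) :
    contin n u 0 ≤ contin n u y := by
  obtain ⟨A, B, hA, hB, hBA, -, h⟩ := contin_affine n u
  rw [h _ hy, h _ le_rfl]; nlinarith

lemma contin_le_two_mul (n : ℕ) (u : ℕ → ℕ) {y : ℝ} (hy : 0 ≤ y) (hy1 : y ≤ 1) :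
    contin n u y ≤ 2 * contin n u 0 := by
  obtain ⟨A, B, hA, hB, hBA, -, h⟩ := contin_affine n u
  rw [h _ hy, h _ le_rfl]; nlinarith

lemma le_contin (n : ℕ) (u : ℕ → ℕ) {y : ℝ} (hy : 0 ≤ y) : (n : ℝ) ≤ contin n u y := by
  refine le_trans ?_ (contin_zero_le n u hy)
  obtain ⟨A, B, hA, hB, hBA, hn, h⟩ := contin_affine n u
  rw [h _ le_rfl]; linarith [hn.1]

lemma one_le_contin (n : ℕ) (u : ℕ → ℕ) {y : ℝ} (hy : 0 ≤ y) : 1 ≤ contin n u y := by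
  refine le_trans ?_ (contin_zero_le n u hy)
  obtain ⟨A, B, hA, hB, hBA, hn, h⟩ := contin_affine n u
  rw [h _ le_rfl]; linarith

lemma len_pos (n : ℕ) (u : ℕ → ℕ) : 0 < len n u :=
  inv_pos.2 (mul_pos (contin_pos n u le_rfl) (contin_pos n u zero_le_one))

lemma abs_branch_zero_sub_one (n : ℕ) (u : ℕ → ℕ) :
    |branch n u 0 - branch n u 1| = len n u := by
  rw [branch_sub n u le_rfl zero_le_one, len]; simp

lemma len_add_le (n m : ℕ) (u : ℕ → ℕ) :
    len (n + m) u ≤ 4 * (len n u * len m (fullShift^[n] u)) := by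
  set v := fullShift^[n] u
  have h0 := branch_nonneg m v le_rfl
  have h1 := branch_nonneg m v zero_le_one
  have p := contin_pos n u le_rfl
  have p1 := contin_pos n u zero_le_one
  have q := contin_pos m v le_rfl
  have q1 := contin_pos m v zero_le_one
  have a := contin_zero_le n u h0
  have b := contin_zero_le n u h1
  have c := contin_le_two_mul n u zero_le_one le_rfl
  have key : (contin n u 0 * contin n u 1) * (contin m v 0 * contin m v 1)
      ≤ 4 * (contin (n + m) u 0 * contin (n + m) u 1) := by
    rw [contin_add, contin_add]
    change _ ≤ 4 * (contin n u (branch m v 0) * contin m v 0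
      * (contin n u (branch m v 1) * contin m v 1))
    have : contin n u 0 * contin n u 1 ≤ 4 * (contin n u (branch m v 0) *
      contin n u (branch m v 1)) := by
      have d := p.le.trans a
      calc _ ≤ contin n u 0 * (2 * contin n u 0) := by gcongr
        _ ≤ 4 * (contin n u 0 * contin n u 0) := by nlinarith
        _ ≤ _ := by gcongr
    calc _ ≤ 4 * (contin n u (branch m v 0) * contin n u (branch m v 1))
          * (contin m v 0 * contin m v 1) := by gcongr
      _ = _ := by ring
  have s := contin_pos (n + m) u le_rfl
  have s1 := contin_pos (n + m) u zero_le_one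
  rw [len, len, len, ← mul_inv, ← div_eq_mul_inv, inv_eq_one_div,
    div_le_div_iff₀ (by positivity) (by positivity)]
  linarith

lemma len_mul_le (n m : ℕ) (u : ℕ → ℕ) :
    len n u * len m (fullShift^[n] u) ≤ 4 * len (n + m) u := by
  set v := fullShift^[n] u
  have h0 := branch_nonneg m v le_rfl
  have h1 := branch_nonneg m v zero_le_one
  have p := contin_pos n u le_rfl
  have p1 := contin_pos n u zero_le_one
  have q := contin_pos m v le_rfl
  have q1 := contin_pos m v zero_le_one
  have a := contin_le_two_mul n u h0 (branch_le_one m v le_rfl zero_le_one)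
  have b := contin_le_two_mul n u h1 (branch_le_one m v zero_le_one le_rfl)
  have c := contin_zero_le n u zero_le_one
  have key : (contin (n + m) u 0 * contin (n + m) u 1)
      ≤ 4 * ((contin n u 0 * contin n u 1) * (contin m v 0 * contin m v 1)) := by
    rw [contin_add, contin_add]
    change contin n u (branch m v 0) * contin m v 0
      * (contin n u (branch m v 1) * contin m v 1) ≤ _
    have : (contin n u (branch m v 0) *
      contin n u (branch m v 1)) ≤ 4 * (contin n u 0 * contin n u 1) := by
      have d := contin_pos n u h1
      calc _ ≤ (2 * contin n u 0) * (2 * contin n u 0) := by gcongr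
        _ ≤ (2 * contin n u 0) * (2 * contin n u 1) := by gcongr
        _ = _ := by ring
    calc _ = (contin n u (branch m v 0) * contin n u (branch m v 1))
          * (contin m v 0 * contin m v 1) := by ring
      _ ≤ 4 * (contin n u 0 * contin n u 1)
          * (contin m v 0 * contin m v 1) := by gcongr
      _ = _ := by ring
  have s := contin_pos (n + m) u le_rfl
  have s1 := contin_pos (n + m) u zero_le_one
  rw [len, len, len, ← mul_inv, ← div_eq_mul_inv, inv_eq_one_div,
    div_le_div_iff₀ (by positivity) (by positivity)]
  linarith

lemma branch_congr {n : ℕ} {u v : ℕ → ℕ} (h : ∀ i < n, u i = v i) (y : ℝ) :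
    branch n u y = branch n v y := by
  induction n generalizing u v with
  | zero => rfl
  | succ n ih =>
    simp only [branch]
    rw [h 0 (by omega), ih (u := fullShift u) (v := fullShift v)]
    intro i hi; exact h (i + 1) (by omega)

lemma contin_congr {n : ℕ} {u v : ℕ → ℕ} (h : ∀ i < n, u i = v i) (y : ℝ) :
    contin n u y = contin n v y := by
  induction n generalizing u v with
  | zero => rfl
  | succ n ih =>
    have h' : ∀ i < n, fullShift u i = fullShift v i := fun i hi => h (i + 1) (by omega)
    simp only [contin]
    rw [h 0 (by omega), ih h', branch_congr h']

lemma len_congr {n : ℕ} {u v : ℕ → ℕ} (h : ∀ i < n, u i = v i) : len n u = len n v := by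
  rw [len, len, contin_congr h, contin_congr h]

lemma finCF_ofFn (n : ℕ) (u : ℕ → ℕ) :
    finCF (List.ofFn fun i : Fin n => u i) = branch n u 0 := by
  induction n generalizing u with
  | zero => simp [finCF, branch]
  | succ n ih =>
    rw [List.ofFn_succ]
    simp only [finCF, branch]
    have := ih (fullShift u)
    simp only [fullShift] at this
    simp only [Fin.val_succ, Fin.val_zero]
    rw [this]

lemma tendsto_branch (u : ℕ → ℕ) :
    Tendsto (fun n => branch n u 0) atTop (𝓝 (cfPi u)) := by
  have hc : CauchySeq fun n => branch n u 0 := by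
    apply cauchySeq_of_le_tendsto_0 (fun n : ℕ => 4 * (1 / ((n : ℝ) + 1)))
    · intro n m N hn hm
      have key : ∀ n ≥ N, |branch n u 0 - branch N u 0| ≤ 2 * (1 / ((N : ℝ) + 1)) := by
        intro n hn
        obtain ⟨k, rfl⟩ := Nat.exists_eq_add_of_le hn
        have h0 := branch_nonneg k (fullShift^[N] u) le_rfl
        have h1 := branch_le_one k (fullShift^[N] u) le_rfl zero_le_one
        rw [branch_add, branch_sub N u h0 le_rfl]
        have p := one_le_contin N u h0
        have q := le_contin N u le_rfl
        have q' := one_le_contin N u le_rfl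
        rw [sub_zero, abs_of_nonneg h0, ← mul_div_assoc, div_le_div_iff₀ (by positivity)
          (by positivity)]
        nlinarith
      rw [Real.dist_eq]
      have := abs_sub_le (branch n u 0) (branch N u 0) (branch m u 0)
      have a := key n hn
      have b := key m hm
      rw [abs_sub_comm] at b
      linarith
    · simpa using (tendsto_one_div_add_atTop_nhds_zero_nat (𝕜 := ℝ)).const_mul 4
  have := hc.tendsto_limUnder
  simpa only [cfPi, finCF_ofFn] using this

lemma cfPi_nonneg (u : ℕ → ℕ) : 0 ≤ cfPi u :=
  ge_of_tendsto' (tendsto_branch u) fun n => branch_nonneg n u le_rfl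

lemma cfPi_le_one (u : ℕ → ℕ) : cfPi u ≤ 1 :=
  le_of_tendsto' (tendsto_branch u) fun n => branch_le_one n u le_rfl zero_le_one

lemma cfPi_eq (u : ℕ → ℕ) : cfPi u = ((u 0 : ℝ) + 1 + cfPi (fullShift u))⁻¹ := by
  have h1 := (tendsto_branch u).comp (tendsto_add_atTop_nat 1)
  have h2 : Tendsto (fun n => branch (n + 1) u 0) atTop
      (𝓝 ((u 0 : ℝ) + 1 + cfPi (fullShift u))⁻¹) := by
    simp only [branch]
    refine ((tendsto_branch (fullShift u)).const_add _).inv₀ ?_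
    have := cfPi_nonneg (fullShift u)
    positivity
  exact tendsto_nhds_unique h1 h2

lemma cfPi_pos (u : ℕ → ℕ) : 0 < cfPi u := by
  rw [cfPi_eq]; have := cfPi_nonneg (fullShift u); positivity

lemma cfPi_lt_one (u : ℕ → ℕ) : cfPi u < 1 := by
  rw [cfPi_eq]
  have := cfPi_pos (fullShift u)
  apply inv_lt_one_of_one_lt₀
  have : (0 : ℝ) ≤ u 0 := by positivity
  linarith

lemma cfPi_mem_Ioo_iff (u : ℕ → ℕ) {k : ℕ} (hk : 1 ≤ k) :
    cfPi u ∈ Ioo (((k : ℝ) + 1)⁻¹) ((k : ℝ)⁻¹) ↔ u 0 = k - 1 := by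
  have hk' : (0 : ℝ) < k := by exact_mod_cast hk
  have h0 := cfPi_pos (fullShift u)
  have h1 := cfPi_lt_one (fullShift u)
  rw [cfPi_eq, mem_Ioo, inv_lt_inv₀ (by positivity) (by positivity),
    inv_lt_inv₀ (by positivity) (by positivity)]
  constructor
  · rintro ⟨ha, hb⟩
    have ha' : (u 0 : ℝ) < k := by linarith
    have hb' : (k : ℝ) < u 0 + 2 := by linarith
    have ha2 : u 0 < k := by exact_mod_cast ha'
    have hb2 : k < u 0 + 2 := by exact_mod_cast hb'
    omega
  · intro h
    have : (k : ℝ) = u 0 + 1 := by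
      have : k = u 0 + 1 := by omega
      exact_mod_cast this
    constructor <;> linarith

lemma measurable_cfPi : Measurable cfPi := by
  refine measurable_of_tendsto_metrizable (f := fun n u => branch n u 0) ?_
    (tendsto_pi_nhds.2 tendsto_branch)
  intro n
  have hs : Measurable fullShift := measurable_pi_lambda _ fun i => measurable_pi_apply _
  induction n with
  | zero => exact measurable_const
  | succ n ih =>
    simp only [branch]
    have : Measurable fun u : ℕ → ℕ => (u 0 : ℝ) :=
      measurable_from_top.comp (measurable_pi_apply 0)
    exact ((this.add_const 1).add (ih.comp hs)).inv

lemma gaussPotential_eq (u : ℕ → ℕ) : gaussPotential u = 2 * Real.log (cfPi u) := by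
  have h0 := cfPi_pos u
  have h1 := cfPi_pos (fullShift u)
  have h2 := cfPi_lt_one (fullShift u)
  have e : (cfPi u)⁻¹ = (u 0 : ℝ) + 1 + cfPi (fullShift u) := by
    conv_lhs => rw [cfPi_eq]
    rw [inv_inv]
  have hd : HasDerivAt gaussMap (-((cfPi u) ^ 2)⁻¹) (cfPi u) := by
    have hi := (hasDerivAt_inv h0.ne').sub_const ((u 0 : ℝ) + 1)
    refine hi.congr_of_eventuallyEq ?_
    have hc : ContinuousAt (fun x : ℝ => x⁻¹) (cfPi u) := continuousAt_inv₀ h0.ne'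
    have : ∀ᶠ x in 𝓝 (cfPi u), x⁻¹ ∈ Ioo ((u 0 : ℝ) + 1) ((u 0 : ℝ) + 1 + 1) := by
      apply hc.eventually_mem
      apply Ioo_mem_nhds <;> linarith
    filter_upwards [this] with x hx
    have hf : ⌊x⁻¹⌋ = (u 0 : ℤ) + 1 := by
      rw [Int.floor_eq_iff]; push_cast; exact ⟨hx.1.le, hx.2⟩
    rw [gaussMap, Int.fract, hf]; push_cast; rfl
  rw [gaussPotential, hd.deriv, abs_neg, abs_of_pos (by positivity), Real.log_inv, Real.log_pow]
  push_cast; ring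

lemma measurable_gaussPotential : Measurable gaussPotential := by
  have : gaussPotential = fun u => 2 * Real.log (cfPi u) := funext gaussPotential_eq
  rw [this]
  exact (Real.measurable_log.comp measurable_cfPi).const_mul 2

lemma gaussPotential_nonpos (u : ℕ → ℕ) : gaussPotential u ≤ 0 := by
  rw [gaussPotential_eq]
  have := Real.log_nonpos (cfPi_nonneg u) (cfPi_le_one u)
  linarith

lemma sum_gaussPotential (n : ℕ) (u : ℕ → ℕ) :
    ∑ i ∈ Finset.range n, -gaussPotential (fullShift^[i] u)
      = 2 * Real.log (contin n u (cfPi (fullShift^[n] u))) := by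
  induction n generalizing u with
  | zero => simp [contin]
  | succ n ih =>
    rw [Finset.sum_range_succ']
    simp only [Function.iterate_succ_apply, Function.iterate_zero, id]
    rw [ih]
    have hb : ∀ n u, branch n u (cfPi (fullShift^[n] u)) = cfPi u := by
      intro n
      induction n with
      | zero => intro u; rfl
      | succ n ih => intro u; simp only [branch, Function.iterate_succ_apply]; rw [ih, ← cfPi_eq]
    simp only [contin]
    rw [hb]
    have h1 := cfPi_pos (fullShift u)
    have h2 := contin_pos n (fullShift u) (cfPi_nonneg (fullShift^[n] (fullShift u)))
    rw [Real.log_mul (by positivity) h2.ne', gaussPotential_eq, cfPi_eq u, Real.log_inv]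
    ring

lemma log_contin_le (n : ℕ) (u : ℕ → ℕ) {y : ℝ} (hy : 0 ≤ y) (hy1 : y ≤ 1) :
    |2 * Real.log (contin n u y) + Real.log (len n u)| ≤ 2 := by
  have h0 := contin_pos n u le_rfl
  have h1 := contin_pos n u zero_le_one
  have hp := contin_pos n u hy
  have a := Real.log_le_log h0 (contin_zero_le n u hy)
  have b := Real.log_le_log hp (contin_le_two_mul n u hy hy1)
  have c := Real.log_le_log h0 (contin_zero_le n u zero_le_one)
  have d := Real.log_le_log h1 (contin_le_two_mul n u zero_le_one le_rfl)
  rw [Real.log_mul two_ne_zero h0.ne'] at b d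
  have e := Real.log_two_lt_d9
  rw [len, Real.log_inv, Real.log_mul h0.ne' h1.ne', abs_le]
  constructor <;> linarith

lemma abs_sum_gaussPotential_le (n : ℕ) (u : ℕ → ℕ) :
    |∑ i ∈ Finset.range n, -gaussPotential (fullShift^[i] u) + Real.log (len n u)| ≤ 2 := by
  rw [sum_gaussPotential]
  exact log_contin_le n u (cfPi_nonneg _) (cfPi_le_one _)

/-- The digits of `x`, shifted by one. -/
noncomputable def digits (x : ℝ) : ℕ → ℕ := fun i => ⌊(gaussMap^[i] x)⁻¹⌋₊ - 1

/-- The set of sequences sharing the first `n` digits with `u`. -/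
def cyl (n : ℕ) (u : ℕ → ℕ) : Set (ℕ → ℕ) := {v | ∀ i < n, v i = u i}

/-- The number of the first `n` digits lying in `E`. -/
noncomputable def hits (E : Set ℕ) (n : ℕ) (u : ℕ → ℕ) : ℝ :=
  ∑ i ∈ Finset.range n, E.indicator 1 (u i)

/-- The law of the digits under Lebesgue measure. -/
noncomputable def lebLaw : Measure (ℕ → ℕ) := Measure.map digits (volume.restrict (Ioo 0 1))

/-- The Gauss measure on the real line. -/
noncomputable def gaussReal : Measure ℝ :=
  (volume.restrict (Ioo 0 1)).withDensity fun x => ENNReal.ofReal ((1 + x)⁻¹ / Real.log 2)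

/-- The law of the digits under the Gauss measure. -/
noncomputable def gaussLaw : Measure (ℕ → ℕ) := Measure.map digits gaussReal

lemma measurable_gaussMap : Measurable gaussMap := measurable_fract.comp measurable_inv

lemma measurable_digits : Measurable digits := by
  refine measurable_pi_lambda _ fun i => ?_
  have h : Measurable fun n : ℕ => n - 1 := measurable_from_top
  exact h.comp (Nat.measurable_floor.comp (measurable_gaussMap.iterate i).inv)

lemma measurable_fullShift : Measurable fullShift :=
  measurable_pi_lambda _ fun _ => measurable_pi_apply _

lemma irrational_gaussMap {x : ℝ} (hx : Irrational x) : Irrational (gaussMap x) := by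
  rw [gaussMap, Int.fract]; exact hx.inv.sub_intCast _

lemma gaussMap_mem {x : ℝ} (hx : Irrational x) : gaussMap x ∈ Ioo (0 : ℝ) 1 := by
  refine ⟨lt_of_le_of_ne (Int.fract_nonneg _) ?_, Int.fract_lt_one _⟩
  exact (irrational_gaussMap hx).ne_zero.symm

lemma digits_gaussMap (x : ℝ) : digits (gaussMap x) = fullShift (digits x) := by
  funext i; simp only [digits, fullShift, Function.iterate_succ_apply]

lemma inv_eq_digit {x : ℝ} (hx : x ∈ Ioo (0 : ℝ) 1) :
    x⁻¹ = (digits x 0 : ℝ) + 1 + gaussMap x := by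
  have h1 : 1 < x⁻¹ := (one_lt_inv₀ hx.1).2 hx.2
  have h2 : 1 ≤ ⌊x⁻¹⌋₊ := Nat.one_le_floor_iff _ |>.2 h1.le
  have h3 : ((⌊x⁻¹⌋₊ - 1 : ℕ) : ℝ) = ⌊x⁻¹⌋₊ - 1 := by push_cast [h2]; rfl
  simp only [digits, Function.iterate_zero, id, gaussMap, Int.fract]
  rw [h3, ← natCast_floor_eq_intCast_floor (by linarith : (0 : ℝ) ≤ x⁻¹)]
  ring

lemma digits_prefix_iff (n : ℕ) (u : ℕ → ℕ) {x : ℝ} (hx : x ∈ Ioo (0 : ℝ) 1)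
    (hi : Irrational x) :
    digits x ∈ cyl n u ↔ (x - branch n u 0) * (x - branch n u 1) < 0 := by
  induction n generalizing u x with
  | zero =>
    simp only [cyl, branch, sub_zero]
    simp only [not_lt_zero, false_imp_iff, implies_true, ofPred_true, mem_univ, true_iff]
    nlinarith [hx.1, hx.2]
  | succ n ih =>
    have ih' := ih (fullShift u) (gaussMap_mem hi) (irrational_gaussMap hi)
    have e := inv_eq_digit hx
    obtain ⟨t0, t1⟩ := gaussMap_mem hi
    set t := gaussMap x with ht
    have hs : digits x ∈ cyl (n + 1) u ↔
        digits x 0 = u 0 ∧ digits t ∈ cyl n (fullShift u) := by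
      rw [ht, digits_gaussMap]
      constructor
      · intro h; exact ⟨h 0 (by omega), fun i hi => h (i + 1) (by omega)⟩
      · rintro ⟨h0, h⟩ i hi
        cases i with
        | zero => exact h0
        | succ i => exact h i (by omega)
    rw [hs, ih']
    have a0 := branch_nonneg n (fullShift u) le_rfl
    have a1 := branch_le_one n (fullShift u) le_rfl zero_le_one
    have b0 := branch_nonneg n (fullShift u) zero_le_one
    have b1 := branch_le_one n (fullShift u) zero_le_one le_rfl
    set a := branch n (fullShift u) 0
    set b := branch n (fullShift u) 1
    have hxe : x = ((digits x 0 : ℝ) + 1 + t)⁻¹ := by rw [← e, inv_inv]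
    set d := digits x 0
    have hd : (0 : ℝ) ≤ d := by positivity
    have hu : (0 : ℝ) ≤ u 0 := by positivity
    simp only [branch]
    change d = u 0 ∧ (t - a) * (t - b) < 0 ↔
      (x - ((u 0 : ℝ) + 1 + a)⁻¹) * (x - ((u 0 : ℝ) + 1 + b)⁻¹) < 0
    have key : (x - ((u 0 : ℝ) + 1 + a)⁻¹) * (x - ((u 0 : ℝ) + 1 + b)⁻¹) =
        ((u 0 - d + (a - t)) * (u 0 - d + (b - t))) /
          (((d : ℝ) + 1 + t) ^ 2 * (((u 0 : ℝ) + 1 + a) * ((u 0 : ℝ) + 1 + b))) := by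
      have : (d : ℝ) + 1 + t ≠ 0 := by positivity
      have : (u 0 : ℝ) + 1 + a ≠ 0 := by positivity
      have : (u 0 : ℝ) + 1 + b ≠ 0 := by positivity
      rw [hxe]; field_simp; ring
    have hpos : 0 < ((d : ℝ) + 1 + t) ^ 2 * (((u 0 : ℝ) + 1 + a) * ((u 0 : ℝ) + 1 + b)) := by
      positivity
    rw [key, div_neg_iff]
    constructor
    · rintro ⟨h, hneg⟩
      right
      refine ⟨?_, hpos⟩
      rw [h]; nlinarith
    · rintro (⟨_, h⟩ | ⟨h, _⟩)
      · exact absurd h (not_lt.2 hpos.le)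
      · have hdu : d = u 0 := by
          rcases lt_trichotomy d (u 0) with hl | hl | hl
          · exfalso
            have : (d : ℝ) + 1 ≤ u 0 := by exact_mod_cast hl
            have h1 : 0 ≤ (u 0 : ℝ) - d + (a - t) := by linarith
            have h2 : 0 ≤ (u 0 : ℝ) - d + (b - t) := by linarith
            nlinarith [mul_nonneg h1 h2]
          · exact hl
          · exfalso
            have : (u 0 : ℝ) + 1 ≤ d := by exact_mod_cast hl
            have h1 : (u 0 : ℝ) - d + (a - t) ≤ 0 := by linarith
            have h2 : (u 0 : ℝ) - d + (b - t) ≤ 0 := by linarith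
            nlinarith [mul_nonneg_of_nonpos_of_nonpos h1 h2]
        refine ⟨hdu, ?_⟩
        rw [hdu] at h; nlinarith

lemma irrational_ae : ∀ᵐ x : ℝ, Irrational x := by
  have : (range ((↑) : ℚ → ℝ)).Countable := countable_range _
  simpa only [ae_iff, Irrational, not_not, Set.ofPred_mem_eq] using this.measure_zero volume

lemma digitCount_eq {k : ℕ} (hk : 1 ≤ k) (n : ℕ) {x : ℝ} (hx : x ∈ Ioo (0 : ℝ) 1)
    (hi : Irrational x) : (digitCount k n x : ℝ) = hits {k - 1} n (digits x) := by
  classical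
  have hT : ∀ i, gaussMap^[i] x ∈ Ioo (0 : ℝ) 1 ∧ Irrational (gaussMap^[i] x) := by
    intro i
    induction i with
    | zero => exact ⟨hx, hi⟩
    | succ i ih =>
      rw [Function.iterate_succ_apply']
      exact ⟨gaussMap_mem ih.2, irrational_gaussMap ih.2⟩
  have hk' : (0 : ℝ) < k := by exact_mod_cast hk
  have hmem : ∀ i, gaussMap^[i] x ∈ Ioo (((k : ℝ) + 1)⁻¹) ((k : ℝ)⁻¹) ↔
      digits x i = k - 1 := by
    intro i
    obtain ⟨h1, h2⟩ := hT i
    have e := inv_eq_digit h1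
    obtain ⟨t0, t1⟩ := gaussMap_mem h2
    have hd : digits (gaussMap^[i] x) 0 = digits x i := by simp [digits]
    rw [hd] at e
    have e' : gaussMap^[i] x = ((digits x i : ℝ) + 1 + gaussMap (gaussMap^[i] x))⁻¹ := by
      rw [← e, inv_inv]
    rw [e', mem_Ioo, inv_lt_inv₀ (by positivity) (by positivity),
      inv_lt_inv₀ (by positivity) (by positivity)]
    constructor
    · rintro ⟨ha, hb⟩
      have ha' : (digits x i : ℝ) < k := by linarith
      have hb' : (k : ℝ) < digits x i + 2 := by linarith
      have ha2 : digits x i < k := by exact_mod_cast ha'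
      have hb2 : k < digits x i + 2 := by exact_mod_cast hb'
      omega
    · intro h
      have : (k : ℝ) = digits x i + 1 := by
        have : k = digits x i + 1 := by omega
        exact_mod_cast this
      constructor <;> linarith
  have hset : {i : ℕ | i < n ∧ gaussMap^[i] x ∈ Ioo (((k : ℝ) + 1)⁻¹) ((k : ℝ)⁻¹)} =
      ((Finset.range n).filter fun i => digits x i = k - 1 : Finset ℕ) := by
    ext i; simp only [mem_ofPred_eq, hmem, Finset.coe_filter, Finset.mem_range]
  rw [digitCount, hset, ncard_coe_finset, Finset.card_filter]
  push_cast
  simp [hits, indicator_apply]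

lemma measurableSet_cyl (n : ℕ) (u : ℕ → ℕ) : MeasurableSet (cyl n u) := by
  have : cyl n u = ⋂ i, ⋂ (_ : i < n), (fun v : ℕ → ℕ => v i) ⁻¹' {u i} := by
    ext v; simp [cyl]
  rw [this]
  exact MeasurableSet.iInter fun i => MeasurableSet.iInter fun _ =>
    measurable_pi_apply i (measurableSet_singleton _)

lemma map_digits_cyl {μ : Measure ℝ} (hμ : μ ≪ volume.restrict (Ioo (0 : ℝ) 1)) (n : ℕ)
    (u : ℕ → ℕ) :
    Measure.map digits μ (cyl n u)
      = μ (Ioo (min (branch n u 0) (branch n u 1)) (max (branch n u 0) (branch n u 1))) := by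
  rw [Measure.map_apply measurable_digits (measurableSet_cyl n u)]
  apply measure_congr
  have h1 : ∀ᵐ x ∂(volume.restrict (Ioo (0 : ℝ) 1)), x ∈ Ioo (0 : ℝ) 1 ∧ Irrational x :=
    (ae_restrict_mem measurableSet_Ioo).and (ae_restrict_of_ae irrational_ae)
  filter_upwards [hμ.ae_le h1] with x hx
  apply propext
  change digits x ∈ cyl n u ↔ x ∈ Ioo _ _
  rw [digits_prefix_iff n u hx.1 hx.2, mem_Ioo, min_lt_iff, lt_max_iff, mul_neg_iff]
  constructor
  · rintro (h | h)
    · exact ⟨Or.inl (by linarith), Or.inr (by linarith)⟩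
    · exact ⟨Or.inr (by linarith), Or.inl (by linarith)⟩
  · rintro ⟨h1 | h1, h2 | h2⟩
    · linarith
    · exact Or.inl ⟨by linarith, by linarith⟩
    · exact Or.inr ⟨by linarith, by linarith⟩
    · linarith

lemma Ioo_branch_subset (n : ℕ) (u : ℕ → ℕ) :
    Ioo (min (branch n u 0) (branch n u 1)) (max (branch n u 0) (branch n u 1)) ⊆ Ioo 0 1 :=
  Ioo_subset_Ioo (le_min (branch_nonneg n u le_rfl) (branch_nonneg n u zero_le_one))
    (max_le (branch_le_one n u le_rfl zero_le_one) (branch_le_one n u zero_le_one le_rfl))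

lemma lebLaw_cyl (n : ℕ) (u : ℕ → ℕ) : lebLaw (cyl n u) = ENNReal.ofReal (len n u) := by
  rw [lebLaw, map_digits_cyl Measure.AbsolutelyContinuous.rfl,
    Measure.restrict_apply measurableSet_Ioo, inter_eq_left.2 (Ioo_branch_subset n u),
    Real.volume_Ioo, max_sub_min_eq_abs, abs_sub_comm, abs_branch_zero_sub_one]

lemma gaussReal_Ioo {a b : ℝ} (ha : 0 ≤ a) (hab : a ≤ b) (hb : b ≤ 1) :
    gaussReal (Ioo a b) = ENNReal.ofReal ((Real.log (1 + b) - Real.log (1 + a)) / Real.log 2) := by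
  have hl : 0 < Real.log 2 := Real.log_pos one_lt_two
  rw [gaussReal, withDensity_apply _ measurableSet_Ioo,
    Measure.restrict_restrict measurableSet_Ioo, inter_eq_left.2 (Ioo_subset_Ioo ha hb),
    restrict_Ioo_eq_restrict_Ioc]
  have hcont : ContinuousOn (fun x : ℝ => (1 + x)⁻¹ / Real.log 2) (uIcc a b) := by
    rw [uIcc_of_le hab]
    refine ContinuousOn.div_const (ContinuousOn.inv₀ (by fun_prop) ?_) _
    intro x hx
    have h1 : 0 < 1 + x := by linarith [hx.1]
    exact h1.ne'
  have hInt := hcont.intervalIntegrable (μ := volume)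
  rw [← ofReal_integral_eq_lintegral_ofReal]
  · rw [← intervalIntegral.integral_of_le hab]
    congr 1
    have : ∀ x ∈ uIcc a b, HasDerivAt (fun x => Real.log (1 + x) / Real.log 2)
        ((1 + x)⁻¹ / Real.log 2) x := by
      intro x hx
      rw [uIcc_of_le hab] at hx
      have := hx.1
      have h := ((hasDerivAt_id x).const_add 1).log (by simp; linarith)
      simpa [one_div] using h.div_const (Real.log 2)
    rw [intervalIntegral.integral_eq_sub_of_hasDerivAt this hInt]
    ring
  · rwa [intervalIntegrable_iff_integrableOn_Ioc_of_le hab] at hInt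
  · filter_upwards [ae_restrict_mem measurableSet_Ioc] with x hx
    have := hx.1
    have : 0 < 1 + x := by linarith
    simp only [Pi.zero_apply]
    positivity

lemma gaussLaw_cyl (n : ℕ) (u : ℕ → ℕ) : gaussLaw (cyl n u) =
    ENNReal.ofReal (|Real.log (1 + branch n u 0) - Real.log (1 + branch n u 1)| / Real.log 2) := by
  have h0 := branch_nonneg n u le_rfl
  have h1 := branch_le_one n u le_rfl zero_le_one
  have h2 := branch_nonneg n u zero_le_one
  have h3 := branch_le_one n u zero_le_one le_rfl
  rw [gaussLaw, map_digits_cyl (μ := gaussReal) (withDensity_absolutelyContinuous _ _),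
    gaussReal_Ioo (le_min h0 h2) min_le_max (max_le h1 h3)]
  congr 2
  rcases le_total (branch n u 0) (branch n u 1) with h | h
  · rw [max_eq_right h, min_eq_left h, abs_sub_comm, abs_of_nonneg]
    have := Real.log_le_log (by positivity : 0 < 1 + branch n u 0) (add_le_add_right h 1)
    linarith
  · rw [max_eq_left h, min_eq_right h, abs_of_nonneg]
    have := Real.log_le_log (by positivity : 0 < 1 + branch n u 1) (add_le_add_right h 1)
    linarith

lemma cyl_zero (u : ℕ → ℕ) : cyl 0 u = univ := by ext; simp [cyl]

instance : IsProbabilityMeasure lebLaw :=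
  ⟨by rw [← cyl_zero 0, lebLaw_cyl]; simp [len, contin]⟩

instance : IsProbabilityMeasure gaussLaw :=
  ⟨by
    have hl : 0 < Real.log 2 := Real.log_pos one_lt_two
    rw [← cyl_zero 0, gaussLaw_cyl]; norm_num [branch]
    rw [abs_of_pos hl, div_self hl.ne']⟩

/-- The word of the first `n` digits. -/
def pre (n : ℕ) (u : ℕ → ℕ) : Fin n → ℕ := fun i => u i

/-- The extension of a finite word by zeros. -/
def ext {n : ℕ} (w : Fin n → ℕ) : ℕ → ℕ := fun i => if h : i < n then w ⟨i, h⟩ else 0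

lemma measurable_pre (n : ℕ) : Measurable (pre n) :=
  measurable_pi_lambda _ fun _ => measurable_pi_apply _

lemma preimage_pre_singleton {n : ℕ} (w : Fin n → ℕ) : pre n ⁻¹' {w} = cyl n (ext w) := by
  ext u
  simp only [mem_preimage, mem_singleton_iff, cyl, mem_ofPred_eq, funext_iff, pre]
  constructor
  · intro h i hi; rw [show u i = w ⟨i, hi⟩ from h ⟨i, hi⟩]; simp [ext, hi]
  · intro h i; rw [h i i.2]; simp [ext]

lemma ext_pre {n : ℕ} (u : ℕ → ℕ) : ∀ i < n, ext (pre n u) i = u i := by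
  intro i hi; simp [ext, pre, hi]

/-- The sets depending on finitely many digits. -/
def cylRing : Set (Set (ℕ → ℕ)) := {B | ∃ n, ∃ s : Set (Fin n → ℕ), B = pre n ⁻¹' s}

lemma exists_preimage_pre_of_le {n N : ℕ} (h : n ≤ N) (s : Set (Fin n → ℕ)) :
    ∃ t : Set (Fin N → ℕ), pre n ⁻¹' s = pre N ⁻¹' t :=
  ⟨(fun w i => w (Fin.castLE h i)) ⁻¹' s, rfl⟩

lemma isSetRing_cylRing : IsSetRing cylRing where
  empty_mem := ⟨0, ∅, rfl⟩
  union_mem := by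
    rintro _ _ ⟨n, s, rfl⟩ ⟨m, t, rfl⟩
    obtain ⟨s', hs⟩ := exists_preimage_pre_of_le (le_max_left n m) s
    obtain ⟨t', ht⟩ := exists_preimage_pre_of_le (le_max_right n m) t
    exact ⟨max n m, s' ∪ t', by rw [hs, ht]; rfl⟩
  sdiff_mem := by
    rintro _ _ ⟨n, s, rfl⟩ ⟨m, t, rfl⟩
    obtain ⟨s', hs⟩ := exists_preimage_pre_of_le (le_max_left n m) s
    obtain ⟨t', ht⟩ := exists_preimage_pre_of_le (le_max_right n m) t
    exact ⟨max n m, s' \ t', by rw [hs, ht]; rfl⟩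

lemma generateFrom_cylRing :
    (MeasurableSpace.pi : MeasurableSpace (ℕ → ℕ)) = MeasurableSpace.generateFrom cylRing := by
  apply le_antisymm
  · refine iSup_le fun i => ?_
    rintro _ ⟨t, -, rfl⟩
    exact MeasurableSpace.measurableSet_generateFrom
      ⟨i + 1, {w | w ⟨i, by omega⟩ ∈ t}, rfl⟩
  · refine MeasurableSpace.generateFrom_le ?_
    rintro _ ⟨n, s, rfl⟩
    exact measurable_pre n s.to_countable.measurableSet

lemma exists_pre_approx (μ : Measure (ℕ → ℕ)) [IsFiniteMeasure μ] {B : Set (ℕ → ℕ)}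
    (hB : MeasurableSet B) {ε : ℝ≥0∞} (hε : 0 < ε) :
    ∃ n, ∃ s : Set (Fin n → ℕ), μ (symmDiff (pre n ⁻¹' s) B) < ε := by
  obtain ⟨_, ⟨n, s, rfl⟩, h⟩ := exists_measure_symmDiff_lt_of_generateFrom_isSetRing (μ := μ)
    isSetRing_cylRing ⟨{univ}, countable_singleton _, by
      rintro _ rfl; exact ⟨0, univ, rfl⟩, by simp⟩ generateFrom_cylRing hB hε
  exact ⟨n, s, h⟩

lemma measure_le_of_cyl_le {μ ν : Measure (ℕ → ℕ)} [IsFiniteMeasure μ] [IsFiniteMeasure ν]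
    (h : ∀ n u, μ (cyl n u) ≤ ν (cyl n u)) : μ ≤ ν := by
  have hs : ∀ n, ∀ s : Set (Fin n → ℕ), μ (pre n ⁻¹' s) ≤ ν (pre n ⁻¹' s) := by
    intro n s
    have e : ∀ ρ : Measure (ℕ → ℕ), ρ (pre n ⁻¹' s) =
        ∑' w : s, ρ (pre n ⁻¹' {(w : Fin n → ℕ)}) := by
      intro ρ
      rw [tsum_measure_preimage_singleton s.to_countable
        (fun w _ => measurable_pre n (measurableSet_singleton w))]
    rw [e, e]
    refine ENNReal.tsum_le_tsum fun w => ?_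
    rw [preimage_pre_singleton]
    exact h _ _
  refine Measure.le_iff.2 fun B hB => ?_
  refine ENNReal.le_of_forall_pos_le_add fun ε hε _ => ?_
  obtain ⟨n, s, hlt⟩ := exists_pre_approx (μ + ν) hB
    (ε := (ε : ℝ≥0∞) / 2) (by simpa using hε.ne')
  have h1 : μ (symmDiff (pre n ⁻¹' s) B) ≤ (ε : ℝ≥0∞) / 2 :=
    le_trans (by simp) hlt.le
  have h2 : ν (symmDiff (pre n ⁻¹' s) B) ≤ (ε : ℝ≥0∞) / 2 :=
    le_trans (by simp) hlt.le
  calc μ B ≤ μ (pre n ⁻¹' s ∪ symmDiff (pre n ⁻¹' s) B) := by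
        apply measure_mono; intro x hx
        by_cases hx' : x ∈ pre n ⁻¹' s
        · exact Or.inl hx'
        · exact Or.inr (Or.inr ⟨hx, hx'⟩)
    _ ≤ μ (pre n ⁻¹' s) + ε / 2 := (measure_union_le _ _).trans (by gcongr)
    _ ≤ ν (pre n ⁻¹' s) + ε / 2 := add_le_add_left (hs n s) _
    _ ≤ ν (B ∪ symmDiff (pre n ⁻¹' s) B) + ε / 2 := by
        gcongr; intro x hx
        by_cases hx' : x ∈ B
        · exact Or.inl hx'
        · exact Or.inr (Or.inl ⟨hx, hx'⟩)
    _ ≤ (ν B + ε / 2) + ε / 2 := by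
        gcongr; exact (measure_union_le _ _).trans (by gcongr)
    _ = ν B + ε := by rw [add_assoc, ENNReal.add_halves]

lemma measure_eq_of_cyl_eq {μ ν : Measure (ℕ → ℕ)} [IsFiniteMeasure μ] [IsFiniteMeasure ν]
    (h : ∀ n u, μ (cyl n u) = ν (cyl n u)) : μ = ν :=
  le_antisymm (measure_le_of_cyl_le fun n u => (h n u).le)
    (measure_le_of_cyl_le fun n u => (h n u).ge)

lemma cyl_inter_preimage (n m : ℕ) (u v : ℕ → ℕ) :
    ∃ z : ℕ → ℕ, (∀ i < n, z i = u i) ∧ (∀ i < m, fullShift^[n] z i = v i) ∧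
      (fullShift^[n] ⁻¹' cyl m v) ∩ cyl n u = cyl (n + m) z := by
  have hz : ∀ i < n, (fun i => if i < n then u i else v (i - n)) i = u i := by
    intro i hi; simp [hi]
  have hz' : ∀ i < m, fullShift^[n] (fun i => if i < n then u i else v (i - n)) i = v i := by
    intro i hi; rw [fullShift_iterate]; simp
  refine ⟨fun i => if i < n then u i else v (i - n), hz, hz', ?_⟩
  ext x
  simp only [mem_inter_iff, mem_preimage, cyl, mem_ofPred_eq, fullShift_iterate]
  constructor
  · rintro ⟨h1, h2⟩ i hi
    by_cases hin : i < n
    · simp [hin, h2 i hin]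
    · have := h1 (i - n) (by omega)
      rw [Nat.sub_add_cancel (by omega)] at this
      simp [hin, this]
  · intro h
    refine ⟨fun i hi => ?_, fun i hi => ?_⟩
    · rw [h (i + n) (by omega)]; simp
    · rw [h i (by omega)]; simp [hi]

lemma map_restrict_cyl_le (n : ℕ) (u : ℕ → ℕ) :
    Measure.map fullShift^[n] (lebLaw.restrict (cyl n u)) ≤ (4 * lebLaw (cyl n u)) • lebLaw := by
  have hfin : 4 * lebLaw (cyl n u) ≠ ∞ := ENNReal.mul_ne_top (by simp) (measure_ne_top _ _)
  have : IsFiniteMeasure ((4 * lebLaw (cyl n u)) • lebLaw) := Measure.smul_finite _ hfin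
  refine measure_le_of_cyl_le fun m v => ?_
  obtain ⟨z, hz1, hz2, hz⟩ := cyl_inter_preimage n m u v
  rw [Measure.map_apply (measurable_fullShift.iterate n) (measurableSet_cyl m v),
    Measure.restrict_apply (measurable_fullShift.iterate n (measurableSet_cyl m v)), hz,
    Measure.smul_apply, smul_eq_mul, lebLaw_cyl, lebLaw_cyl, lebLaw_cyl, mul_assoc,
    ← ENNReal.ofReal_mul (len_pos _ _).le,
    show (4 : ℝ≥0∞) = ENNReal.ofReal 4 by simp, ← ENNReal.ofReal_mul (by norm_num)]
  apply ENNReal.ofReal_le_ofReal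
  have := len_add_le n m z
  rwa [len_congr hz1, len_congr hz2] at this

lemma le_map_restrict_cyl (n : ℕ) (u : ℕ → ℕ) :
    lebLaw (cyl n u) • lebLaw
      ≤ (4 : ℝ≥0∞) • Measure.map fullShift^[n] (lebLaw.restrict (cyl n u)) := by
  have : IsFiniteMeasure (lebLaw (cyl n u) • lebLaw) := Measure.smul_finite _ (measure_ne_top _ _)
  have : IsFiniteMeasure ((4 : ℝ≥0∞) • Measure.map fullShift^[n] (lebLaw.restrict (cyl n u))) :=
    Measure.smul_finite _ (by simp)
  refine measure_le_of_cyl_le fun m v => ?_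
  obtain ⟨z, hz1, hz2, hz⟩ := cyl_inter_preimage n m u v
  rw [Measure.smul_apply, Measure.smul_apply,
    Measure.map_apply (measurable_fullShift.iterate n) (measurableSet_cyl m v),
    Measure.restrict_apply (measurable_fullShift.iterate n (measurableSet_cyl m v)), hz,
    smul_eq_mul, smul_eq_mul, lebLaw_cyl, lebLaw_cyl, lebLaw_cyl,
    ← ENNReal.ofReal_mul (len_pos _ _).le,
    show (4 : ℝ≥0∞) = ENNReal.ofReal 4 by simp, ← ENNReal.ofReal_mul (by norm_num)]
  apply ENNReal.ofReal_le_ofReal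
  have := len_mul_le n m z
  rwa [len_congr hz1, len_congr hz2] at this

lemma lintegral_pre (μ : Measure (ℕ → ℕ)) (n : ℕ) (f : (Fin n → ℕ) → ℝ≥0∞)
    {g : (ℕ → ℕ) → ℝ≥0∞} (hg : Measurable g) :
    ∫⁻ x, f (pre n x) * g x ∂μ = ∑' w, f w * ∫⁻ x in cyl n (ext w), g x ∂μ := by
  have hu : (⋃ w : Fin n → ℕ, pre n ⁻¹' {w}) = univ := by ext; simp
  rw [← setLIntegral_univ, ← hu, lintegral_iUnion
    (fun w => measurable_pre n (measurableSet_singleton w))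
    (fun w w' h => Disjoint.preimage _ (by simpa using h))]
  congr 1; funext w
  rw [← preimage_pre_singleton, setLIntegral_congr_fun (g := fun x => f w * g x)
    (measurable_pre n (measurableSet_singleton w))
    (fun x hx => by simp only [mem_preimage, mem_singleton_iff] at hx; simp [hx]),
    lintegral_const_mul _ hg]

lemma lintegral_pre_mul_shift_le (n : ℕ) (f : (Fin n → ℕ) → ℝ≥0∞) {g : (ℕ → ℕ) → ℝ≥0∞}
    (hg : Measurable g) :
    ∫⁻ x, f (pre n x) * g (fullShift^[n] x) ∂lebLaw
      ≤ 4 * ((∫⁻ x, f (pre n x) ∂lebLaw) * ∫⁻ x, g x ∂lebLaw) := by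
  have h1 := lintegral_pre lebLaw n f (g := fun _ => 1) measurable_const
  simp only [mul_one, lintegral_one, Measure.restrict_apply_univ] at h1
  rw [lintegral_pre lebLaw n f (g := fun x => g (fullShift^[n] x))
    (hg.comp (measurable_fullShift.iterate n)), h1, ← mul_assoc,
    ← ENNReal.tsum_mul_left, ← ENNReal.tsum_mul_right]
  refine ENNReal.tsum_le_tsum fun w => ?_
  rw [← lintegral_map hg (measurable_fullShift.iterate n)]
  have := lintegral_mono' (map_restrict_cyl_le n (ext w)) (le_refl g)
  rw [lintegral_smul_measure, smul_eq_mul] at this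
  calc _ ≤ f w * (4 * lebLaw (cyl n (ext w)) * ∫⁻ x, g x ∂lebLaw) := by gcongr
    _ = _ := by ring

lemma lintegral_mul_le_pre_mul_shift (n : ℕ) (f : (Fin n → ℕ) → ℝ≥0∞) {g : (ℕ → ℕ) → ℝ≥0∞}
    (hg : Measurable g) :
    (∫⁻ x, f (pre n x) ∂lebLaw) * ∫⁻ x, g x ∂lebLaw
      ≤ 4 * ∫⁻ x, f (pre n x) * g (fullShift^[n] x) ∂lebLaw := by
  have h1 := lintegral_pre lebLaw n f (g := fun _ => 1) measurable_const
  simp only [mul_one, lintegral_one, Measure.restrict_apply_univ] at h1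
  rw [lintegral_pre lebLaw n f (g := fun x => g (fullShift^[n] x))
    (hg.comp (measurable_fullShift.iterate n)), h1,
    ← ENNReal.tsum_mul_left, ← ENNReal.tsum_mul_right]
  refine ENNReal.tsum_le_tsum fun w => ?_
  rw [← lintegral_map hg (measurable_fullShift.iterate n)]
  have := lintegral_mono' (le_map_restrict_cyl n (ext w)) (le_refl g)
  rw [lintegral_smul_measure, lintegral_smul_measure, smul_eq_mul, smul_eq_mul] at this
  calc _ = f w * (lebLaw (cyl n (ext w)) * ∫⁻ x, g x ∂lebLaw) := by ring
    _ ≤ f w * (4 * _) := by gcongr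
    _ = _ := by ring

/-- Prepend a digit. -/
def cons (a : ℕ) (u : ℕ → ℕ) : ℕ → ℕ
  | 0 => a
  | i + 1 => u i

lemma preimage_fullShift_cyl (n : ℕ) (u : ℕ → ℕ) :
    fullShift ⁻¹' cyl n u = ⋃ a, cyl (n + 1) (cons a u) := by
  ext x
  simp only [mem_preimage, cyl, mem_ofPred_eq, mem_iUnion, fullShift]
  constructor
  · intro h
    refine ⟨x 0, fun i hi => ?_⟩
    cases i with
    | zero => rfl
    | succ i => exact h i (by omega)
  · rintro ⟨a, h⟩ i hi
    exact h (i + 1) (by omega)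

lemma hasSum_log_branches {s t : ℝ} (hs : 0 ≤ s) (ht : 0 ≤ t) :
    HasSum (fun a : ℕ => |Real.log (1 + ((a : ℝ) + 1 + s)⁻¹) - Real.log (1 + ((a : ℝ) + 1 + t)⁻¹)|)
      |Real.log (1 + s) - Real.log (1 + t)| := by
  wlog hst : s ≤ t generalizing s t
  · have := this ht hs (le_of_not_ge hst)
    simpa only [abs_sub_comm] using this
  have key : ∀ x : ℝ, 0 ≤ x → ∀ a : ℕ, Real.log (1 + ((a : ℝ) + 1 + x)⁻¹)
      = Real.log (((a + 1 : ℕ) : ℝ) + 1 + x) - Real.log ((a : ℝ) + 1 + x) := by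
    intro x hx a
    rw [← Real.log_div (by positivity) (by positivity)]
    congr 1
    push_cast
    field_simp
    ring
  have hpos : ∀ a : ℕ, 0 ≤ Real.log (1 + ((a : ℝ) + 1 + s)⁻¹)
      - Real.log (1 + ((a : ℝ) + 1 + t)⁻¹) := by
    intro a
    have : Real.log (1 + ((a : ℝ) + 1 + t)⁻¹) ≤ Real.log (1 + ((a : ℝ) + 1 + s)⁻¹) := by
      apply Real.log_le_log (by positivity)
      gcongr
    linarith
  have h0 : Real.log (1 + s) ≤ Real.log (1 + t) := Real.log_le_log (by positivity) (by linarith)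
  rw [hasSum_iff_tendsto_nat_of_nonneg (fun _ => abs_nonneg _), abs_sub_comm,
    abs_of_nonneg (by linarith)]
  have hsum : ∀ n : ℕ, ∑ a ∈ Finset.range n,
      |Real.log (1 + ((a : ℝ) + 1 + s)⁻¹) - Real.log (1 + ((a : ℝ) + 1 + t)⁻¹)|
      = (Real.log (1 + t) - Real.log (1 + s))
        - Real.log (((n : ℝ) + 1 + t) / ((n : ℝ) + 1 + s)) := by
    intro n
    rw [Real.log_div (by positivity) (by positivity)]
    induction n with
    | zero => simp
    | succ n ih =>
      rw [Finset.sum_range_succ, ih, abs_of_nonneg (hpos n), key s hs, key t ht]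
      ring
  simp_rw [hsum]
  have hlim : Tendsto (fun n : ℕ => Real.log (((n : ℝ) + 1 + t) / ((n : ℝ) + 1 + s))) atTop
      (𝓝 0) := by
    have h1 : Tendsto (fun n : ℕ => (t - s) * (1 / ((n : ℝ) + 1))) atTop (𝓝 ((t - s) * 0)) :=
      tendsto_one_div_add_atTop_nhds_zero_nat.const_mul _
    rw [mul_zero] at h1
    refine squeeze_zero (fun n => Real.log_nonneg ?_) (fun n => ?_) h1
    · rw [one_le_div (by positivity)]; linarith
    · refine (Real.log_le_sub_one_of_pos (by positivity)).trans ?_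
      have e : ((n : ℝ) + 1 + t) / ((n : ℝ) + 1 + s) - 1 = (t - s) * (1 / ((n : ℝ) + 1 + s)) := by
        field_simp; ring
      rw [e]
      refine mul_le_mul_of_nonneg_left ?_ (by linarith)
      exact one_div_le_one_div_of_le (by positivity) (by linarith)
  simpa using hlim.const_sub (Real.log (1 + t) - Real.log (1 + s))

lemma measurePreserving_fullShift : MeasurePreserving fullShift gaussLaw gaussLaw := by
  refine ⟨measurable_fullShift, ?_⟩
  have : IsProbabilityMeasure (Measure.map fullShift gaussLaw) :=
    Measure.isProbabilityMeasure_map measurable_fullShift.aemeasurable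
  refine measure_eq_of_cyl_eq fun n u => ?_
  rw [Measure.map_apply measurable_fullShift (measurableSet_cyl n u), preimage_fullShift_cyl,
    measure_iUnion _ (fun a => measurableSet_cyl _ _)]
  · have hs := hasSum_log_branches (branch_nonneg n u le_rfl) (branch_nonneg n u zero_le_one)
    have hs' := hs.div_const (Real.log 2)
    rw [gaussLaw_cyl, ← hs'.tsum_eq, ENNReal.ofReal_tsum_of_nonneg _ hs'.summable]
    · congr 1; funext a
      rw [gaussLaw_cyl]; rfl
    · intro a
      have : 0 < Real.log 2 := Real.log_pos one_lt_two
      positivity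
  · intro a b hab
    rw [Function.onFun, disjoint_left]
    intro x hx hx'
    exact hab ((hx 0 (by omega)).symm.trans (hx' 0 (by omega)))

lemma lebLaw_le_smul_gaussLaw : lebLaw ≤ (2 : ℝ≥0∞) • gaussLaw := by
  rw [lebLaw, gaussLaw, ← Measure.map_smul]
  apply Measure.map_mono _ measurable_digits
  refine Measure.le_iff.2 fun s hs => ?_
  rw [Measure.smul_apply, gaussReal, withDensity_apply _ hs, smul_eq_mul, ← lintegral_const_mul]
  · calc (volume.restrict (Ioo (0 : ℝ) 1)) s
        = ∫⁻ _ in s, 1 ∂(volume.restrict (Ioo (0 : ℝ) 1)) := by simp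
      _ ≤ _ := ?_
    rw [← lintegral_indicator hs, ← lintegral_indicator hs]
    refine lintegral_mono_ae ?_
    filter_upwards [ae_restrict_mem measurableSet_Ioo] with x hx
    by_cases hxs : x ∈ s
    · rw [indicator_of_mem hxs, indicator_of_mem hxs, show (2 : ℝ≥0∞) = ENNReal.ofReal 2 by simp,
        ← ENNReal.ofReal_mul (by norm_num), ← ENNReal.ofReal_one]
      apply ENNReal.ofReal_le_ofReal
      have hl : Real.log 2 ≤ 1 := by
        have := Real.log_le_sub_one_of_pos (show (0 : ℝ) < 2 by norm_num); linarith
      have hl0 : 0 < Real.log 2 := Real.log_pos one_lt_two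
      have h1 := hx.1
      have h2 := hx.2
      rw [inv_eq_one_div, div_div, mul_one_div, le_div_iff₀ (by positivity)]
      nlinarith
    · rw [indicator_of_notMem hxs]; exact bot_le
  · fun_prop

lemma gaussLaw_ac : gaussLaw ≪ lebLaw :=
  (withDensity_absolutelyContinuous _ _).map measurable_digits

lemma ergodic_fullShift : Ergodic fullShift gaussLaw := by
  refine ⟨measurePreserving_fullShift, ⟨fun A hA hinv => ?_⟩⟩
  have hit : ∀ n, fullShift^[n] ⁻¹' A = A := by
    intro n
    induction n with
    | zero => rfl
    | succ n ih => rw [Function.iterate_succ, preimage_comp, ih, hinv]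
  have : IsFiniteMeasure ((4 : ℝ≥0∞) • lebLaw.restrict A) := Measure.smul_finite _ (by simp)
  have : IsFiniteMeasure (lebLaw A • lebLaw) := Measure.smul_finite _ (measure_ne_top _ _)
  have h : lebLaw A • lebLaw ≤ (4 : ℝ≥0∞) • lebLaw.restrict A := by
    refine measure_le_of_cyl_le fun n u => ?_
    have := le_map_restrict_cyl n u A
    rw [Measure.smul_apply, Measure.smul_apply,
      Measure.map_apply (measurable_fullShift.iterate n) hA, hit, Measure.restrict_apply hA] at this
    rw [Measure.smul_apply, Measure.smul_apply, Measure.restrict_apply (measurableSet_cyl n u),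
      inter_comm, smul_eq_mul, mul_comm]
    exact this
  have h0 := h Aᶜ
  rw [Measure.smul_apply, Measure.smul_apply, Measure.restrict_apply hA.compl] at h0
  simp only [compl_inter_self, measure_empty, smul_eq_mul, mul_zero, nonpos_iff_eq_zero,
    mul_eq_zero] at h0
  rw [eventuallyConst_set]
  rcases h0 with h0 | h0
  · right
    exact (measure_eq_zero_iff_ae_notMem.1 (gaussLaw_ac h0)).mono fun x hx => by simpa using hx
  · left
    exact (measure_eq_zero_iff_ae_notMem.1 (gaussLaw_ac h0)).mono fun x hx => by simpa using hx

lemma tendstoInMeasure_birkhoffAverage {X : Type*} [MeasurableSpace X] {T : X → X}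
    {μ : Measure X} [IsProbabilityMeasure μ] (hT : Ergodic T μ) {f : X → ℝ} (hf : MemLp f 2 μ) :
    TendstoInMeasure μ (fun n => birkhoffAverage ℝ T f n) atTop (fun _ => ∫ x, f x ∂μ) := by
  set hmp := hT.toMeasurePreserving
  set U : Lp ℝ 2 μ →L[ℝ] Lp ℝ 2 μ :=
    (Lp.compMeasurePreservingₗᵢ ℝ T hmp).toContinuousLinearMap with hU
  have hU1 : ‖U‖ ≤ 1 := LinearIsometry.norm_toContinuousLinearMap_le _
  set F := hf.toLp f
  set G := ((U.eqLocus (1 : Lp ℝ 2 μ →L[ℝ] Lp ℝ 2 μ)).orthogonalProjectionOnto F)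
  have hlim := ContinuousLinearMap.tendsto_birkhoffAverage_orthogonalProjection U hU1 F
  have hG : U (G : Lp ℝ 2 μ) = G := G.2
  have hUc : ∀ g : Lp ℝ 2 μ, U g = Lp.compMeasurePreserving T hmp g := fun g => rfl
  have hUn : ∀ n, (U^[n] F : X → ℝ) =ᵐ[μ] f ∘ T^[n] := by
    intro n
    have e : (U : Lp ℝ 2 μ → Lp ℝ 2 μ) = Lp.compMeasurePreserving T hmp := rfl
    rw [e, Lp.compMeasurePreserving_iterate, Lp.toLp_compMeasurePreserving]
    exact MemLp.coeFn_toLp _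
  obtain ⟨c, hc⟩ : ∃ c, (G : Lp ℝ 2 μ) =ᵐ[μ] Function.const X c := by
    apply hT.ae_eq_const_of_ae_eq_comp_ae (Lp.aestronglyMeasurable _)
    refine (Lp.coeFn_compMeasurePreserving (G : Lp ℝ 2 μ) hmp).symm.trans ?_
    rw [← hUc, hG]
  have havg : ∀ n, ((birkhoffAverage ℝ U _root_.id n F : Lp ℝ 2 μ) : X → ℝ) =ᵐ[μ]
      birkhoffAverage ℝ T f n := by
    intro n
    simp only [birkhoffAverage, birkhoffSum, _root_.id]
    filter_upwards [Lp.coeFn_smul (n : ℝ)⁻¹ (∑ i ∈ Finset.range n, U^[i] F),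
      Lp.coeFn_finsetSum (Finset.range n) fun i => U^[i] F, ae_all_iff.2 hUn] with x h1 h2 h3
    rw [h1, Pi.smul_apply, h2, Finset.sum_apply]
    simp only [h3, Function.comp_apply]
    rfl
  have hcint : c = ∫ x, f x ∂μ := by
    set e : Lp ℝ 2 μ := (memLp_const (1 : ℝ)).toLp (fun _ => (1 : ℝ))
    have he : e =ᵐ[μ] fun _ => (1 : ℝ) := MemLp.coeFn_toLp _
    have hinner : ∀ (g : Lp ℝ 2 μ) (g' : X → ℝ), g =ᵐ[μ] g' → inner ℝ e g = ∫ x, g' x ∂μ := by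
      intro g g' hg
      rw [L2.inner_def]
      refine integral_congr_ae ?_
      filter_upwards [he, hg] with x h1 h2
      simp [h1, h2]
    have hiter : ∀ n, ∫ x, f (T^[n] x) ∂μ = ∫ x, f x ∂μ := by
      intro n
      have hn := hmp.iterate n
      rw [← integral_map hn.measurable.aemeasurable (by rw [hn.map_eq]; exact hf.1), hn.map_eq]
    have hl : Tendsto (fun n => inner ℝ e (birkhoffAverage ℝ U _root_.id n F)) atTop
        (𝓝 (inner ℝ e (G : Lp ℝ 2 μ))) := tendsto_const_nhds.inner hlim
    rw [hinner _ _ hc] at hl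
    have hev : ∀ᶠ n : ℕ in atTop, inner ℝ e (birkhoffAverage ℝ U _root_.id n F)
        = ∫ x, f x ∂μ := by
      filter_upwards [eventually_ge_atTop 1] with n hn
      rw [hinner _ _ (havg n)]
      simp only [birkhoffAverage, birkhoffSum, smul_eq_mul]
      rw [integral_const_mul, integral_finsetSum]
      · simp only [hiter, Finset.sum_const, Finset.card_range, nsmul_eq_mul]
        field_simp
      · intro i _
        exact ((hf.comp_measurePreserving (hmp.iterate i)).integrable one_le_two)
    have hl' := tendsto_nhds_unique (hl.congr' hev) tendsto_const_nhds
    simpa using hl'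
  have := tendstoInMeasure_of_tendsto_Lp hlim
  refine this.congr havg ?_
  rw [← hcint]; exact hc

lemma birkhoffAverage_hits (E : Set ℕ) (n : ℕ) (u : ℕ → ℕ) :
    birkhoffAverage ℝ fullShift (fun x => E.indicator 1 (x 0)) n u = hits E n u / n := by
  simp [birkhoffAverage, birkhoffSum, hits, fullShift_iterate, div_eq_inv_mul]

/-- The Gauss frequency of the set of digits `E`. -/
noncomputable def freq (E : Set ℕ) : ℝ := gaussLaw.real {x | x 0 ∈ E}

lemma measurableSet_zero_mem (E : Set ℕ) : MeasurableSet {x : ℕ → ℕ | x 0 ∈ E} :=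
  measurable_pi_apply 0 E.to_countable.measurableSet

lemma indicator_zero (E : Set ℕ) : (fun x : ℕ → ℕ => E.indicator (1 : ℕ → ℝ) (x 0))
    = {x : ℕ → ℕ | x 0 ∈ E}.indicator 1 := rfl

lemma tendsto_lebLaw_deviation (E : Set ℕ) {δ : ℝ} (hδ : 0 < δ) :
    Tendsto (fun n : ℕ => lebLaw {u | δ ≤ |hits E n u / n - freq E|}) atTop (𝓝 0) := by
  have hm := measurableSet_zero_mem E
  have hf : MemLp (fun x : ℕ → ℕ => E.indicator (1 : ℕ → ℝ) (x 0)) 2 gaussLaw := by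
    rw [indicator_zero]
    exact (memLp_const (1 : ℝ)).indicator hm
  have h := tendstoInMeasure_birkhoffAverage ergodic_fullShift hf (ENNReal.ofReal δ) (by simpa)
  have hInt : ∫ x : ℕ → ℕ, E.indicator (1 : ℕ → ℝ) (x 0) ∂gaussLaw = freq E := by
    rw [indicator_zero, integral_indicator_one hm]; rfl
  simp only [birkhoffAverage_hits, hInt, edist_dist, Real.dist_eq] at h
  have h2 := ENNReal.Tendsto.const_mul (a := 2) h (Or.inr (by simp))
  rw [mul_zero] at h2
  refine tendsto_of_tendsto_of_tendsto_of_le_of_le tendsto_const_nhds h2 (fun _ => bot_le)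
    fun n => ?_
  refine (lebLaw_le_smul_gaussLaw _).trans ?_
  rw [Measure.smul_apply, smul_eq_mul]
  gcongr
  intro hx
  exact ENNReal.ofReal_le_ofReal hx

lemma freq_singleton {k : ℕ} (hk : 1 ≤ k) : freq {k - 1}
    = Real.log (((k : ℝ) + 1) ^ 2 / ((k : ℝ) * ((k : ℝ) + 2))) / Real.log 2 := by
  have hk' : (1 : ℝ) ≤ k := by exact_mod_cast hk
  have e : {x : ℕ → ℕ | x 0 ∈ ({k - 1} : Set ℕ)} = cyl 1 (fun _ => k - 1) := by
    ext x; simp [cyl]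
  rw [freq, e, Measure.real, gaussLaw_cyl]
  have hl0 : 0 < Real.log 2 := Real.log_pos one_lt_two
  rw [ENNReal.toReal_ofReal (by positivity)]
  congr 1
  simp only [branch]
  have hc : ((k - 1 : ℕ) : ℝ) = k - 1 := by push_cast [hk]; ring
  have h1 : Real.log (1 + ((k : ℝ) - 1 + 1 + 0)⁻¹) - Real.log (1 + ((k : ℝ) - 1 + 1 + 1)⁻¹)
      = Real.log (((k : ℝ) + 1) ^ 2 / ((k : ℝ) * ((k : ℝ) + 2))) := by
    rw [sub_add_cancel, add_zero, ← Real.log_div (by positivity) (by positivity)]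
    congr 1
    field_simp
    ring
  rw [hc, h1, abs_of_nonneg]
  apply Real.log_nonneg
  rw [le_div_iff₀ (by positivity)]
  nlinarith

lemma freq_compl (E : Set ℕ) : freq Eᶜ = 1 - freq E := by
  have := probReal_compl_eq_one_sub (μ := gaussLaw) (measurableSet_zero_mem E)
  exact this

lemma hits_nonneg (E : Set ℕ) (n : ℕ) (u : ℕ → ℕ) : 0 ≤ hits E n u :=
  Finset.sum_nonneg fun _ _ => indicator_nonneg (fun _ _ => zero_le_one) _

lemma hits_le (E : Set ℕ) (n : ℕ) (u : ℕ → ℕ) : hits E n u ≤ n := by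
  have : hits E n u ≤ ∑ _i ∈ Finset.range n, (1 : ℝ) :=
    Finset.sum_le_sum fun i _ => indicator_le_self' (f := (1 : ℕ → ℝ)) (fun _ _ => zero_le_one) _
  simpa using this

lemma exists_hits_eq (E : Set ℕ) (n : ℕ) (u : ℕ → ℕ) : ∃ j : ℕ, j ≤ n ∧ hits E n u = j := by
  have h : hits E n u = ((∑ i ∈ Finset.range n, E.indicator 1 (u i) : ℕ) : ℝ) := by
    rw [hits, Nat.cast_sum]
    refine Finset.sum_congr rfl fun i _ => ?_
    by_cases hi : u i ∈ E <;> simp [hi]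
  refine ⟨_, ?_, h⟩
  have := hits_le E n u
  rw [h] at this
  exact_mod_cast this

lemma hits_add (E : Set ℕ) (n m : ℕ) (u : ℕ → ℕ) :
    hits E (n + m) u = hits E n u + hits E m (fullShift^[n] u) := by
  simp only [hits, Finset.sum_range_add, fullShift_iterate, add_comm]

lemma hits_congr (E : Set ℕ) {n : ℕ} {u v : ℕ → ℕ} (h : ∀ i < n, u i = v i) :
    hits E n u = hits E n v :=
  Finset.sum_congr rfl fun i hi => by rw [h i (Finset.mem_range.1 hi)]

lemma hits_ext_pre (E : Set ℕ) (n : ℕ) (u : ℕ → ℕ) : hits E n (ext (pre n u)) = hits E n u :=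
  hits_congr E (ext_pre u)

lemma hits_compl (E : Set ℕ) (n : ℕ) (u : ℕ → ℕ) : hits Eᶜ n u = n - hits E n u := by
  rw [eq_sub_iff_add_eq, hits, hits, ← Finset.sum_add_distrib]
  have : ∀ i, Eᶜ.indicator (1 : ℕ → ℝ) (u i) + E.indicator 1 (u i) = 1 := fun i => by
    rw [add_comm]; exact congrFun (indicator_self_add_compl E (1 : ℕ → ℝ)) (u i)
  simp [this]

lemma measurable_hits (E : Set ℕ) (n : ℕ) : Measurable (hits E n) := by
  refine Finset.measurable_sum _ fun i _ => ?_
  exact (measurable_from_top (f := E.indicator (1 : ℕ → ℝ))).comp (measurable_pi_apply i)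

/-- The Lebesgue probability of at least `s` hits during time `n`. -/
noncomputable def tail (E : Set ℕ) (n : ℕ) (s : ℝ) : ℝ := lebLaw.real {x | s ≤ hits E n x}

lemma measurableSet_le_hits (E : Set ℕ) (n : ℕ) (s : ℝ) : MeasurableSet {x | s ≤ hits E n x} :=
  measurableSet_le measurable_const (measurable_hits E n)

lemma tail_le_one (E : Set ℕ) (n : ℕ) (s : ℝ) : tail E n s ≤ 1 := measureReal_le_one

lemma tail_anti (E : Set ℕ) (n : ℕ) {s t : ℝ} (h : s ≤ t) : tail E n t ≤ tail E n s :=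
  measureReal_mono fun _ hx => h.trans hx

lemma tail_mul_le (E : Set ℕ) (n m : ℕ) (s t : ℝ) :
    tail E n s * tail E m t ≤ 4 * tail E (n + m) (s + t) := by
  have hm := measurableSet_le_hits E m t
  have hn := measurableSet_le_hits E n s
  have h := lintegral_mul_le_pre_mul_shift n ({w | s ≤ hits E n (ext w)}.indicator 1)
    (g := {x | t ≤ hits E m x}.indicator 1) (measurable_one.indicator hm)
  have e1 : ∀ x, {w : Fin n → ℕ | s ≤ hits E n (ext w)}.indicator (1 : (Fin n → ℕ) → ℝ≥0∞) (pre n x)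
      = {x | s ≤ hits E n x}.indicator 1 x := by
    intro x; simp only [indicator, mem_ofPred_eq, hits_ext_pre, Pi.one_apply]
  simp only [e1] at h
  rw [lintegral_indicator_one hn, lintegral_indicator_one hm] at h
  have h2 : ∫⁻ x, {x | s ≤ hits E n x}.indicator (1 : (ℕ → ℕ) → ℝ≥0∞) x
      * {x | t ≤ hits E m x}.indicator 1 (fullShift^[n] x) ∂lebLaw
      ≤ lebLaw {x | s + t ≤ hits E (n + m) x} := by
    rw [← lintegral_indicator_one (measurableSet_le_hits E (n + m) (s + t))]
    refine lintegral_mono fun x => ?_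
    simp only [indicator, mem_ofPred_eq, Pi.one_apply, hits_add]
    split_ifs with h1 h2 h3 <;> simp
    exact absurd (add_le_add h1 h2) h3
  have h3 := h.trans (mul_le_mul_right h2 4)
  have h4 := ENNReal.toReal_mono (ENNReal.mul_ne_top (by simp) (measure_ne_top _ _)) h3
  simpa [ENNReal.toReal_mul, tail, Measure.real] using h4

lemma tail_pos {E : Set ℕ} (hE : E.Nonempty) (n : ℕ) {s : ℝ} (hs : s ≤ n) : 0 < tail E n s := by
  obtain ⟨e, he⟩ := hE
  have hsub : cyl n (fun _ => e) ⊆ {x | s ≤ hits E n x} := by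
    intro x hx
    have : hits E n x = hits E n (fun _ => e) := hits_congr E hx
    simp only [mem_ofPred_eq, this]
    simpa [hits, he] using hs
  refine lt_of_lt_of_le ?_ (measureReal_mono hsub)
  rw [Measure.real, lebLaw_cyl, ENNReal.toReal_ofReal (len_pos _ _).le]
  exact len_pos _ _

/-- The exponential rate of the probability that the frequency of hits is at least `β`. -/
noncomputable def rate (E : Set ℕ) (β : ℝ) : ℝ :=
  -sInf ((fun n : ℕ => (Real.log 4 - Real.log (tail E n (β * n))) / n) '' Ici 1)

lemma subadditive_log_tail {E : Set ℕ} (hE : E.Nonempty) {β : ℝ} (hβ : β ≤ 1) :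
    Subadditive fun n : ℕ => Real.log 4 - Real.log (tail E n (β * n)) := by
  intro n m
  have hp : ∀ k : ℕ, 0 < tail E k (β * k) := fun k =>
    tail_pos hE k (by nlinarith [Nat.cast_nonneg (α := ℝ) k])
  have h := tail_mul_le E n m (β * n) (β * m)
  rw [← mul_add, ← Nat.cast_add] at h
  have := Real.log_le_log (mul_pos (hp n) (hp m)) h
  rw [Real.log_mul (hp n).ne' (hp m).ne', Real.log_mul (by norm_num) (hp _).ne'] at this
  linarith

lemma log_tail_nonpos (E : Set ℕ) (n : ℕ) (s : ℝ) : Real.log (tail E n s) ≤ 0 :=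
  Real.log_nonpos measureReal_nonneg (tail_le_one E n s)

lemma bddBelow_log_tail (E : Set ℕ) (β : ℝ) :
    BddBelow (range fun n : ℕ => (Real.log 4 - Real.log (tail E n (β * n))) / n) := by
  refine ⟨0, ?_⟩
  rintro _ ⟨n, rfl⟩
  have := log_tail_nonpos E n (β * n)
  have := Real.log_nonneg (show (1 : ℝ) ≤ 4 by norm_num)
  exact div_nonneg (by linarith) (Nat.cast_nonneg n)

lemma tendsto_rate {E : Set ℕ} (hE : E.Nonempty) {β : ℝ} (hβ : β ≤ 1) :
    Tendsto (fun n : ℕ => Real.log (tail E n (β * n)) / n) atTop (𝓝 (rate E β)) := by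
  have h := (subadditive_log_tail hE hβ).tendsto_lim (bddBelow_log_tail E β)
  have h2 := (tendsto_const_div_atTop_nhds_zero_nat (Real.log 4)).sub h
  simp only [zero_sub, sub_div, sub_sub_cancel] at h2
  rwa [Subadditive.lim] at h2

lemma log_tail_le {E : Set ℕ} (hE : E.Nonempty) {β : ℝ} (hβ : β ≤ 1) (n : ℕ) :
    Real.log (tail E n (β * n)) ≤ n * rate E β + Real.log 4 := by
  rcases Nat.eq_zero_or_pos n with rfl | hn
  · have := log_tail_nonpos E 0 (β * (0 : ℕ))
    have := Real.log_nonneg (show (1 : ℝ) ≤ 4 by norm_num)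
    simp only [Nat.cast_zero, zero_mul] at *
    linarith
  · have h := (subadditive_log_tail hE hβ).lim_le_div (bddBelow_log_tail E β) hn.ne'
    have hn' : (0 : ℝ) < n := by exact_mod_cast hn
    rw [le_div_iff₀ hn'] at h
    rw [Subadditive.lim] at h
    rw [rate]; linarith

lemma rate_anti {E : Set ℕ} (hE : E.Nonempty) {β γ : ℝ} (h : β ≤ γ) (hγ : γ ≤ 1) :
    rate E γ ≤ rate E β := by
  refine le_of_tendsto_of_tendsto' (tendsto_rate hE hγ) (tendsto_rate hE (h.trans hγ)) fun n => ?_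
  have hn : (0 : ℝ) ≤ n := Nat.cast_nonneg n
  have := Real.log_le_log (tail_pos hE n (s := γ * n) (by nlinarith))
    (tail_anti E n (mul_le_mul_of_nonneg_right h hn))
  gcongr

lemma concaveOn_rate {E : Set ℕ} (hE : E.Nonempty) : ConcaveOn ℝ (Iic 1) (rate E) := by
  refine LinearOrder.concaveOn_of_lt (convex_Iic 1) fun x hx y hy hxy a b ha hb hab => ?_
  simp only [smul_eq_mul]
  have hab' : a * x + b * y ≤ 1 := by
    have := mul_le_mul_of_nonneg_left hx ha.le
    have := mul_le_mul_of_nonneg_left hy hb.le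
    simp only [mul_one] at *
    linarith
  set p : ℕ → ℕ := fun n => ⌈b * n⌉₊
  set q : ℕ → ℕ := fun n => n - p n
  have hpn : ∀ n, p n ≤ n := fun n => Nat.ceil_le.2 (by nlinarith [Nat.cast_nonneg (α := ℝ) n])
  have hqc : ∀ n, (q n : ℝ) = n - p n := fun n => Nat.cast_sub (hpn n)
  have hp : Tendsto (fun n : ℕ => (p n : ℝ) / n) atTop (𝓝 b) :=
    (tendsto_nat_ceil_mul_div_atTop hb.le).comp tendsto_natCast_atTop_atTop
  have hq : Tendsto (fun n : ℕ => (q n : ℝ) / n) atTop (𝓝 a) := by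
    have : a = 1 - b := by linarith
    rw [this]
    refine (hp.const_sub 1).congr' ?_
    filter_upwards [eventually_gt_atTop 0] with n hn
    have hn' : (n : ℝ) ≠ 0 := by exact_mod_cast hn.ne'
    rw [hqc]; field_simp
  have htop : ∀ {r : ℕ → ℕ} {c : ℝ}, 0 < c → Tendsto (fun n : ℕ => (r n : ℝ) / n) atTop (𝓝 c) →
      Tendsto r atTop atTop := by
    intro r c hc h
    have := h.pos_mul_atTop hc (tendsto_natCast_atTop_atTop (R := ℝ))
    refine tendsto_natCast_atTop_iff.1 (this.congr' ?_) 
    filter_upwards [eventually_gt_atTop 0] with n hn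
    have hn' : (n : ℝ) ≠ 0 := by exact_mod_cast hn.ne'
    field_simp
  have hlim : ∀ {r : ℕ → ℕ} {c z : ℝ}, 0 < c → z ≤ 1 →
      Tendsto (fun n : ℕ => (r n : ℝ) / n) atTop (𝓝 c) →
      Tendsto (fun n : ℕ => Real.log (tail E (r n) (z * r n)) / n) atTop (𝓝 (c * rate E z)) := by
    intro r c z hc hz h
    have ht := htop hc h
    refine (h.mul ((tendsto_rate hE hz).comp ht)).congr' ?_
    filter_upwards [eventually_gt_atTop 0, ht.eventually_gt_atTop 0] with n hn hrn
    have hn' : (n : ℝ) ≠ 0 := by exact_mod_cast hn.ne'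
    have hr' : (r n : ℝ) ≠ 0 := by exact_mod_cast hrn.ne'
    simp only [Function.comp_apply]
    field_simp
  have h1 := ((hlim ha hx hq).add (hlim hb hy hp)).sub
    (tendsto_const_div_atTop_nhds_zero_nat (Real.log 4))
  rw [sub_zero] at h1
  refine le_of_tendsto_of_tendsto' h1 (tendsto_rate hE hab') fun n => ?_
  rw [← add_div, ← sub_div]
  gcongr
  have hx1 := tail_pos hE (q n) (s := x * q n)
    (by have : x ≤ 1 := hx; nlinarith [Nat.cast_nonneg (α := ℝ) (q n)])
  have hy1 := tail_pos hE (p n) (s := y * p n)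
    (by have : y ≤ 1 := hy; nlinarith [Nat.cast_nonneg (α := ℝ) (p n)])
  have h2 := tail_mul_le E (q n) (p n) (x * q n) (y * p n)
  rw [show q n + p n = n from Nat.sub_add_cancel (hpn n)] at h2
  have h3 : tail E n (x * q n + y * p n) ≤ tail E n ((a * x + b * y) * n) := by
    apply tail_anti
    have : b * n ≤ p n := Nat.le_ceil _
    rw [hqc]
    have ha' : a = 1 - b := by linarith
    rw [ha']
    nlinarith
  have h4 := Real.log_le_log (mul_pos hx1 hy1)
    (h2.trans (mul_le_mul_of_nonneg_left h3 (by norm_num)))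
  have h5 := tail_pos hE n (s := (a * x + b * y) * n) (by nlinarith [Nat.cast_nonneg (α := ℝ) n])
  rw [Real.log_mul hx1.ne' hy1.ne', Real.log_mul (by norm_num) h5.ne'] at h4
  linarith

/-- The exponential moments of the number of hits. -/
noncomputable def expMoment (E : Set ℕ) (q : ℝ) (n : ℕ) : ℝ≥0∞ :=
  ∫⁻ x, ENNReal.ofReal (Real.exp (q * hits E n x)) ∂lebLaw

lemma expMoment_mul_le (E : Set ℕ) (q : ℝ) (n m : ℕ) :
    expMoment E q (m * n) ≤ (4 * expMoment E q n) ^ m := by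
  induction m with
  | zero => simp [expMoment, hits]
  | succ m ih =>
    have h := lintegral_pre_mul_shift_le n
      (fun w => ENNReal.ofReal (Real.exp (q * hits E n (ext w))))
      (g := fun x => ENNReal.ofReal (Real.exp (q * hits E (m * n) x)))
      (((measurable_hits E _).const_mul q).exp.ennreal_ofReal)
    simp only [hits_ext_pre, ← ENNReal.ofReal_mul (Real.exp_pos _).le, ← Real.exp_add, ← mul_add,
      ← hits_add] at h
    rw [show (m + 1) * n = n + m * n by ring, pow_succ]
    calc _ ≤ 4 * (expMoment E q n * expMoment E q (m * n)) := h
      _ ≤ 4 * (expMoment E q n * (4 * expMoment E q n) ^ m) := by gcongr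
      _ = _ := by ring

lemma rate_le_of_expMoment_le {E : Set ℕ} (hE : E.Nonempty) {β q z : ℝ} (hβ : β ≤ 1)
    (hq : 0 ≤ q) (hz : 0 < z) {n : ℕ}
    (hn : 0 < n) (h : expMoment E q n ≤ ENNReal.ofReal z) :
    rate E β ≤ -(q * β) + Real.log (4 * z) / n := by
  have hn' : (0 : ℝ) < n := by exact_mod_cast hn
  have ht : Tendsto (fun m : ℕ => m * n) atTop atTop :=
    tendsto_id.atTop_mul_const' hn
  have hlim := (tendsto_rate hE hβ).comp ht
  refine le_of_tendsto hlim ?_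
  filter_upwards [eventually_gt_atTop 0] with m hm
  have hm' : (0 : ℝ) < m := by exact_mod_cast hm
  simp only [Function.comp_apply]
  set N := m * n
  have hN : ((N : ℕ) : ℝ) = m * n := by simp [N]
  have hT := tail_pos hE N (s := β * N) (by rw [hN]; nlinarith [mul_pos hm' hn'])
  have h1 := mul_meas_ge_le_lintegral₀ (μ := lebLaw)
    (((measurable_hits E N).const_mul q).exp.ennreal_ofReal.aemeasurable)
    (ENNReal.ofReal (Real.exp (q * (β * N))))
  have h2 : ENNReal.ofReal (Real.exp (q * (β * N)) * tail E N (β * N))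
      ≤ ENNReal.ofReal ((4 * z) ^ m) := by
    rw [ENNReal.ofReal_mul (Real.exp_pos _).le, tail, ofReal_measureReal,
      ENNReal.ofReal_pow (by positivity), ENNReal.ofReal_mul (by norm_num)]
    refine le_trans ?_ ((h1.trans (expMoment_mul_le E q n m)).trans ?_)
    · refine mul_le_mul_right (measure_mono fun x hx => ?_) _
      refine ENNReal.ofReal_le_ofReal (Real.exp_le_exp.2 (mul_le_mul_of_nonneg_left ?_ hq))
      exact hx
    · simp only [ENNReal.ofReal_ofNat]
      gcongr
  rw [ENNReal.ofReal_le_ofReal_iff (by positivity)] at h2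
  have h3 := Real.log_le_log (mul_pos (Real.exp_pos _) hT) h2
  rw [Real.log_mul (Real.exp_pos _).ne' hT.ne', Real.log_exp, Real.log_pow] at h3
  rw [div_le_iff₀ (by rw [hN]; positivity)]
  have : (-(q * β) + Real.log (4 * z) / n) * N = -(q * (β * N)) + m * Real.log (4 * z) := by
    rw [hN]; field_simp
  rw [this]; linarith

lemma rate_neg {E : Set ℕ} (hE : E.Nonempty) {α : ℝ} (hα : freq E < α) (hα1 : α ≤ 1) :
    rate E α < 0 := by
  set δ := (α - freq E) / 2
  have hδ : 0 < δ := by simp only [δ]; linarith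
  set t := (Real.log 8 + 1) / δ
  have hl8 : 0 < Real.log 8 := Real.log_pos (by norm_num)
  have ht : 0 < t := by positivity
  have hc : (0 : ℝ≥0∞) < ENNReal.ofReal (Real.exp (t * (freq E + δ)) / Real.exp t) := by
    rw [ENNReal.ofReal_pos]; positivity
  obtain ⟨n, hn, hn0⟩ := (((tendsto_lebLaw_deviation E hδ).eventually (gt_mem_nhds hc)).and
    (eventually_gt_atTop 0)).exists
  have hn' : (0 : ℝ) < n := by exact_mod_cast hn0
  have hmom : expMoment E (t / n) n ≤ ENNReal.ofReal (2 * Real.exp (t * (freq E + δ))) := by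
    have hm : MeasurableSet {u | δ ≤ |hits E n u / n - freq E|} :=
      measurableSet_le measurable_const (((measurable_hits E n).div_const _).sub_const _).abs
    calc expMoment E (t / n) n
        ≤ ∫⁻ x, (ENNReal.ofReal (Real.exp (t * (freq E + δ)))
          + {u | δ ≤ |hits E n u / n - freq E|}.indicator
            (fun _ => ENNReal.ofReal (Real.exp t)) x) ∂lebLaw := by
          refine lintegral_mono fun x => ?_
          by_cases hx : δ ≤ |hits E n x / n - freq E|
          · rw [indicator_of_mem (by exact hx)]
            refine le_trans (ENNReal.ofReal_le_ofReal ?_) le_add_self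
            apply Real.exp_le_exp.2
            rw [div_mul_eq_mul_div, div_le_iff₀ hn']
            exact mul_le_mul_of_nonneg_left (hits_le E n x) ht.le
          · refine le_trans (ENNReal.ofReal_le_ofReal ?_) le_self_add
            apply Real.exp_le_exp.2
            rw [div_mul_eq_mul_div, mul_div_assoc]
            have := (abs_lt.1 (not_le.1 hx)).2
            exact mul_le_mul_of_nonneg_left (by linarith) ht.le
      _ = ENNReal.ofReal (Real.exp (t * (freq E + δ))) + ENNReal.ofReal (Real.exp t)
            * lebLaw {u | δ ≤ |hits E n u / n - freq E|} := by
          rw [lintegral_add_left measurable_const, lintegral_const, measure_univ, mul_one,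
            lintegral_indicator_const hm]
      _ ≤ ENNReal.ofReal (Real.exp (t * (freq E + δ))) + ENNReal.ofReal (Real.exp t)
            * ENNReal.ofReal (Real.exp (t * (freq E + δ)) / Real.exp t) := by gcongr
      _ = _ := by
          rw [← ENNReal.ofReal_mul (Real.exp_pos _).le, ← ENNReal.ofReal_add (Real.exp_pos _).le
            (by positivity)]
          congr 1
          field_simp
          ring
  have h := rate_le_of_expMoment_le hE hα1 (q := t / n) (by positivity) (by positivity) hn0 hmom
  refine lt_of_le_of_lt h ?_
  rw [show (4 : ℝ) * (2 * Real.exp (t * (freq E + δ))) = 8 * Real.exp (t * (freq E + δ)) by ring,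
    Real.log_mul (by norm_num) (Real.exp_pos _).ne', Real.log_exp]
  have e : -(t / n * α) + (Real.log 8 + t * (freq E + δ)) / n = (Real.log 8 - t * δ) / n := by
    have : freq E = α - 2 * δ := by simp only [δ]; ring
    rw [this]; field_simp; ring
  rw [e]
  have : t * δ = Real.log 8 + 1 := by simp only [t]; field_simp
  rw [this]
  apply div_neg_of_neg_of_pos _ hn'
  linarith

lemma exists_rate_le_one {E : Set ℕ} (hE : E.Nonempty) {ε : ℝ} (hε : 0 < ε) :
    ∃ δ > 0, rate E (1 - δ) ≤ rate E 1 + ε := by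
  obtain ⟨n, hn, hn0⟩ := (((tendsto_const_div_atTop_nhds_zero_nat (Real.log 32)).eventually
    (gt_mem_nhds (half_pos hε))).and (eventually_gt_atTop 0)).exists
  have hn' : (0 : ℝ) < n := by exact_mod_cast hn0
  have hT := tail_pos hE n (s := 1 * n) (by simp)
  set T := tail E n (1 * n)
  set q := -Real.log T
  have hq : 0 ≤ q := neg_nonneg.2 (log_tail_nonpos E n (1 * n))
  have hqT : Real.exp (-q) = T := by simp [q, Real.exp_log hT]
  have hmom : expMoment E q n ≤ ENNReal.ofReal (2 * (Real.exp (q * n) * T)) := by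
    have hm := measurableSet_le_hits E n (1 * n)
    calc expMoment E q n
        ≤ ∫⁻ x, (ENNReal.ofReal (Real.exp (q * n) * T)
          + {u | 1 * n ≤ hits E n u}.indicator
            (fun _ => ENNReal.ofReal (Real.exp (q * n))) x) ∂lebLaw := by
          refine lintegral_mono fun x => ?_
          by_cases hx : 1 * n ≤ hits E n x
          · rw [indicator_of_mem (by exact hx)]
            refine le_trans (ENNReal.ofReal_le_ofReal ?_) le_add_self
            exact Real.exp_le_exp.2 (mul_le_mul_of_nonneg_left (hits_le E n x) hq)
          · refine le_trans (ENNReal.ofReal_le_ofReal ?_) le_self_add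
            rw [← hqT, ← Real.exp_add]
            apply Real.exp_le_exp.2
            have : hits E n x ≤ n - 1 := by
              obtain ⟨j, -, hj⟩ := exists_hits_eq E n x
              rw [one_mul, hj, not_le] at hx
              rw [hj]
              have : j + 1 ≤ n := by exact_mod_cast hx
              have : (j : ℝ) + 1 ≤ n := by exact_mod_cast this
              linarith
            nlinarith
      _ = ENNReal.ofReal (Real.exp (q * n) * T) + ENNReal.ofReal (Real.exp (q * n))
            * lebLaw {u | 1 * n ≤ hits E n u} := by
          rw [lintegral_add_left measurable_const, lintegral_const, measure_univ, mul_one,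
            lintegral_indicator_const hm]
      _ = _ := by
          rw [← ofReal_measureReal, ← ENNReal.ofReal_mul (Real.exp_pos _).le,
            ← ENNReal.ofReal_add (by positivity) (by positivity)]
          congr 1
          change _ + _ * T = _
          ring
  refine ⟨ε / (2 * (q + 1)), by positivity, ?_⟩
  set δ := ε / (2 * (q + 1))
  have hδ : 0 < δ := by positivity
  have h := rate_le_of_expMoment_le hE (β := 1 - δ) (by linarith) hq (by positivity) hn0 hmom
  refine h.trans ?_
  rw [show (4 : ℝ) * (2 * (Real.exp (q * n) * T)) = 8 * (Real.exp (q * n) * T) by ring,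
    Real.log_mul (by norm_num) (by positivity), Real.log_mul (Real.exp_pos _).ne' hT.ne',
    Real.log_exp]
  have h1 := log_tail_le hE le_rfl n
  have h32 : Real.log 32 = Real.log 8 + Real.log 4 := by
    rw [← Real.log_mul (by norm_num) (by norm_num)]; norm_num
  have h2 : (Real.log 8 + (q * n + Real.log T)) / n ≤ Real.log 32 / n + q + rate E 1 := by
    rw [div_le_iff₀ hn', add_mul, add_mul, div_mul_cancel₀ _ hn'.ne', h32]
    linarith
  have h3 : q * δ ≤ ε / 2 := by
    have : (q + 1) * δ = ε / 2 := by simp only [δ]; field_simp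
    nlinarith
  nlinarith

lemma exists_rate_le {E : Set ℕ} (hE : E.Nonempty) {α ε : ℝ} (hα1 : α ≤ 1) (hε : 0 < ε) :
    ∃ δ > 0, ∀ β, α - δ < β → β ≤ 1 → rate E β ≤ rate E α + ε := by
  rcases hα1.eq_or_lt with rfl | hα
  · obtain ⟨δ, hδ, h⟩ := exists_rate_le_one hE hε
    exact ⟨δ, hδ, fun β hβ hβ1 => (rate_anti hE hβ.le hβ1).trans h⟩
  · have hc : ContinuousOn (rate E) (Iio 1) :=
      ((concaveOn_rate hE).subset Iio_subset_Iic_self (convex_Iio 1)).continuousOn isOpen_Iio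
    have hc' := hc.continuousAt (Iio_mem_nhds hα)
    obtain ⟨δ, hδ, h⟩ := Metric.continuousAt_iff.1 hc' ε hε
    refine ⟨δ, hδ, fun β hβ hβ1 => ?_⟩
    rcases le_total α β with hab | hab
    · linarith [rate_anti hE hab hβ1]
    · have := h (x := β) (by rw [Real.dist_eq, abs_lt]; constructor <;> linarith)
      rw [Real.dist_eq, abs_lt] at this
      linarith [this.2]

lemma neg_mul_log_le {a b : ℝ} (ha : 0 ≤ a) (hb : 0 < b) :
    -(a * Real.log a) ≤ a * -Real.log b + (b - a) := by
  rcases ha.eq_or_lt with rfl | ha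
  · simpa using hb.le
  · have h := Real.log_le_sub_one_of_pos (div_pos hb ha)
    rw [Real.log_div hb.ne' ha.ne'] at h
    have := mul_le_mul_of_nonneg_left h ha.le
    rw [mul_sub, mul_sub, mul_div_cancel₀ _ ha.ne'] at this
    linarith

/-- The Gibbs inequality for a finite partition. -/
lemma partitionEntropy_le {X A : Type*} [MeasurableSpace X] (ν : Measure X)
    [IsProbabilityMeasure ν] (g : X → A) (s : Finset A) (hs : ∀ x, g x ∈ s)
    (hg : ∀ a, MeasurableSet (g ⁻¹' {a})) (Q : A → ℝ) (hQ0 : ∀ a ∈ s, 0 ≤ Q a)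
    (hQ : ∑ a ∈ s, Q a ≤ 1) {L : X → ℝ} (hL : Integrable L ν)
    (h : ∀ x, 0 < Q (g x) ∧ -Real.log (Q (g x)) ≤ L x) :
    0 ≤ ∫ x, L x ∂ν ∧ partitionEntropy ν g ≤ ENNReal.ofReal (∫ x, L x ∂ν) := by
  have hu : (⋃ a ∈ s, g ⁻¹' {a}) = univ := by
    ext x; simp [hs x]
  have hd : (s : Set A).PairwiseDisjoint fun a => g ⁻¹' {a} := fun a _ b _ hab =>
    Disjoint.preimage g (by simpa using hab)
  have hsum1 : ∑ a ∈ s, (ν (g ⁻¹' {a})).toReal = 1 := by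
    have := measureReal_biUnion_finset (μ := ν) hd (fun a _ => hg a)
    rw [hu] at this
    simpa [Measure.real] using this.symm
  have hInt : ∫ x, L x ∂ν = ∑ a ∈ s, ∫ x in g ⁻¹' {a}, L x ∂ν := by
    rw [← integral_biUnion_finset s (fun a _ => hg a) hd (fun a _ => hL.integrableOn), hu,
      setIntegral_univ]
  have hterm : ∀ a ∈ s, -((ν (g ⁻¹' {a})).toReal * Real.log ((ν (g ⁻¹' {a})).toReal))
      ≤ (∫ x in g ⁻¹' {a}, L x ∂ν) + (Q a - (ν (g ⁻¹' {a})).toReal) := by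
    intro a ha
    by_cases hne : (g ⁻¹' {a}).Nonempty
    · obtain ⟨x, rfl⟩ := hne
      refine (neg_mul_log_le ENNReal.toReal_nonneg (h x).1).trans ?_
      gcongr
      calc _ = ∫ _y in g ⁻¹' {g x}, -Real.log (Q (g x)) ∂ν := by
            rw [setIntegral_const]; simp [Measure.real]
        _ ≤ _ := by
            refine setIntegral_mono_on (integrable_const _).integrableOn hL.integrableOn (hg _)
              fun y hy => ?_
            have : g y = g x := hy
            rw [← this]; exact (h y).2
    · rw [not_nonempty_iff_eq_empty.1 hne]
      simpa using hQ0 a ha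
  have hpos : ∀ a, 0 ≤ -((ν (g ⁻¹' {a})).toReal * Real.log ((ν (g ⁻¹' {a})).toReal)) := by
    intro a
    have h1 : (ν (g ⁻¹' {a})).toReal ≤ 1 := measureReal_le_one (μ := ν) (s := g ⁻¹' {a})
    have h2 := Real.log_nonpos ENNReal.toReal_nonneg h1
    nlinarith [ENNReal.toReal_nonneg (a := ν (g ⁻¹' {a}))]
  have htot : ∑ a ∈ s, -((ν (g ⁻¹' {a})).toReal * Real.log ((ν (g ⁻¹' {a})).toReal))
      ≤ ∫ x, L x ∂ν := by
    refine (Finset.sum_le_sum hterm).trans ?_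
    rw [Finset.sum_add_distrib, Finset.sum_sub_distrib, hsum1, hInt]
    linarith
  refine ⟨(Finset.sum_nonneg fun a _ => hpos a).trans htot, ?_⟩
  rw [partitionEntropy, tsum_eq_sum (s := s), ← ENNReal.ofReal_sum_of_nonneg fun a _ => hpos a]
  · exact ENNReal.ofReal_le_ofReal htot
  · intro a ha
    have : g ⁻¹' {a} = ∅ := by
      ext x
      simp only [mem_preimage, mem_singleton_iff, mem_empty_iff_false, iff_false]
      rintro rfl; exact ha (hs x)
    simp [this]

lemma exists_code_approx (ν : Measure (ℕ → ℕ)) [IsProbabilityMeasure ν] {p : (ℕ → ℕ) → ℕ}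
    (hp : Measurable p) (R : Finset ℕ) (hR : ∀ x, p x ∈ R) {δ : ℝ} (hδ : 0 < δ) :
    ∃ N, ∃ q : (Fin N → ℕ) → ℕ, ν.real {x | p x ≠ q (pre N x)} ≤ δ := by
  have hpos : 0 < ENNReal.ofReal (δ / (R.card + 1)) := by
    rw [ENNReal.ofReal_pos]; positivity
  have h0 : ∀ r, ∃ n, ∃ s : Set (Fin n → ℕ), ν (symmDiff (pre n ⁻¹' s) (p ⁻¹' {r}))
      < ENNReal.ofReal (δ / (R.card + 1)) := fun r =>
    exists_pre_approx ν (hp (measurableSet_singleton r)) hpos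
  choose n s hs using h0
  set N := R.sup n
  have h1 : ∀ r, ∃ t : Set (Fin N → ℕ), r ∈ R → pre (n r) ⁻¹' s r = pre N ⁻¹' t := by
    intro r
    by_cases hr : r ∈ R
    · obtain ⟨t, ht⟩ := exists_preimage_pre_of_le (Finset.le_sup hr) (s r)
      exact ⟨t, fun _ => ht⟩
    · exact ⟨∅, fun h => absurd h hr⟩
  choose t ht using h1
  classical
  set q : (Fin N → ℕ) → ℕ := fun w => if h : ∃ r ∈ R, w ∈ t r then h.choose else 0 with hq
  refine ⟨N, q, ?_⟩
  have hsub : {x | p x ≠ q (pre N x)} ⊆ ⋃ r ∈ R, symmDiff (pre (n r) ⁻¹' s r) (p ⁻¹' {r}) := by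
    intro x hx
    simp only [mem_iUnion, exists_prop]
    by_cases hx1 : pre N x ∈ t (p x)
    · have hex : ∃ r ∈ R, pre N x ∈ t r := ⟨p x, hR x, hx1⟩
      have hqe : q (pre N x) = hex.choose := by simp only [hq]; rw [dif_pos hex]
      have hc := hex.choose_spec
      rw [← hqe] at hc
      refine ⟨_, hc.1, Or.inl ⟨?_, ?_⟩⟩
      · rw [ht _ hc.1]; exact hc.2
      · exact hx
    · refine ⟨p x, hR x, Or.inr ⟨rfl, ?_⟩⟩
      rw [ht _ (hR x)]; exact hx1
  have h2 : ν {x | p x ≠ q (pre N x)} ≤ ∑ r ∈ R, ENNReal.ofReal (δ / (R.card + 1)) :=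
    (measure_mono hsub).trans ((measure_biUnion_finset_le _ _).trans
      (Finset.sum_le_sum fun r _ => (hs r).le))
  rw [← ENNReal.ofReal_sum_of_nonneg (fun _ _ => by positivity)] at h2
  refine (ENNReal.toReal_le_of_le_ofReal (by positivity) h2).trans ?_
  rw [Finset.sum_const, nsmul_eq_mul, ← mul_div_assoc, div_le_iff₀ (by positivity)]
  nlinarith

lemma lintegral_inv_tail_le {E : Set ℕ} (hE : E.Nonempty) (n : ℕ) :
    ∫⁻ x, ENNReal.ofReal ((tail E n (hits E n x) * (n + 1))⁻¹) ∂lebLaw ≤ 1 := by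
  calc ∫⁻ x, ENNReal.ofReal ((tail E n (hits E n x) * (n + 1))⁻¹) ∂lebLaw
      ≤ ∫⁻ x, ∑ j ∈ Finset.range (n + 1), {x | (j : ℝ) ≤ hits E n x}.indicator
          (fun _ => ENNReal.ofReal ((tail E n j * (n + 1))⁻¹)) x ∂lebLaw := by
        refine lintegral_mono fun x => ?_
        obtain ⟨j, hj, hx⟩ := exists_hits_eq E n x
        refine le_trans ?_ (Finset.single_le_sum (fun _ _ => bot_le)
          (Finset.mem_range.2 (Nat.lt_succ_of_le hj)))
        rw [indicator_of_mem (by exact hx.ge), hx]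
    _ = ∑ j ∈ Finset.range (n + 1), ENNReal.ofReal ((tail E n j * (n + 1))⁻¹)
          * lebLaw {x | (j : ℝ) ≤ hits E n x} := by
        rw [lintegral_finsetSum (f := fun (j : ℕ) => {x | (j : ℝ) ≤ hits E n x}.indicator
          (fun _ => ENNReal.ofReal ((tail E n j * (n + 1))⁻¹))) _ fun j _ =>
          measurable_const.indicator (measurableSet_le_hits E n j)]
        simp_rw [lintegral_indicator_const (measurableSet_le_hits E n _)]
    _ = ∑ j ∈ Finset.range (n + 1), ENNReal.ofReal (((n : ℝ) + 1)⁻¹) := by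
        refine Finset.sum_congr rfl fun j hj => ?_
        have hj' : (j : ℝ) ≤ n := by
          exact_mod_cast Nat.lt_succ_iff.1 (Finset.mem_range.1 hj)
        have hT := tail_pos hE n hj'
        rw [← ofReal_measureReal, ← ENNReal.ofReal_mul (by positivity)]
        congr 1
        change _ * tail E n j = _
        field_simp
    _ ≤ 1 := by
        rw [← ENNReal.ofReal_sum_of_nonneg (fun _ _ => by positivity)]
        simp only [Finset.sum_const, Finset.card_range, nsmul_eq_mul, Nat.cast_add, Nat.cast_one]
        rw [mul_inv_cancel₀ (by positivity)]; simp

lemma integral_comp_hits (ν : Measure (ℕ → ℕ)) [IsProbabilityMeasure ν] (E : Set ℕ) (n : ℕ)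
    (f : ℝ → ℝ) : ∫ x, f (hits E n x) ∂ν
      = ∑ j ∈ Finset.range (n + 1), ν.real {x | hits E n x = j} * f j := by
  have hm : ∀ j : ℕ, MeasurableSet {x | hits E n x = j} := fun j =>
    measurableSet_eq_fun (measurable_hits E n) measurable_const
  have e : ∀ x, f (hits E n x) = ∑ j ∈ Finset.range (n + 1),
      {x | hits E n x = j}.indicator (fun _ => f j) x := by
    intro x
    obtain ⟨j, hj, hx⟩ := exists_hits_eq E n x
    rw [Finset.sum_eq_single_of_mem j (Finset.mem_range.2 (Nat.lt_succ_of_le hj))]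
    · rw [indicator_of_mem (by exact hx), hx]
    · intro i _ hij
      apply indicator_of_notMem
      simp only [mem_ofPred_eq, hx, Nat.cast_inj]
      exact fun h => hij h.symm
  simp_rw [e]
  rw [integral_finsetSum _ fun j _ => (integrable_const _).indicator (hm j)]
  refine Finset.sum_congr rfl fun j _ => ?_
  rw [integral_indicator_const _ (hm j), smul_eq_mul]

lemma integrable_comp_hits (ν : Measure (ℕ → ℕ)) [IsProbabilityMeasure ν] (E : Set ℕ) (n : ℕ)
    (f : ℝ → ℝ) : Integrable (fun x => f (hits E n x)) ν := by
  have hfin : (Finset.range (n + 1)).Nonempty := ⟨0, by simp⟩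
  refine Integrable.of_bound (C := ∑ j ∈ Finset.range (n + 1), |f j|) ?_ (ae_of_all _ fun x => ?_)
  · have : (fun x => f (hits E n x)) = (fun w : Fin n → ℕ => f (hits E n (ext w))) ∘ pre n := by
      funext x; simp [hits_ext_pre]
    rw [this]
    exact ((measurable_of_countable _).comp (measurable_pre n)).aestronglyMeasurable
  · obtain ⟨j, hj, hx⟩ := exists_hits_eq E n x
    rw [hx, Real.norm_eq_abs]
    exact Finset.single_le_sum (f := fun j : ℕ => |f j|) (fun _ _ => abs_nonneg _)
      (Finset.mem_range.2 (Nat.lt_succ_of_le hj))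

lemma map_iterate_of_invariant {ν : Measure (ℕ → ℕ)} (hinv : Invariant fullShift ν) (i : ℕ) :
    MeasurePreserving fullShift^[i] ν ν :=
  MeasurePreserving.iterate ⟨measurable_fullShift, hinv⟩ i

lemma integral_hits {ν : Measure (ℕ → ℕ)} [IsProbabilityMeasure ν]
    (hinv : Invariant fullShift ν) (E : Set ℕ) (n : ℕ) :
    ∫ x, hits E n x ∂ν = n * ν.real {x | x 0 ∈ E} := by
  have hm := measurableSet_zero_mem E
  have e : ∀ x, hits E n x = ∑ i ∈ Finset.range n,
      {x : ℕ → ℕ | x 0 ∈ E}.indicator (1 : (ℕ → ℕ) → ℝ) (fullShift^[i] x) := by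
    intro x; simp only [← indicator_zero, fullShift_iterate, zero_add, hits]
  have hi : Integrable ({x : ℕ → ℕ | x 0 ∈ E}.indicator (1 : (ℕ → ℕ) → ℝ)) ν :=
    (integrable_const (1 : ℝ)).indicator hm
  simp_rw [e]
  have hInt : ∀ i ∈ Finset.range n, Integrable (fun x =>
      {x : ℕ → ℕ | x 0 ∈ E}.indicator (1 : (ℕ → ℕ) → ℝ) (fullShift^[i] x)) ν := fun i _ =>
    (map_iterate_of_invariant hinv i).integrable_comp_of_integrable hi
  rw [integral_finsetSum _ hInt]
  have : ∀ i, ∫ x, {x : ℕ → ℕ | x 0 ∈ E}.indicator (1 : (ℕ → ℕ) → ℝ) (fullShift^[i] x) ∂ν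
      = ν.real {x | x 0 ∈ E} := by
    intro i
    have hmp := map_iterate_of_invariant hinv i
    rw [← integral_map hmp.measurable.aemeasurable
      (by rw [hmp.map_eq]; exact hi.aestronglyMeasurable), hmp.map_eq, integral_indicator_one hm]
  simp [this]

lemma integral_rate_hits_le {E : Set ℕ} (hE : E.Nonempty) {ν : Measure (ℕ → ℕ)}
    [IsProbabilityMeasure ν] (hinv : Invariant fullShift ν) {n : ℕ} (hn : 0 < n) :
    ∫ x, rate E (hits E n x / n) ∂ν ≤ rate E (ν.real {x | x 0 ∈ E}) := by
  have hn' : (0 : ℝ) < n := by exact_mod_cast hn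
  have h1 := integral_comp_hits ν E n fun s => rate E (s / n)
  have h2 := integral_comp_hits ν E n fun s => s / n
  have h3 := integral_comp_hits ν E n fun _ => 1
  simp only [integral_const, probReal_univ, smul_eq_mul, mul_one] at h3
  rw [integral_div, integral_hits hinv, mul_div_cancel_left₀ _ hn'.ne'] at h2
  rw [h1, h2]
  have := (concaveOn_rate hE).le_map_sum (t := Finset.range (n + 1))
    (w := fun j => ν.real {x | hits E n x = j}) (p := fun j => (j : ℝ) / n)
    (fun _ _ => measureReal_nonneg) h3.symm (fun j hj => by
      rw [mem_Iic, div_le_one hn']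
      exact_mod_cast Nat.lt_succ_iff.1 (Finset.mem_range.1 hj))
  simpa only [smul_eq_mul] using this

/-- The weight given to the symbol `a` when the predicted symbol is `b`. -/
noncomputable def codeWeight (c d : ℝ) (a b : ℕ) : ℝ := if a = b then 1 - c else d

lemma codeWeight_pos {c d : ℝ} (hc : c < 1) (hd : 0 < d) (a b : ℕ) : 0 < codeWeight c d a b := by
  unfold codeWeight; split_ifs <;> linarith

lemma sum_codeWeight_le {c : ℝ} (hc0 : 0 < c) (hc : c < 1) {R : Finset ℕ} (hR : R.Nonempty)
    (b : ℕ) : ∑ a ∈ R, codeWeight c (c / R.card) a b ≤ 1 := by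
  have hK : (0 : ℝ) < R.card := by exact_mod_cast hR.card_pos
  calc ∑ a ∈ R, codeWeight c (c / R.card) a b
      ≤ ∑ a ∈ R, ((if a = b then 1 - c else 0) + c / R.card) := by
        refine Finset.sum_le_sum fun a _ => ?_
        unfold codeWeight
        split_ifs
        · have : 0 < c / R.card := by positivity
          linarith
        · simp
    _ ≤ 1 := by
        rw [Finset.sum_add_distrib, Finset.sum_ite_eq', Finset.sum_const, nsmul_eq_mul,
          mul_div_cancel₀ _ hK.ne']
        split_ifs <;> linarith

lemma integrable_gaussPotential {ν : Measure (ℕ → ℕ)} (h : IntegralGtBot gaussPotential ν) :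
    Integrable (fun x => -gaussPotential x) ν := by
  refine ⟨measurable_gaussPotential.neg.aestronglyMeasurable, ?_⟩
  rw [hasFiniteIntegral_iff_ofReal (ae_of_all _ fun x => neg_nonneg.2 (gaussPotential_nonpos x))]
  exact lt_top_iff_ne_top.2 h

lemma partitionEntropy_join_le {E : Set ℕ} (hE : E.Nonempty) {ν : Measure (ℕ → ℕ)}
    [IsProbabilityMeasure ν] (hinv : Invariant fullShift ν)
    (hφ : IntegralGtBot gaussPotential ν) {p : (ℕ → ℕ) → ℕ} (hp : Measurable p) (R : Finset ℕ)
    (hR : ∀ x, p x ∈ R) {c : ℝ} (hc0 : 0 < c) (hc : c < 1) (N : ℕ) (q : (Fin N → ℕ) → ℕ)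
    {n : ℕ} (hn : 0 < n) {D : ℝ}
    (hD : D = ((n : ℝ) + N) * (∫ x, -gaussPotential x ∂ν + rate E (ν.real {x | x 0 ∈ E}))
      + 2 + Real.log 4 + Real.log ((n : ℝ) + N + 1)
      + n * (-Real.log (1 - c) + ν.real {x | p x ≠ q (pre N x)} * Real.log (R.card / c))) :
    0 ≤ D ∧ partitionEntropy ν (fun x => fun i : Fin n => p (fullShift^[i] x))
      ≤ ENNReal.ofReal D := by
  classical
  have hRne : R.Nonempty := ⟨_, hR fun _ => 0⟩
  have hK : (0 : ℝ) < R.card := by exact_mod_cast hRne.card_pos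
  have hK1 : (1 : ℝ) ≤ R.card := by exact_mod_cast hRne.card_pos
  set d := c / R.card with hd
  have hd0 : 0 < d := by positivity
  set B := {x | p x ≠ q (pre N x)} with hB
  have hqm : Measurable fun x => q (pre N x) := (measurable_of_countable q).comp (measurable_pre N)
  have hBm : MeasurableSet B := (measurableSet_eq_fun hp hqm).compl
  set m := n + N with hm
  have hm0 : (0 : ℝ) < m := by positivity
  set G : (ℕ → ℕ) → ℝ := fun x => (tail E m (hits E m x) * (m + 1))⁻¹ with hG
  set W : (Fin n → ℕ) → (ℕ → ℕ) → ℝ := fun a x =>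
    ∏ i : Fin n, codeWeight c d (a i) (q (pre N (fullShift^[i] x))) with hW
  have hW0 : ∀ a x, 0 < W a x := fun a x => Finset.prod_pos fun i _ => codeWeight_pos hc hd0 _ _
  have hT : ∀ x, 0 < tail E m (hits E m x) := fun x => tail_pos hE m (hits_le E m x)
  have hG0 : ∀ x, 0 < G x := fun x => by have := hT x; positivity
  have hGm : Measurable G := by
    have : G = (fun w : Fin m → ℕ => (tail E m (hits E m (ext w)) * (m + 1))⁻¹) ∘ pre m := by
      funext x; simp [hG, hits_ext_pre]
    rw [this]; exact (measurable_of_countable _).comp (measurable_pre m)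
  have hWm : ∀ a, Measurable (W a) := fun a => by
    refine Finset.measurable_fun_prod _ fun i _ => ?_
    exact (measurable_of_countable fun b => codeWeight c d (a i) b).comp
      (hqm.comp (measurable_fullShift.iterate i))
  set Q' : (Fin n → ℕ) → ℝ≥0∞ := fun a => ∫⁻ x, ENNReal.ofReal (G x * W a x) ∂lebLaw with hQ'
  have hQsum : ∑ a ∈ Fintype.piFinset fun _ : Fin n => R, Q' a ≤ 1 := by
    rw [← lintegral_finsetSum (f := fun a x => ENNReal.ofReal (G x * W a x)) _
      fun a _ => (hGm.mul (hWm a)).ennreal_ofReal]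
    refine le_trans (lintegral_mono fun x => ?_) (lintegral_inv_tail_le hE m)
    rw [← ENNReal.ofReal_sum_of_nonneg fun a _ => (mul_pos (hG0 x) (hW0 a x)).le,
      ← Finset.mul_sum]
    refine ENNReal.ofReal_le_ofReal ?_
    have : ∑ a ∈ Fintype.piFinset fun _ : Fin n => R, W a x ≤ 1 := by
      have e := Finset.prod_univ_sum (fun _ : Fin n => R)
        fun i a => codeWeight c d a (q (pre N (fullShift^[i] x)))
      rw [← e]
      exact Finset.prod_le_one
        (fun i _ => Finset.sum_nonneg fun a _ => (codeWeight_pos hc hd0 _ _).le)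
        fun i _ => sum_codeWeight_le hc0 hc hRne _
    exact mul_le_of_le_one_right (hG0 x).le this
  have hQfin : ∀ a ∈ Fintype.piFinset fun _ : Fin n => R, Q' a ≠ ⊤ := fun a ha =>
    ne_top_of_le_ne_top ENNReal.one_ne_top
      ((Finset.single_le_sum (fun _ _ => bot_le) ha).trans hQsum)
  have hmem : ∀ x, (fun i : Fin n => p (fullShift^[i] x)) ∈ Fintype.piFinset fun _ : Fin n => R :=
    fun x => Fintype.mem_piFinset.2 fun i => hR _
  have hQlow : ∀ x, G x * W (fun i : Fin n => p (fullShift^[i] x)) x * len m x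
      ≤ (Q' fun i : Fin n => p (fullShift^[i] x)).toReal := by
    intro x
    refine (ENNReal.ofReal_le_iff_le_toReal (hQfin _ (hmem x))).1 ?_
    rw [ENNReal.ofReal_mul (mul_pos (hG0 x) (hW0 _ x)).le, ← lebLaw_cyl, ← setLIntegral_const]
    refine le_trans (le_of_eq ?_) (setLIntegral_le_lintegral (cyl m x) _)
    refine setLIntegral_congr_fun (measurableSet_cyl m x) fun y hy => ?_
    have hy' : ∀ i < m, y i = x i := hy
    have h1 : G y = G x := by simp only [hG]; rw [hits_congr E hy']
    have h2 : ∀ a, W a y = W a x := fun a => by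
      refine Finset.prod_congr rfl fun i _ => ?_
      congr 2
      funext j
      simp only [pre, fullShift_iterate]
      exact hy' _ (by omega)
    simp only [h1, h2]
  set L : (ℕ → ℕ) → ℝ := fun x =>
    ((∑ i ∈ Finset.range m, -gaussPotential (fullShift^[i] x)) + 2)
      + (m * rate E (hits E m x / m) + Real.log 4) + Real.log ((m : ℝ) + 1)
      + ∑ i ∈ Finset.range n, (-Real.log (1 - c)
        + B.indicator (1 : (ℕ → ℕ) → ℝ) (fullShift^[i] x) * Real.log (R.card / c)) with hL
  have hφi := integrable_gaussPotential hφ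
  have hmp := map_iterate_of_invariant hinv
  have hI1 : ∀ i, Integrable (fun x => -gaussPotential (fullShift^[i] x)) ν := fun i =>
    (hmp i).integrable_comp_of_integrable hφi
  have hBi : Integrable (B.indicator (1 : (ℕ → ℕ) → ℝ)) ν :=
    (integrable_const (1 : ℝ)).indicator hBm
  have hI2 : ∀ i, Integrable (fun x => B.indicator (1 : (ℕ → ℕ) → ℝ) (fullShift^[i] x)) ν :=
    fun i => (hmp i).integrable_comp_of_integrable hBi
  have hI3 : Integrable (fun x => rate E (hits E m x / m)) ν :=
    integrable_comp_hits ν E m fun s => rate E (s / m)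
  have hI4 : ∀ i, Integrable (fun x => -Real.log (1 - c)
        + B.indicator (1 : (ℕ → ℕ) → ℝ) (fullShift^[i] x) * Real.log (R.card / c)) ν :=
    fun i => (integrable_const _).add ((hI2 i).mul_const _)
  have hS1 : Integrable (fun x => ∑ i ∈ Finset.range m, -gaussPotential (fullShift^[i] x)) ν :=
    integrable_finsetSum _ fun i _ => hI1 i
  have hS4 : Integrable (fun x => ∑ i ∈ Finset.range n, (-Real.log (1 - c)
        + B.indicator (1 : (ℕ → ℕ) → ℝ) (fullShift^[i] x) * Real.log (R.card / c))) ν :=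
    integrable_finsetSum _ fun i _ => hI4 i
  have hLi : Integrable L ν :=
    (((hS1.add (integrable_const _)).add ((hI3.const_mul _).add (integrable_const _))).add
      (integrable_const _)).add hS4
  have hc1 : 0 ≤ -Real.log (1 - c) := by
    have := Real.log_nonpos (by linarith : 0 ≤ 1 - c) (by linarith); linarith
  have hLD : ∫ x, L x ∂ν ≤ D := by
    have e1 : ∀ i, ∫ x, -gaussPotential (fullShift^[i] x) ∂ν = ∫ x, -gaussPotential x ∂ν :=
      fun i => by
        have := integral_map (μ := ν) (f := fun x => -gaussPotential x)
          (hmp i).measurable.aemeasurable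
          measurable_gaussPotential.neg.aestronglyMeasurable
        rw [← this, (hmp i).map_eq]
    have e2 : ∀ i, ∫ x, B.indicator (1 : (ℕ → ℕ) → ℝ) (fullShift^[i] x) ∂ν = ν.real B :=
      fun i => by
        rw [← integral_map (hmp i).measurable.aemeasurable
          (by rw [(hmp i).map_eq]; exact hBi.aestronglyMeasurable), (hmp i).map_eq,
          integral_indicator_one hBm]
    have e3 : ∀ i, ∫ x, (-Real.log (1 - c)
        + B.indicator (1 : (ℕ → ℕ) → ℝ) (fullShift^[i] x) * Real.log (R.card / c)) ∂ν
        = -Real.log (1 - c) + ν.real B * Real.log (R.card / c) := fun i => by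
      rw [integral_add (integrable_const _) ((hI2 i).mul_const _), integral_mul_const, e2]
      simp
    have e4 := integral_rate_hits_le hE hinv (n := m) (by omega)
    have : ∫ x, L x ∂ν = (m * ∫ x, -gaussPotential x ∂ν + 2)
        + (m * ∫ x, rate E (hits E m x / m) ∂ν + Real.log 4) + Real.log ((m : ℝ) + 1)
        + n * (-Real.log (1 - c) + ν.real B * Real.log (R.card / c)) := by
      have hA := hS1.fun_add (integrable_const (2 : ℝ))
      have hB' := (hI3.const_mul m).fun_add (integrable_const (Real.log 4))
      have hC := hA.fun_add hB'
      have hD' := hC.fun_add (integrable_const (Real.log ((m : ℝ) + 1)))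
      simp only [hL]
      rw [integral_add hD' hS4, integral_add hC (integrable_const _), integral_add hA hB',
        integral_add hS1 (integrable_const _),
        integral_add (hI3.const_mul _) (integrable_const _),
        integral_finsetSum _ fun i _ => hI1 i, integral_finsetSum _ fun i _ => hI4 i,
        integral_const_mul]
      simp [e1, e3, mul_add]
    rw [this, hD]
    have := mul_le_mul_of_nonneg_left e4 hm0.le
    have hmc : (m : ℝ) = n + N := by simp [hm]
    rw [← hmc]
    linarith
  have key := partitionEntropy_le ν (fun x => fun i : Fin n => p (fullShift^[i] x))
    (Fintype.piFinset fun _ : Fin n => R) hmem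
    (fun a => (measurable_pi_lambda _ fun i : Fin n =>
      hp.comp (measurable_fullShift.iterate i)) (measurableSet_singleton a))
    (fun a => (Q' a).toReal) (fun _ _ => ENNReal.toReal_nonneg)
    (by rw [← ENNReal.toReal_sum hQfin]; exact ENNReal.toReal_le_of_le_ofReal zero_le_one
          (by simpa using hQsum)) hLi (fun x => ?_)
  · exact ⟨key.1.trans hLD, key.2.trans (ENNReal.ofReal_le_ofReal hLD)⟩
  · have hlen := len_pos m x
    have h0 : 0 < G x * W (fun i : Fin n => p (fullShift^[i] x)) x * len m x :=
      mul_pos (mul_pos (hG0 x) (hW0 _ x)) hlen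
    refine ⟨h0.trans_le (hQlow x), ?_⟩
    have h1 := Real.log_le_log h0 (hQlow x)
    rw [Real.log_mul (mul_pos (hG0 x) (hW0 _ x)).ne' hlen.ne',
      Real.log_mul (hG0 x).ne' (hW0 _ x).ne'] at h1
    have h2 := (abs_le.1 (abs_sum_gaussPotential_le m x)).1
    have h3 : -Real.log (G x) ≤ m * rate E (hits E m x / m) + Real.log 4
        + Real.log ((m : ℝ) + 1) := by
      have h4 := log_tail_le hE (β := hits E m x / m)
        ((div_le_one hm0).2 (hits_le E m x)) m
      rw [div_mul_cancel₀ _ hm0.ne'] at h4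
      simp only [hG]
      rw [Real.log_inv, Real.log_mul (hT x).ne' (by positivity)]
      linarith
    have h5 : -Real.log (W (fun i : Fin n => p (fullShift^[i] x)) x)
        ≤ ∑ i ∈ Finset.range n, (-Real.log (1 - c)
          + B.indicator (1 : (ℕ → ℕ) → ℝ) (fullShift^[i] x) * Real.log (R.card / c)) := by
      simp only [hW]
      rw [Real.log_prod fun i _ => (codeWeight_pos hc hd0 _ _).ne', ← Finset.sum_neg_distrib,
        Finset.sum_range]
      refine Finset.sum_le_sum fun i _ => ?_
      by_cases hx : fullShift^[i] x ∈ B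
      · have hx' : p (fullShift^[i] x) ≠ q (pre N (fullShift^[i] x)) := hx
        rw [codeWeight, if_neg hx', indicator_of_mem hx, hd, Pi.one_apply, one_mul,
          ← Real.log_inv, inv_div]
        linarith
      · have hx' : p (fullShift^[i] x) = q (pre N (fullShift^[i] x)) := not_not.1 hx
        rw [codeWeight, if_pos hx', indicator_of_notMem hx]
        simp
    simp only [hL]
    linarith

lemma tendsto_const_div_nat_add (C : ℝ) : Tendsto (fun n : ℕ => C / (n : ℝ)) atTop (𝓝 0) :=
  tendsto_const_nhds.div_atTop tendsto_natCast_atTop_atTop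

lemma tendsto_log_add_div (N : ℕ) :
    Tendsto (fun n : ℕ => Real.log ((n : ℝ) + N + 1) / n) atTop (𝓝 0) := by
  have h1 : Tendsto (fun n : ℕ => ((n : ℝ) + N + 1)) atTop atTop :=
    tendsto_atTop_add_const_right _ _ (tendsto_atTop_add_const_right _ _
      tendsto_natCast_atTop_atTop)
  have h2 : Tendsto (fun n : ℕ => Real.log ((n : ℝ) + N + 1) / ((n : ℝ) + N + 1)) atTop (𝓝 0) :=
    (Real.isLittleO_log_id_atTop.tendsto_div_nhds_zero).comp h1
  have h3 : Tendsto (fun n : ℕ => 1 + ((N : ℝ) + 1) / n) atTop (𝓝 (1 + 0)) :=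
    tendsto_const_nhds.add (tendsto_const_div_nat_add _)
  have h4 := h2.mul h3
  rw [zero_mul] at h4
  refine h4.congr' ?_
  filter_upwards [eventually_gt_atTop 0] with n hn
  have : (0 : ℝ) < n := by exact_mod_cast hn
  field_simp
  ring

lemma liminf_partitionEntropy_le {E : Set ℕ} (hE : E.Nonempty) {ν : Measure (ℕ → ℕ)}
    [IsProbabilityMeasure ν] (hinv : Invariant fullShift ν)
    (hφ : IntegralGtBot gaussPotential ν) {p : (ℕ → ℕ) → ℕ} (hp : Measurable p)
    (hpf : (Set.range p).Finite) {ε : ℝ} (hε : 0 < ε) :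
    0 ≤ ∫ x, -gaussPotential x ∂ν + rate E (ν.real {x | x 0 ∈ E}) + ε ∧
    (atTop.liminf fun n : ℕ => ENNReal.ofReal ((n : ℝ)⁻¹)
        * partitionEntropy ν (fun x => fun i : Fin n => p (fullShift^[i] x)))
      ≤ ENNReal.ofReal (∫ x, -gaussPotential x ∂ν + rate E (ν.real {x | x 0 ∈ E}) + ε) := by
  set R := hpf.toFinset with hRd
  have hR : ∀ x, p x ∈ R := fun x => by simp [hRd]
  have hRne : R.Nonempty := ⟨_, hR fun _ => 0⟩
  have hK1 : (1 : ℝ) ≤ R.card := by exact_mod_cast hRne.card_pos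
  set c := 1 - Real.exp (-(ε / 2)) with hcd
  have hc0 : 0 < c := by
    have : Real.exp (-(ε / 2)) < 1 := by
      rw [← Real.exp_zero]; exact Real.exp_lt_exp.2 (by linarith)
    simp only [hcd]; linarith
  have hc : c < 1 := by
    have := Real.exp_pos (-(ε / 2)); simp only [hcd]; linarith
  have hclog : -Real.log (1 - c) = ε / 2 := by
    simp only [hcd, sub_sub_cancel, Real.log_exp, neg_neg]
  have hl0 : 0 ≤ Real.log (R.card / c) :=
    Real.log_nonneg ((one_le_div hc0).2 (by linarith))
  obtain ⟨N, q, hq⟩ := exists_code_approx ν hp R hR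
    (δ := ε / 2 / (Real.log (R.card / c) + 1)) (by positivity)
  set b := ν.real {x | p x ≠ q (pre N x)} with hb
  have hbl : b * Real.log (R.card / c) ≤ ε / 2 := by
    rw [le_div_iff₀ (by positivity)] at hq
    have : 0 ≤ b := measureReal_nonneg
    nlinarith
  set s := ∫ x, -gaussPotential x ∂ν + rate E (ν.real {x | x 0 ∈ E}) with hs
  set D : ℕ → ℝ := fun n => ((n : ℝ) + N) * s + 2 + Real.log 4 + Real.log ((n : ℝ) + N + 1)
      + n * (-Real.log (1 - c) + b * Real.log (R.card / c)) with hD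
  have hkey : ∀ n, 0 < n → 0 ≤ D n ∧
      partitionEntropy ν (fun x => fun i : Fin n => p (fullShift^[i] x)) ≤ ENNReal.ofReal (D n) :=
    fun n hn => partitionEntropy_join_le hE hinv hφ hp R hR hc0 hc N q hn rfl
  have hlim : Tendsto (fun n : ℕ => (n : ℝ)⁻¹ * D n) atTop
      (𝓝 (s + (-Real.log (1 - c) + b * Real.log (R.card / c)))) := by
    have h := ((tendsto_const_div_nat_add (N * s + 2 + Real.log 4)).add
      (tendsto_log_add_div N)).add_const (s + (-Real.log (1 - c) + b * Real.log (R.card / c)))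
    rw [add_zero, zero_add] at h
    refine h.congr' ?_
    filter_upwards [eventually_gt_atTop 0] with n hn
    have : (0 : ℝ) < n := by exact_mod_cast hn
    simp only [hD]
    field_simp
    ring
  have hle : s + (-Real.log (1 - c) + b * Real.log (R.card / c)) ≤ s + ε := by
    rw [hclog]; linarith
  constructor
  · refine (ge_of_tendsto hlim ?_).trans hle
    filter_upwards [eventually_gt_atTop 0] with n hn
    have := (hkey n hn).1
    positivity
  · refine le_trans ?_ (ENNReal.ofReal_le_ofReal hle)
    rw [← (ENNReal.tendsto_ofReal hlim).liminf_eq]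
    refine liminf_le_liminf ?_
    filter_upwards [eventually_gt_atTop 0] with n hn
    rw [ENNReal.ofReal_mul (by positivity)]
    exact mul_le_mul_right (hkey n hn).2 _

lemma entropy_le {E : Set ℕ} (hE : E.Nonempty) {ν : Measure (ℕ → ℕ)}
    [IsProbabilityMeasure ν] (hinv : Invariant fullShift ν)
    (hφ : IntegralGtBot gaussPotential ν) :
    0 ≤ ∫ x, -gaussPotential x ∂ν + rate E (ν.real {x | x 0 ∈ E}) ∧
    entropy fullShift ν
      ≤ ENNReal.ofReal (∫ x, -gaussPotential x ∂ν + rate E (ν.real {x | x 0 ∈ E})) := by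
  have h0 : 0 ≤ ∫ x, -gaussPotential x ∂ν + rate E (ν.real {x | x 0 ∈ E}) :=
    le_of_forall_pos_le_add fun ε hε =>
      (liminf_partitionEntropy_le hE hinv hφ (p := fun _ => 0) measurable_const
        (by simp) hε).1
  refine ⟨h0, iSup₂_le fun p hp => ENNReal.le_of_forall_pos_le_add fun ε hε _ => ?_⟩
  refine (liminf_partitionEntropy_le hE hinv hφ hp.1 hp.2 (ε := ε)
    (by exact_mod_cast hε)).2.trans ?_
  rw [ENNReal.ofReal_add h0 ε.coe_nonneg, ENNReal.ofReal_coe_nnreal]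

lemma eintegral_gaussPotential {ν : Measure (ℕ → ℕ)} (hφ : IntegralGtBot gaussPotential ν) :
    eintegral gaussPotential ν = ((-∫ x, -gaussPotential x ∂ν : ℝ) : EReal) := by
  have h1 : ∀ x, ENNReal.ofReal (gaussPotential x) = 0 := fun x =>
    ENNReal.ofReal_of_nonpos (gaussPotential_nonpos x)
  rw [eintegral, ← ofReal_integral_eq_lintegral_ofReal (integrable_gaussPotential hφ)
    (ae_of_all _ fun x => neg_nonneg.2 (gaussPotential_nonpos x))]
  simp only [h1, lintegral_zero]
  rw [EReal.coe_ennreal_ofReal, max_eq_left]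
  · simp
  · exact integral_nonneg fun x => neg_nonneg.2 (gaussPotential_nonpos x)

lemma freeEnergy_eq {ν : ProbabilityMeasure (ℕ → ℕ)} (hinv : Invariant fullShift (ν : Measure _))
    (hφ : IntegralGtBot gaussPotential (ν : Measure _)) :
    freeEnergy fullShift gaussPotential 0 ν = ((entropy fullShift (ν : Measure _) : ℝ≥0∞) : EReal)
      + ((-∫ x, -gaussPotential x ∂(ν : Measure (ℕ → ℕ)) : ℝ) : EReal) := by
  rw [freeEnergy, if_pos ⟨hinv, hφ⟩, eintegral_gaussPotential hφ]
  simp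

lemma freeEnergy_le_rate {E : Set ℕ} (hE : E.Nonempty) (ν : ProbabilityMeasure (ℕ → ℕ)) :
    freeEnergy fullShift gaussPotential 0 ν
      ≤ ((rate E ((ν : Measure (ℕ → ℕ)).real {x | x 0 ∈ E}) : ℝ) : EReal) := by
  by_cases h : Invariant fullShift (ν : Measure _) ∧ IntegralGtBot gaussPotential (ν : Measure _)
  · obtain ⟨h0, h1⟩ := entropy_le hE h.1 h.2
    rw [freeEnergy_eq h.1 h.2]
    have h2 : ((entropy fullShift (ν : Measure _) : ℝ≥0∞) : EReal) ≤ _ :=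
      EReal.coe_ennreal_le_coe_ennreal_iff.2 h1
    rw [EReal.coe_ennreal_ofReal, max_eq_left h0] at h2
    refine (add_le_add_left h2 _).trans ?_
    rw [← EReal.coe_add, EReal.coe_le_coe_iff]
    linarith
  · rw [freeEnergy, if_neg h]; exact bot_le

lemma continuous_measureReal_zero_mem (E : Set ℕ) :
    Continuous fun ν : ProbabilityMeasure (ℕ → ℕ) =>
      (ν : Measure (ℕ → ℕ)).real {x | x 0 ∈ E} := by
  have hcl : IsClopen {x : ℕ → ℕ | x 0 ∈ E} :=
    (isClopen_discrete E).preimage (continuous_apply 0)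
  rw [continuous_iff_continuousAt]
  intro ν
  have := ProbabilityMeasure.tendsto_measure_of_null_frontier_of_tendsto
    (μs := fun ν : ProbabilityMeasure (ℕ → ℕ) => ν) (tendsto_id (x := 𝓝 ν))
    (E := {x | x 0 ∈ E}) (by rw [hcl.frontier_eq]; simp)
  exact NNReal.continuous_coe.continuousAt.tendsto.comp this

lemma neg_rate_le_rateOf {E : Set ℕ} (hE : E.Nonempty) (μ : ProbabilityMeasure (ℕ → ℕ)) :
    ((-rate E ((μ : Measure (ℕ → ℕ)).real {x | x 0 ∈ E}) : ℝ) : EReal)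
      ≤ rateOf (freeEnergy fullShift gaussPotential 0) μ := by
  set α := (μ : Measure (ℕ → ℕ)).real {x | x 0 ∈ E} with hα
  have hα1 : α ≤ 1 := measureReal_le_one
  rw [rateOf, EReal.coe_neg, EReal.neg_le_neg_iff]
  refine EReal.le_of_forall_lt_iff_le.1 fun z hz => ?_
  have hz' : rate E α < z := by exact_mod_cast hz
  obtain ⟨δ, hδ, h⟩ := exists_rate_le hE hα1 (sub_pos.2 hz')
  refine iInf₂_le_of_le {ν | α - δ < (ν : Measure (ℕ → ℕ)).real {x | x 0 ∈ E}}
    ⟨isOpen_lt continuous_const (continuous_measureReal_zero_mem E), ?_⟩ (iSup₂_le fun ν hν => ?_)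
  · simp only [mem_ofPred_eq, ← hα]; linarith
  · refine (freeEnergy_le_rate hE ν).trans ?_
    have := h _ hν measureReal_le_one
    rw [EReal.coe_le_coe_iff]; linarith

lemma rateOf_le_neg {Y : Type*} [TopologicalSpace Y] (F : Y → EReal) (y : Y) :
    rateOf F y ≤ -F y := by
  rw [rateOf, EReal.neg_le_neg_iff]
  exact le_iInf₂ fun G hG => le_iSup₂_of_le y hG.2 le_rfl

/-- If almost every fibre has mass at most `exp (-V)`, then the entropy is at least `∫ V`. -/
lemma lintegral_le_partitionEntropy {X A : Type*} [MeasurableSpace X] [Countable A]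
    (ν : Measure X) [IsProbabilityMeasure ν] (g : X → A)
    (hg : ∀ a, MeasurableSet (g ⁻¹' {a})) {V : X → ℝ}
    (h : ∀ᵐ x ∂ν, ν.real (g ⁻¹' {g x}) ≤ Real.exp (-V x)) :
    ∫⁻ x, ENNReal.ofReal (V x) ∂ν ≤ partitionEntropy ν g := by
  have hu : (⋃ a, g ⁻¹' {a}) = univ := by ext x; simp
  have hd : Pairwise (Function.onFun Disjoint fun a => g ⁻¹' {a}) := fun a b hab =>
    Disjoint.preimage g (by simpa using hab)
  rw [← setLIntegral_univ, ← hu, lintegral_iUnion hg hd, partitionEntropy]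
  refine ENNReal.tsum_le_tsum fun a => ?_
  change _ ≤ ENNReal.ofReal (-(ν.real (g ⁻¹' {a}) * Real.log (ν.real (g ⁻¹' {a}))))
  by_cases h0 : ν (g ⁻¹' {a}) = 0
  · rw [Measure.restrict_eq_zero.2 h0]; simp
  have hpos : 0 < ν.real (g ⁻¹' {a}) := ENNReal.toReal_pos h0 (measure_ne_top _ _)
  calc ∫⁻ x in g ⁻¹' {a}, ENNReal.ofReal (V x) ∂ν
      ≤ ∫⁻ _x in g ⁻¹' {a}, ENNReal.ofReal (-Real.log (ν.real (g ⁻¹' {a}))) ∂ν := by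
        refine lintegral_mono_ae ?_
        filter_upwards [ae_restrict_of_ae h, ae_restrict_mem (hg a)] with x hx hxa
        rw [show g x = a from hxa] at hx
        refine ENNReal.ofReal_le_ofReal ?_
        have := Real.log_le_log hpos hx
        rw [Real.log_exp] at this
        linarith
    _ = _ := by
        rw [setLIntegral_const, ← ofReal_measureReal, ← ENNReal.ofReal_mul' measureReal_nonneg]
        congr 1; ring

lemma partitionEntropy_map {X Z A : Type*} [MeasurableSpace X] [MeasurableSpace Z]
    (ν : Measure X) {f : X → Z} (hf : Measurable f) (g : Z → A)
    (hg : ∀ a, MeasurableSet (g ⁻¹' {a})) :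
    partitionEntropy (ν.map f) g = partitionEntropy ν (g ∘ f) := by
  simp only [partitionEntropy, Measure.map_apply hf (hg _), preimage_comp]

/-- The entropy of a partition is a concave function of the measure. -/
lemma le_partitionEntropy_average {X A : Type*} [MeasurableSpace X] {m : ℕ} (hm : 0 < m)
    (β : ℕ → Measure X) [∀ j, IsProbabilityMeasure (β j)] (g : X → A) {H : ℝ≥0∞}
    (h : ∀ j < m, H ≤ partitionEntropy (β j) g) :
    H ≤ partitionEntropy ((m : ℝ≥0∞)⁻¹ • ∑ j ∈ Finset.range m, β j) g := by
  have hm' : (0 : ℝ) < m := by exact_mod_cast hm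
  have hmi : (m : ℝ≥0∞)⁻¹ = ENNReal.ofReal ((m : ℝ)⁻¹) := by
    rw [ENNReal.ofReal_inv_of_pos hm', ENNReal.ofReal_natCast]
  calc H = ∑ j ∈ Finset.range m, (m : ℝ≥0∞)⁻¹ * H := by
        rw [Finset.sum_const, Finset.card_range, nsmul_eq_mul, ← mul_assoc,
          ENNReal.mul_inv_cancel (by exact_mod_cast hm.ne') (ENNReal.natCast_ne_top m), one_mul]
    _ ≤ ∑ j ∈ Finset.range m, (m : ℝ≥0∞)⁻¹ * partitionEntropy (β j) g :=
        Finset.sum_le_sum fun j hj => mul_le_mul_right (h j (Finset.mem_range.1 hj)) _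
    _ = ∑' a, ∑ j ∈ Finset.range m, ENNReal.ofReal ((m : ℝ)⁻¹ *
          Real.negMulLog ((β j).real (g ⁻¹' {a}))) := by
        rw [Summable.tsum_finsetSum fun _ _ => ENNReal.summable]
        refine Finset.sum_congr rfl fun j _ => ?_
        rw [partitionEntropy, ← ENNReal.tsum_mul_left]
        refine tsum_congr fun a => ?_
        rw [ENNReal.ofReal_mul (by positivity), hmi, Real.negMulLog, neg_mul]
        rfl
    _ ≤ _ := by
        refine ENNReal.tsum_le_tsum fun a => ?_
        have h1 : ((((m : ℝ≥0∞)⁻¹ • ∑ j ∈ Finset.range m, β j) : Measure X) (g ⁻¹' {a})).toReal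
            = ∑ j ∈ Finset.range m, (m : ℝ)⁻¹ • (β j).real (g ⁻¹' {a}) := by
          rw [Measure.smul_apply, Measure.finsetSum_apply, smul_eq_mul, ENNReal.toReal_mul,
            ENNReal.toReal_sum fun j _ => measure_ne_top _ _, Finset.mul_sum]
          simp [Measure.real]
        rw [h1, ← ENNReal.ofReal_sum_of_nonneg]
        · refine ENNReal.ofReal_le_ofReal ?_
          have := Real.concaveOn_negMulLog.le_map_sum (t := Finset.range m)
            (w := fun _ => (m : ℝ)⁻¹) (p := fun j => (β j).real (g ⁻¹' {a}))
            (fun _ _ => by positivity) (by simp [hm'.ne']) fun _ _ => measureReal_nonneg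
          simpa only [Real.negMulLog, neg_mul, smul_eq_mul] using this
        · exact fun j _ => mul_nonneg (by positivity)
            (Real.negMulLog_nonneg measureReal_nonneg measureReal_le_one)

/-- The concatenation of a sequence of words of length `m`. -/
def conc {m : ℕ} (hm : 0 < m) (y : ℕ → Fin m → ℕ) : ℕ → ℕ :=
  fun i => y (i / m) ⟨i % m, Nat.mod_lt i hm⟩

lemma conc_mul_add {m : ℕ} (hm : 0 < m) (y : ℕ → Fin m → ℕ) (l : ℕ) (i : Fin m) :
    conc hm y (m * l + i) = y l i := by
  have h1 : (m * l + i) / m = l := by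
    rw [Nat.mul_add_div hm, Nat.div_eq_of_lt i.2, add_zero]
  have h2 : (m * l + i) % m = i := by
    rw [Nat.mul_add_mod, Nat.mod_eq_of_lt i.2]
  simp only [conc, h2, h1]

lemma measurable_conc {m : ℕ} (hm : 0 < m) : Measurable (conc hm) :=
  measurable_pi_lambda _ fun _ => (measurable_pi_apply _).comp (measurable_pi_apply _)

lemma iterate_conc {m : ℕ} (hm : 0 < m) (y : ℕ → Fin m → ℕ) :
    fullShift^[m] (conc hm y) = conc hm fun l => y (l + 1) := by
  funext i
  simp only [fullShift_iterate, conc, Nat.add_mod_right, Nat.add_div_right i hm]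

lemma map_succ_infinitePi {Z : Type*} [MeasurableSpace Z] (ω : Measure Z)
    [IsProbabilityMeasure ω] :
    (Measure.infinitePi fun _ : ℕ => ω).map (fun y l => y (l + 1))
      = Measure.infinitePi fun _ : ℕ => ω :=
  Measure.map_infinitePi_infinitePi_of_inj (P := fun _ : ℕ => ω) Nat.succ_injective

/-- The law of a sequence of independent words with law `ω`, concatenated. -/
noncomputable def blockLaw {m : ℕ} (hm : 0 < m) (ω : Measure (Fin m → ℕ))
    [IsProbabilityMeasure ω] : Measure (ℕ → ℕ) :=
  (Measure.infinitePi fun _ : ℕ => ω).map (conc hm)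

instance {m : ℕ} (hm : 0 < m) (ω : Measure (Fin m → ℕ)) [IsProbabilityMeasure ω] :
    IsProbabilityMeasure (blockLaw hm ω) :=
  Measure.isProbabilityMeasure_map (measurable_conc hm).aemeasurable

lemma map_iterate_blockLaw {m : ℕ} (hm : 0 < m) (ω : Measure (Fin m → ℕ))
    [IsProbabilityMeasure ω] : (blockLaw hm ω).map fullShift^[m] = blockLaw hm ω := by
  rw [blockLaw, Measure.map_map (measurable_fullShift.iterate m) (measurable_conc hm)]
  have : fullShift^[m] ∘ conc hm = conc hm ∘ fun y l => y (l + 1) :=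
    funext fun y => iterate_conc hm y
  rw [this, ← Measure.map_map (measurable_conc hm)
    (measurable_pi_lambda _ fun l => measurable_pi_apply _), map_succ_infinitePi]

/-- The stationary average of `blockLaw`. -/
noncomputable def blockAverage {m : ℕ} (hm : 0 < m) (ω : Measure (Fin m → ℕ))
    [IsProbabilityMeasure ω] : Measure (ℕ → ℕ) :=
  (m : ℝ≥0∞)⁻¹ • ∑ j ∈ Finset.range m, (blockLaw hm ω).map fullShift^[j]

instance isProbabilityMeasure_map_iterate (μ : Measure (ℕ → ℕ)) [IsProbabilityMeasure μ] (j : ℕ) :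
    IsProbabilityMeasure (μ.map fullShift^[j]) :=
  Measure.isProbabilityMeasure_map (measurable_fullShift.iterate j).aemeasurable

instance {m : ℕ} (hm : 0 < m) (ω : Measure (Fin m → ℕ)) [IsProbabilityMeasure ω] :
    IsProbabilityMeasure (blockAverage hm ω) := by
  refine ⟨?_⟩
  rw [blockAverage, Measure.smul_apply, Measure.finsetSum_apply]
  simp only [measure_univ, Finset.sum_const, Finset.card_range, nsmul_eq_mul, mul_one, smul_eq_mul]
  exact ENNReal.inv_mul_cancel (by exact_mod_cast hm.ne') (ENNReal.natCast_ne_top m)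

lemma invariant_blockAverage {m : ℕ} (hm : 0 < m) (ω : Measure (Fin m → ℕ))
    [IsProbabilityMeasure ω] : Invariant fullShift (blockAverage hm ω) := by
  rw [Invariant, blockAverage, Measure.map_smul]
  congr 1
  rw [Measure.map_finset_sum measurable_fullShift.aemeasurable]
  have : ∀ j, ((blockLaw hm ω).map fullShift^[j]).map fullShift
      = (blockLaw hm ω).map fullShift^[j + 1] := fun j => by
    rw [Measure.map_map measurable_fullShift (measurable_fullShift.iterate j),
      Function.iterate_succ']
  simp_rw [this]
  obtain ⟨k, rfl⟩ : ∃ k, m = k + 1 := ⟨m - 1, by omega⟩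
  rw [Finset.sum_range_succ, map_iterate_blockLaw hm ω, Finset.sum_range_succ']
  simp

lemma lintegral_blockAverage {m : ℕ} (hm : 0 < m) (ω : Measure (Fin m → ℕ))
    [IsProbabilityMeasure ω] {f : (ℕ → ℕ) → ℝ≥0∞} (hf : Measurable f) :
    ∫⁻ x, f x ∂(blockAverage hm ω) = (m : ℝ≥0∞)⁻¹ *
      ∫⁻ y, ∑ j ∈ Finset.range m, f (fullShift^[j] (conc hm y))
        ∂(Measure.infinitePi fun _ : ℕ => ω) := by
  have hc : ∀ j, Measurable fun y => f (fullShift^[j] (conc hm y)) := fun j =>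
    hf.comp ((measurable_fullShift.iterate j).comp (measurable_conc hm))
  rw [blockAverage, lintegral_smul_measure, lintegral_finsetSum_measure, smul_eq_mul,
    lintegral_finsetSum _ fun j _ => hc j]
  congr 1
  refine Finset.sum_congr rfl fun j _ => ?_
  rw [lintegral_map hf (measurable_fullShift.iterate j), blockLaw,
    lintegral_map (f := fun x => f (fullShift^[j] x))
      (hf.comp (measurable_fullShift.iterate j)) (measurable_conc hm)]

/-- The law on words of length `m` with weights `w` on the finite set `s`. -/
noncomputable def wordLaw {m : ℕ} (s : Finset (Fin m → ℕ)) (w : (Fin m → ℕ) → ℝ) :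
    Measure (Fin m → ℕ) :=
  ∑ u ∈ s, ENNReal.ofReal (w u) • Measure.dirac u

lemma isProbabilityMeasure_wordLaw {m : ℕ} {s : Finset (Fin m → ℕ)} {w : (Fin m → ℕ) → ℝ}
    (hw : ∀ u ∈ s, 0 ≤ w u) (h1 : ∑ u ∈ s, w u = 1) : IsProbabilityMeasure (wordLaw s w) := by
  refine ⟨?_⟩
  simp only [wordLaw, Measure.finsetSum_apply, Measure.smul_apply, measure_univ, smul_eq_mul,
    mul_one]
  rw [← ENNReal.ofReal_sum_of_nonneg hw, h1, ENNReal.ofReal_one]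

lemma wordLaw_singleton {m : ℕ} {s : Finset (Fin m → ℕ)} {w : (Fin m → ℕ) → ℝ}
    {u : Fin m → ℕ} (hu : u ∈ s) : wordLaw s w {u} = ENNReal.ofReal (w u) := by
  classical
  rw [wordLaw, Measure.finsetSum_apply, Finset.sum_eq_single_of_mem u hu]
  · simp
  · intro v _ hv
    simp [hv]

lemma lintegral_wordLaw {m : ℕ} (s : Finset (Fin m → ℕ)) (w : (Fin m → ℕ) → ℝ)
    (f : (Fin m → ℕ) → ℝ≥0∞) :
    ∫⁻ u, f u ∂(wordLaw s w) = ∑ u ∈ s, ENNReal.ofReal (w u) * f u := by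
  rw [wordLaw, lintegral_finsetSum_measure]
  simp [lintegral_smul_measure]

lemma ae_wordLaw {m : ℕ} (s : Finset (Fin m → ℕ)) (w : (Fin m → ℕ) → ℝ) :
    ∀ᵐ u ∂(wordLaw s w), u ∈ s ∧ 0 < w u := by
  rw [ae_iff, wordLaw, Measure.finsetSum_apply, Finset.sum_eq_zero]
  intro u hu
  rw [Measure.smul_apply, smul_eq_mul]
  by_cases h : 0 < w u
  · simp [hu, h]
  · simp [ENNReal.ofReal_of_nonpos (not_lt.1 h)]

lemma sum_wordLaw_negMulLog {m : ℕ} {s : Finset (Fin m → ℕ)} {w : (Fin m → ℕ) → ℝ}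
    (hw : ∀ u ∈ s, 0 ≤ w u) (hw1 : ∀ u ∈ s, w u ≤ 1) :
    ∫⁻ u, ENNReal.ofReal (-Real.log (w u)) ∂(wordLaw s w)
      = ENNReal.ofReal (∑ u ∈ s, Real.negMulLog (w u)) := by
  rw [lintegral_wordLaw, ENNReal.ofReal_sum_of_nonneg fun u hu =>
    Real.negMulLog_nonneg (hw u hu) (hw1 u hu)]
  refine Finset.sum_congr rfl fun u hu => ?_
  rw [← ENNReal.ofReal_mul (hw u hu), Real.negMulLog]
  congr 1; ring

/-- The truncated first digit. -/
def truncDigit (K : ℕ) (x : ℕ → ℕ) : ℕ := min (x 0) K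

lemma measurable_truncDigit (K : ℕ) : Measurable (truncDigit K) :=
  (measurable_pi_apply 0).min measurable_const

lemma finite_range_truncDigit (K : ℕ) : (Set.range (truncDigit K)).Finite :=
  (Set.finite_Iic K).subset (by rintro _ ⟨x, rfl⟩; exact min_le_right (x 0) K)

/-- The partition into words of truncated digits determines the blocks `1, …, N`. -/
lemma block_eq_of_trunc_eq {m : ℕ} (hm : 0 < m) {K j n N : ℕ} (hj : j < m) (hN : m * (N + 1) ≤ n)
    {y y' : ℕ → Fin m → ℕ} (hy : ∀ l i, y l i ≤ K) (hy' : ∀ i, ∀ l, y' l i ≤ K)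
    (h : ∀ i : Fin n, truncDigit K (fullShift^[i] (fullShift^[j] (conc hm y')))
      = truncDigit K (fullShift^[i] (fullShift^[j] (conc hm y)))) :
    ∀ l, 1 ≤ l → l ≤ N → y' l = y l := by
  intro l hl1 hlN
  funext i
  have h1 : m * 1 ≤ m * l := Nat.mul_le_mul_left m hl1
  have h2 : m * l ≤ m * N := Nat.mul_le_mul_left m hlN
  have h3 : m * (N + 1) = m * N + m := by ring
  have hi := i.2
  have := h ⟨m * l + i - j, by omega⟩
  simp only [truncDigit, fullShift_iterate, zero_add] at this
  rw [show m * l + i - j + j = m * l + i by omega, conc_mul_add, conc_mul_add,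
    min_eq_left (hy l i), min_eq_left (hy' i l)] at this
  exact this

lemma le_partitionEntropy_map_blockLaw {m : ℕ} (hm : 0 < m) {s : Finset (Fin m → ℕ)}
    {w : (Fin m → ℕ) → ℝ} (hw : ∀ u ∈ s, 0 ≤ w u) (h1 : ∑ u ∈ s, w u = 1)
    [IsProbabilityMeasure (wordLaw s w)] {K j n N : ℕ} (hK : ∀ u ∈ s, ∀ i, u i ≤ K) (hj : j < m)
    (hN : m * (N + 1) ≤ n) :
    N * ENNReal.ofReal (∑ u ∈ s, Real.negMulLog (w u))
      ≤ partitionEntropy ((blockLaw hm (wordLaw s w)).map fullShift^[j])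
          (fun x => fun i : Fin n => truncDigit K (fullShift^[i] x)) := by
  set P := Measure.infinitePi fun _ : ℕ => wordLaw s w with hP
  have hw1 : ∀ u ∈ s, w u ≤ 1 := fun u hu => h1 ▸ Finset.single_le_sum hw hu
  have hgm : Measurable fun x => fun i : Fin n => truncDigit K (fullShift^[i] x) :=
    measurable_pi_lambda _ fun i =>
      (measurable_truncDigit K).comp (measurable_fullShift.iterate i)
  have hfm : Measurable (fullShift^[j] ∘ conc hm) :=
    (measurable_fullShift.iterate j).comp (measurable_conc hm)
  rw [blockLaw, Measure.map_map (measurable_fullShift.iterate j) (measurable_conc hm),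
    partitionEntropy_map _ hfm _ fun a => hgm (measurableSet_singleton a)]
  have hmp : ∀ l : ℕ, MeasurePreserving (fun y : ℕ → Fin m → ℕ => y l) P (wordLaw s w) :=
    fun l => measurePreserving_eval_infinitePi (fun _ : ℕ => wordLaw s w) l
  have hae : ∀ᵐ y ∂P, ∀ l, y l ∈ s ∧ 0 < w (y l) := by
    rw [ae_all_iff]
    intro l
    exact (hmp l).quasiMeasurePreserving.ae (ae_wordLaw s w)
  set V : (ℕ → Fin m → ℕ) → ℝ := fun y => ∑ l ∈ Finset.Icc 1 N, -Real.log (w (y l)) with hV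
  refine le_trans (le_of_eq ?_) (lintegral_le_partitionEntropy P _
    (fun a => (hgm.comp hfm) (measurableSet_singleton a)) (V := V) ?_)
  · have e : ∫⁻ y, ENNReal.ofReal (V y) ∂P
        = ∫⁻ y, ∑ l ∈ Finset.Icc 1 N, ENNReal.ofReal (-Real.log (w (y l))) ∂P := by
      refine lintegral_congr_ae ?_
      filter_upwards [hae] with y hy
      rw [hV, ENNReal.ofReal_sum_of_nonneg]
      exact fun l _ => neg_nonneg.2 (Real.log_nonpos (hy l).2.le (hw1 _ (hy l).1))
    have hmeas : ∀ l, Measurable fun y : ℕ → Fin m → ℕ => ENNReal.ofReal (-Real.log (w (y l))) :=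
      fun l => (measurable_of_countable fun u : Fin m → ℕ =>
        ENNReal.ofReal (-Real.log (w u))).comp (measurable_pi_apply l)
    have e2 : ∀ l, ∫⁻ y, ENNReal.ofReal (-Real.log (w (y l))) ∂P
        = ENNReal.ofReal (∑ u ∈ s, Real.negMulLog (w u)) := fun l => by
      rw [← sum_wordLaw_negMulLog hw hw1]
      exact (hmp l).lintegral_comp
        (measurable_of_countable fun u : Fin m → ℕ => ENNReal.ofReal (-Real.log (w u)))
    rw [e, lintegral_finsetSum _ fun l _ => hmeas l]
    simp [e2]
  · filter_upwards [hae] with y hy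
    have hset : P ((Finset.Icc 1 N : Set ℕ).pi fun l => {y l})
        = ENNReal.ofReal (Real.exp (-V y)) := by
      rw [hP, Measure.infinitePi_pi _ fun l _ => measurableSet_singleton _]
      rw [hV, ← Finset.sum_neg_distrib, Real.exp_sum,
        ENNReal.ofReal_prod_of_nonneg fun l _ => (Real.exp_pos _).le]
      refine Finset.prod_congr rfl fun l _ => ?_
      rw [wordLaw_singleton (hy l).1, neg_neg, Real.exp_log (hy l).2]
    refine ENNReal.toReal_le_of_le_ofReal (Real.exp_pos _).le ?_
    rw [← hset]
    refine measure_mono_ae ?_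
    filter_upwards [hae] with y' hy' hmem
    have hmem' : ∀ i : Fin n, truncDigit K (fullShift^[i] (fullShift^[j] (conc hm y')))
      = truncDigit K (fullShift^[i] (fullShift^[j] (conc hm y))) := fun i => congrFun hmem i
    intro l hl
    rw [Finset.mem_coe, Finset.mem_Icc] at hl
    exact block_eq_of_trunc_eq hm hj hN (fun l i => hK _ (hy l).1 i)
      (fun i l => hK _ (hy' l).1 i) hmem' l hl.1 hl.2

lemma le_entropy_blockAverage {m : ℕ} (hm : 0 < m) {s : Finset (Fin m → ℕ)}
    {w : (Fin m → ℕ) → ℝ} (hw : ∀ u ∈ s, 0 ≤ w u) (h1 : ∑ u ∈ s, w u = 1)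
    [IsProbabilityMeasure (wordLaw s w)] :
    ENNReal.ofReal ((∑ u ∈ s, Real.negMulLog (w u)) / m)
      ≤ entropy fullShift (blockAverage hm (wordLaw s w)) := by
  set K := s.sup fun u => Finset.univ.sup u with hKd
  have hK : ∀ u ∈ s, ∀ i, u i ≤ K := fun u hu i =>
    (Finset.le_sup (f := u) (Finset.mem_univ i)).trans
      (Finset.le_sup (f := fun u : Fin m → ℕ => Finset.univ.sup u) hu)
  have hw1 : ∀ u ∈ s, w u ≤ 1 := fun u hu => h1 ▸ Finset.single_le_sum hw hu
  set H := ∑ u ∈ s, Real.negMulLog (w u) with hH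
  have hH0 : 0 ≤ H := Finset.sum_nonneg fun u hu => Real.negMulLog_nonneg (hw u hu) (hw1 u hu)
  have hm' : (0 : ℝ) < m := by exact_mod_cast hm
  refine le_trans ?_ (le_iSup₂_of_le (truncDigit K)
    ⟨measurable_truncDigit K, finite_range_truncDigit K⟩ le_rfl)
  have hlim : Tendsto (fun n : ℕ => (1 / (m : ℝ) - 2 / n) * H) atTop (𝓝 ((1 / m - 0) * H)) :=
    (tendsto_const_nhds.sub (tendsto_const_div_nat_add 2)).mul_const H
  rw [show (1 / (m : ℝ) - 0) * H = H / m by ring] at hlim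
  rw [← (ENNReal.tendsto_ofReal hlim).liminf_eq]
  refine liminf_le_liminf ?_
  filter_upwards [eventually_ge_atTop m] with n hn
  have hn0 : (0 : ℝ) < n := by exact_mod_cast hm.trans_le hn
  have hq : 1 ≤ n / m := (Nat.one_le_div_iff hm).2 hn
  have hN : m * (n / m - 1 + 1) ≤ n := by
    rw [Nat.sub_add_cancel hq]; exact Nat.mul_div_le n m
  have hP := le_partitionEntropy_average hm
    (fun j => (blockLaw hm (wordLaw s w)).map fullShift^[j])
    (fun x => fun i : Fin n => truncDigit K (fullShift^[i] x))
    (fun j hj => le_partitionEntropy_map_blockLaw hm hw h1 hK hj hN)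
  refine le_trans ?_ (mul_le_mul_right hP _)
  rw [← ENNReal.ofReal_natCast, ← ENNReal.ofReal_mul (by positivity),
    ← ENNReal.ofReal_mul (by positivity), ← mul_assoc]
  refine ENNReal.ofReal_le_ofReal (mul_le_mul_of_nonneg_right ?_ hH0)
  have h2 : (n : ℝ) < m * ((n / m : ℕ) + 1) := by
    have := Nat.lt_mul_div_succ n hm
    exact_mod_cast this
  rw [Nat.cast_sub hq, Nat.cast_one, div_sub_div _ _ hm'.ne' hn0.ne', div_le_iff₀ (by positivity)]
  field_simp
  nlinarith

lemma conc_eq_ext {m : ℕ} (hm : 0 < m) (y : ℕ → Fin m → ℕ) :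
    ∀ i < m, conc hm y i = ext (y 0) i := by
  intro i hi
  have := conc_mul_add hm y 0 ⟨i, hi⟩
  simp only [mul_zero, zero_add] at this
  rw [this, ext, dif_pos hi]

lemma lintegral_infinitePi_zero {m : ℕ} (ω : Measure (Fin m → ℕ)) [IsProbabilityMeasure ω]
    (f : (Fin m → ℕ) → ℝ≥0∞) :
    ∫⁻ y, f (y 0) ∂(Measure.infinitePi fun _ : ℕ => ω) = ∫⁻ u, f u ∂ω :=
  (measurePreserving_eval_infinitePi (fun _ : ℕ => ω) 0).lintegral_comp (measurable_of_countable f)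

lemma inv_natCast_mul_lintegral_wordLaw {m : ℕ} (hm : 0 < m) {s : Finset (Fin m → ℕ)}
    {w f : (Fin m → ℕ) → ℝ} (hw : ∀ u ∈ s, 0 ≤ w u) (hf : ∀ u, 0 ≤ f u) :
    (m : ℝ≥0∞)⁻¹ * ∫⁻ u, ENNReal.ofReal (f u) ∂(wordLaw s w)
      = ENNReal.ofReal ((∑ u ∈ s, w u * f u) / m) := by
  have hm' : (0 : ℝ) < m := by exact_mod_cast hm
  rw [lintegral_wordLaw, div_eq_inv_mul, ENNReal.ofReal_mul (by positivity),
    ENNReal.ofReal_inv_of_pos hm', ENNReal.ofReal_natCast,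
    ENNReal.ofReal_sum_of_nonneg fun u hu => mul_nonneg (hw u hu) (hf u)]
  congr 1
  exact Finset.sum_congr rfl fun u hu => (ENNReal.ofReal_mul (hw u hu)).symm

lemma blockAverage_zero_mem {m : ℕ} (hm : 0 < m) {s : Finset (Fin m → ℕ)}
    {w : (Fin m → ℕ) → ℝ} (hw : ∀ u ∈ s, 0 ≤ w u) [IsProbabilityMeasure (wordLaw s w)]
    (E : Set ℕ) :
    (blockAverage hm (wordLaw s w)).real {x | x 0 ∈ E}
      = (∑ u ∈ s, w u * hits E m (ext u)) / m := by
  have hE := measurableSet_zero_mem E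
  have h1 : ∀ y, ∑ j ∈ Finset.range m,
      {x : ℕ → ℕ | x 0 ∈ E}.indicator (1 : (ℕ → ℕ) → ℝ≥0∞) (fullShift^[j] (conc hm y))
      = ENNReal.ofReal (hits E m (ext (y 0))) := by
    intro y
    rw [← hits_congr E (conc_eq_ext hm y), hits, ENNReal.ofReal_sum_of_nonneg]
    · refine Finset.sum_congr rfl fun j _ => ?_
      by_cases h : conc hm y j ∈ E <;> simp [indicator, fullShift_iterate, h]
    · exact fun i _ => indicator_nonneg (fun _ _ => zero_le_one) _
  rw [Measure.real, ← lintegral_indicator_one hE,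
    lintegral_blockAverage hm _ (measurable_one.indicator hE)]
  simp_rw [h1]
  rw [lintegral_infinitePi_zero _ fun u => ENNReal.ofReal (hits E m (ext u)),
    inv_natCast_mul_lintegral_wordLaw hm hw fun u => hits_nonneg E m _, ENNReal.toReal_ofReal]
  exact div_nonneg (Finset.sum_nonneg fun u hu => mul_nonneg (hw u hu) (hits_nonneg E m _))
    (Nat.cast_nonneg m)

lemma sum_neg_gaussPotential_le (n : ℕ) (u : ℕ → ℕ) :
    ∑ i ∈ Finset.range n, -gaussPotential (fullShift^[i] u) ≤ 2 - Real.log (len n u) := by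
  have := (abs_le.1 (abs_sum_gaussPotential_le n u)).2
  linarith

lemma two_sub_log_len_nonneg (n : ℕ) (u : ℕ → ℕ) : 0 ≤ 2 - Real.log (len n u) :=
  (Finset.sum_nonneg fun _ _ => neg_nonneg.2 (gaussPotential_nonpos _)).trans
    (sum_neg_gaussPotential_le n u)

lemma lintegral_gaussPotential_blockAverage_le {m : ℕ} (hm : 0 < m) {s : Finset (Fin m → ℕ)}
    {w : (Fin m → ℕ) → ℝ} (hw : ∀ u ∈ s, 0 ≤ w u) [IsProbabilityMeasure (wordLaw s w)] :
    ∫⁻ x, ENNReal.ofReal (-gaussPotential x) ∂(blockAverage hm (wordLaw s w))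
      ≤ ENNReal.ofReal ((∑ u ∈ s, w u * (2 - Real.log (len m (ext u)))) / m) := by
  rw [lintegral_blockAverage (f := fun x => ENNReal.ofReal (-gaussPotential x)) hm _
      measurable_gaussPotential.neg.ennreal_ofReal,
    ← inv_natCast_mul_lintegral_wordLaw hm hw fun u => two_sub_log_len_nonneg m _,
    ← lintegral_infinitePi_zero]
  refine mul_le_mul_right (lintegral_mono fun y => ?_) _
  change _ ≤ ENNReal.ofReal _
  rw [← ENNReal.ofReal_sum_of_nonneg fun j _ => neg_nonneg.2 (gaussPotential_nonpos _),
    ← len_congr (conc_eq_ext hm y)]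
  exact ENNReal.ofReal_le_ofReal (sum_neg_gaussPotential_le m _)

lemma le_freeEnergy_blockAverage {m : ℕ} (hm : 0 < m) {s : Finset (Fin m → ℕ)}
    {w : (Fin m → ℕ) → ℝ} (hw : ∀ u ∈ s, 0 ≤ w u) (h1 : ∑ u ∈ s, w u = 1)
    [IsProbabilityMeasure (wordLaw s w)] :
    (((∑ u ∈ s, (Real.negMulLog (w u) + w u * Real.log (len m (ext u))) - 2) / m : ℝ) : EReal)
      ≤ freeEnergy fullShift gaussPotential 0 ⟨blockAverage hm (wordLaw s w), inferInstance⟩ := by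
  have hle := lintegral_gaussPotential_blockAverage_le hm (s := s) hw
  have hφ : IntegralGtBot gaussPotential (blockAverage hm (wordLaw s w)) :=
    ne_top_of_le_ne_top ENNReal.ofReal_ne_top hle
  have hm' : (0 : ℝ) < m := by exact_mod_cast hm
  have hw1 : ∀ u ∈ s, w u ≤ 1 := fun u hu => h1 ▸ Finset.single_le_sum hw hu
  have hC : 0 ≤ (∑ u ∈ s, w u * (2 - Real.log (len m (ext u)))) / m :=
    div_nonneg (Finset.sum_nonneg fun u hu => mul_nonneg (hw u hu) (two_sub_log_len_nonneg m _))
      hm'.le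
  have hInt : ∫ x, -gaussPotential x ∂(blockAverage hm (wordLaw s w))
      ≤ (∑ u ∈ s, w u * (2 - Real.log (len m (ext u)))) / m := by
    rw [integral_eq_lintegral_of_nonneg_ae
      (ae_of_all _ fun x => neg_nonneg.2 (gaussPotential_nonpos x))
      measurable_gaussPotential.neg.aestronglyMeasurable]
    exact ENNReal.toReal_le_of_le_ofReal hC hle
  rw [freeEnergy_eq (ν := ⟨blockAverage hm (wordLaw s w), inferInstance⟩)
    (invariant_blockAverage hm _) hφ]
  have hent : ((ENNReal.ofReal ((∑ u ∈ s, Real.negMulLog (w u)) / m) : ℝ≥0∞) : EReal)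
      ≤ ((entropy fullShift (blockAverage hm (wordLaw s w)) : ℝ≥0∞) : EReal) :=
    EReal.coe_ennreal_le_coe_ennreal_iff.2 (le_entropy_blockAverage hm hw h1)
  rw [EReal.coe_ennreal_ofReal, max_eq_left (div_nonneg (Finset.sum_nonneg fun u hu =>
    Real.negMulLog_nonneg (hw u hu) (hw1 u hu)) hm'.le)] at hent
  refine le_trans ?_ (add_le_add hent (EReal.coe_le_coe_iff.2 (neg_le_neg hInt)))
  rw [← EReal.coe_add, EReal.coe_le_coe_iff]
  simp only [Finset.sum_add_distrib, mul_sub, Finset.sum_sub_distrib, ← Finset.sum_mul, h1]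
  apply le_of_eq
  ring

/-- The finite set of words `W`, weighted proportionally to `ℓ`. -/
noncomputable def propWeight {A : Type*} [DecidableEq A] (ℓ : A → ℝ) (W : Finset A) (u : A) : ℝ :=
  if u ∈ W then ℓ u / ∑ v ∈ W, ℓ v else 0

lemma propWeight_nonneg {A : Type*} [DecidableEq A] {ℓ : A → ℝ} (hℓ : ∀ u, 0 < ℓ u)
    (W : Finset A) (u : A) : 0 ≤ propWeight ℓ W u := by
  unfold propWeight
  split_ifs
  · exact div_nonneg (hℓ u).le (Finset.sum_nonneg fun v _ => (hℓ v).le)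
  · rfl

lemma sum_propWeight_mul {A : Type*} [DecidableEq A] (ℓ f : A → ℝ) {W s : Finset A} (h : W ⊆ s) :
    ∑ u ∈ s, propWeight ℓ W u * f u = (∑ u ∈ W, ℓ u * f u) / ∑ v ∈ W, ℓ v := by
  rw [← Finset.sum_subset h fun u _ hu => by rw [propWeight, if_neg hu, zero_mul],
    Finset.sum_div]
  refine Finset.sum_congr rfl fun u hu => ?_
  rw [propWeight, if_pos hu]; ring

lemma sum_propWeight {A : Type*} [DecidableEq A] {ℓ : A → ℝ} {W s : Finset A} (h : W ⊆ s)
    (hZ : 0 < ∑ v ∈ W, ℓ v) : ∑ u ∈ s, propWeight ℓ W u = 1 := by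
  have := sum_propWeight_mul ℓ (fun _ => 1) h
  simp only [mul_one] at this
  rw [this, div_self hZ.ne']

lemma sum_negMulLog_propWeight {A : Type*} [DecidableEq A] {ℓ : A → ℝ} (hℓ : ∀ u, 0 < ℓ u)
    {W s : Finset A} (h : W ⊆ s) (hZ : 0 < ∑ v ∈ W, ℓ v) :
    ∑ u ∈ s, (Real.negMulLog (propWeight ℓ W u) + propWeight ℓ W u * Real.log (ℓ u))
      = Real.log (∑ v ∈ W, ℓ v) := by
  have : ∀ u ∈ s, Real.negMulLog (propWeight ℓ W u) + propWeight ℓ W u * Real.log (ℓ u)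
      = propWeight ℓ W u * Real.log (∑ v ∈ W, ℓ v) := by
    intro u _
    rw [Real.negMulLog]
    unfold propWeight
    split_ifs
    · rw [Real.log_div (hℓ u).ne' hZ.ne']; ring
    · simp
  rw [Finset.sum_congr rfl this, ← Finset.sum_mul, sum_propWeight h hZ, one_mul]

lemma exists_mixture {A : Type*} [DecidableEq A] {ℓ h : A → ℝ} (hℓ : ∀ u, 0 < ℓ u)
    {W₁ W₀ : Finset A} (hZ₁ : 0 < ∑ v ∈ W₁, ℓ v) (hZ₀ : 0 < ∑ v ∈ W₀, ℓ v)
    (hZ₁' : ∑ v ∈ W₁, ℓ v ≤ 1) (hZ₀' : ∑ v ∈ W₀, ℓ v ≤ 1) {a : ℝ}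
    (h₁ : ∀ u ∈ W₁, a ≤ h u) (h₀ : ∀ u ∈ W₀, h u ≤ a) :
    ∃ w : A → ℝ, (∀ u, 0 ≤ w u) ∧ ∑ u ∈ W₁ ∪ W₀, w u = 1 ∧ ∑ u ∈ W₁ ∪ W₀, w u * h u = a ∧
      Real.log (∑ v ∈ W₁, ℓ v) + Real.log (∑ v ∈ W₀, ℓ v)
        ≤ ∑ u ∈ W₁ ∪ W₀, (Real.negMulLog (w u) + w u * Real.log (ℓ u)) := by
  have s₁ : W₁ ⊆ W₁ ∪ W₀ := Finset.subset_union_left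
  have s₀ : W₀ ⊆ W₁ ∪ W₀ := Finset.subset_union_right
  have f₁ : a ≤ (∑ u ∈ W₁, ℓ u * h u) / ∑ v ∈ W₁, ℓ v := by
    rw [le_div_iff₀ hZ₁, Finset.mul_sum]
    refine Finset.sum_le_sum fun u hu => ?_
    rw [mul_comm]; exact mul_le_mul_of_nonneg_left (h₁ u hu) (hℓ u).le
  have f₀ : (∑ u ∈ W₀, ℓ u * h u) / ∑ v ∈ W₀, ℓ v ≤ a := by
    rw [div_le_iff₀ hZ₀, Finset.mul_sum]
    refine Finset.sum_le_sum fun u hu => ?_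
    rw [mul_comm a]; exact mul_le_mul_of_nonneg_left (h₀ u hu) (hℓ u).le
  obtain ⟨c, t, hc, ht, hct, hsum⟩ : a ∈ segment ℝ ((∑ u ∈ W₀, ℓ u * h u) / ∑ v ∈ W₀, ℓ v)
      ((∑ u ∈ W₁, ℓ u * h u) / ∑ v ∈ W₁, ℓ v) := by
    rw [segment_eq_Icc (f₀.trans f₁)]; exact ⟨f₀, f₁⟩
  refine ⟨fun u => c * propWeight ℓ W₀ u + t * propWeight ℓ W₁ u, fun u =>
    add_nonneg (mul_nonneg hc (propWeight_nonneg hℓ _ u))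
      (mul_nonneg ht (propWeight_nonneg hℓ _ u)), ?_, ?_, ?_⟩
  · rw [Finset.sum_add_distrib, ← Finset.mul_sum, ← Finset.mul_sum, sum_propWeight s₀ hZ₀,
      sum_propWeight s₁ hZ₁]; linarith
  · simp only [add_mul, mul_assoc]
    rw [Finset.sum_add_distrib, ← Finset.mul_sum, ← Finset.mul_sum, sum_propWeight_mul ℓ h s₀,
      sum_propWeight_mul ℓ h s₁]
    simpa using hsum
  · have l₁ := Real.log_nonpos hZ₁.le hZ₁'
    have l₀ := Real.log_nonpos hZ₀.le hZ₀'
    calc _ ≤ c * Real.log (∑ v ∈ W₀, ℓ v) + t * Real.log (∑ v ∈ W₁, ℓ v) := by nlinarith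
      _ ≤ _ := by
        rw [← sum_negMulLog_propWeight hℓ s₀ hZ₀, ← sum_negMulLog_propWeight hℓ s₁ hZ₁,
          Finset.mul_sum, Finset.mul_sum, ← Finset.sum_add_distrib]
        refine Finset.sum_le_sum fun u _ => ?_
        have := Real.concaveOn_negMulLog.2 (propWeight_nonneg hℓ W₀ u)
          (propWeight_nonneg hℓ W₁ u) hc ht hct
        simp only [smul_eq_mul] at this
        linarith

lemma exists_finset_words {m : ℕ} (S : Set (Fin m → ℕ)) {c : ℝ} (hc : 0 ≤ c)
    (h : c < lebLaw.real (pre m ⁻¹' S)) :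
    ∃ W : Finset (Fin m → ℕ), (∀ u ∈ W, u ∈ S) ∧ c < ∑ u ∈ W, len m (ext u) ∧
      ∑ u ∈ W, len m (ext u) ≤ 1 := by
  classical
  have hsing : ∀ u : Fin m → ℕ, (lebLaw.map (pre m)) {u} = ENNReal.ofReal (len m (ext u)) := by
    intro u
    rw [Measure.map_apply (measurable_pre m) (measurableSet_singleton u),
      preimage_pre_singleton, lebLaw_cyl]
  have hprob : IsProbabilityMeasure (lebLaw.map (pre m)) :=
    Measure.isProbabilityMeasure_map (measurable_pre m).aemeasurable
  have hlt : ENNReal.ofReal c < (lebLaw.map (pre m)) S := by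
    rw [Measure.map_apply (measurable_pre m) S.to_countable.measurableSet, ← ofReal_measureReal]
    exact (ENNReal.ofReal_lt_ofReal_iff (hc.trans_lt h)).2 h
  rw [← Measure.tsum_indicator_apply_singleton _ S S.to_countable.measurableSet,
    ENNReal.tsum_eq_iSup_sum, lt_iSup_iff] at hlt
  obtain ⟨t, ht⟩ := hlt
  have e : ∀ W : Finset (Fin m → ℕ), ∑ u ∈ W, (lebLaw.map (pre m)) {u}
      = ENNReal.ofReal (∑ u ∈ W, len m (ext u)) := fun W => by
    rw [ENNReal.ofReal_sum_of_nonneg fun u _ => (len_pos _ _).le]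
    exact Finset.sum_congr rfl fun u _ => hsing u
  refine ⟨t.filter (· ∈ S), fun u hu => (Finset.mem_filter.1 hu).2, ?_, ?_⟩
  · simp only [indicator_apply, ← Finset.sum_filter] at ht
    rw [e] at ht
    exact (ENNReal.ofReal_lt_ofReal_iff_of_nonneg hc).1 ht
  · rw [← ENNReal.ofReal_le_one, ← e, sum_measure_singleton]
    exact prob_le_one

lemma eventually_half_lt_lebLaw {E : Set ℕ} {α : ℝ} (hα : freq E < α) :
    ∀ᶠ m : ℕ in atTop, 1 / 2 < lebLaw.real {u | hits E m u ≤ α * m} := by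
  have h := (tendsto_lebLaw_deviation E (sub_pos.2 hα)).eventually
    (gt_mem_nhds (show (0 : ℝ≥0∞) < ENNReal.ofReal (1 / 2) by simp))
  filter_upwards [h, eventually_gt_atTop 0] with m hm hm0
  have hm0' : (0 : ℝ) < m := by exact_mod_cast hm0
  have hsub : {u | hits E m u ≤ α * m}ᶜ ⊆ {u | α - freq E ≤ |hits E m u / m - freq E|} := by
    intro u hu
    simp only [mem_compl_iff, mem_ofPred_eq, not_le] at hu ⊢
    have : α < hits E m u / m := (lt_div_iff₀ hm0').2 hu
    exact le_trans (by linarith) (le_abs_self _)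
  have hlt : lebLaw.real {u | hits E m u ≤ α * m}ᶜ < 1 / 2 :=
    ENNReal.toReal_lt_of_lt_ofReal ((measure_mono hsub).trans_lt hm)
  rw [probReal_compl_eq_one_sub (measurableSet_le (measurable_hits E m) measurable_const)] at hlt
  linarith

lemma tail_eq_preimage_pre (E : Set ℕ) (m : ℕ) (s : ℝ) :
    lebLaw.real (pre m ⁻¹' {w | s ≤ hits E m (ext w)}) = tail E m s := by
  simp only [tail, preimage_ofPred_eq, hits_ext_pre]

lemma exists_freeEnergy_ge {E : Set ℕ} (hE : E.Nonempty) {α : ℝ} (hα : freq E < α) (h1 : α ≤ 1)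
    {c : ℝ} (hc : c < rate E α) :
    ∃ ν : ProbabilityMeasure (ℕ → ℕ), (ν : Measure (ℕ → ℕ)).real {x | x 0 ∈ E} = α ∧
      ((c : ℝ) : EReal) ≤ freeEnergy fullShift gaussPotential 0 ν := by
  classical
  have hlim : Tendsto (fun m : ℕ => (Real.log (tail E m (α * m) / 2) + Real.log (1 / 2) - 2) / m)
      atTop (𝓝 (rate E α)) := by
    have h2 := (tendsto_rate hE h1).add
      (tendsto_const_div_nat_add (-Real.log 2 + Real.log (1 / 2) - 2))
    rw [add_zero] at h2
    refine h2.congr fun m => ?_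
    have hle : α * m ≤ m := mul_le_of_le_one_left (Nat.cast_nonneg m) h1
    rw [Real.log_div (tail_pos hE m hle).ne' two_ne_zero]
    ring
  obtain ⟨m, hcm, hhalf, hm⟩ := ((hlim.eventually (lt_mem_nhds hc)).and
    ((eventually_half_lt_lebLaw hα).and (eventually_gt_atTop 0))).exists
  have hm' : (0 : ℝ) < m := by exact_mod_cast hm
  have htail := tail_pos hE m (mul_le_of_le_one_left (Nat.cast_nonneg m) h1)
  have hsplit₁ : tail E m (α * m) / 2 < lebLaw.real (pre m ⁻¹' {w | α * m ≤ hits E m (ext w)}) := by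
    rw [tail_eq_preimage_pre]; exact half_lt_self htail
  have hsplit₀ : 1 / 2 < lebLaw.real (pre m ⁻¹' {w | hits E m (ext w) ≤ α * m}) := by
    simpa only [preimage_ofPred_eq, hits_ext_pre] using hhalf
  obtain ⟨W₁, hW₁, hZ₁, hZ₁'⟩ := exists_finset_words _ (half_pos htail).le hsplit₁
  obtain ⟨W₀, hW₀, hZ₀, hZ₀'⟩ := exists_finset_words _ one_half_pos.le hsplit₀
  have hpos₁ := (half_pos htail).trans hZ₁
  have hpos₀ := one_half_pos.trans hZ₀
  obtain ⟨w, hw, hw1, hwa, hF⟩ := exists_mixture (ℓ := fun u : Fin m → ℕ => len m (ext u))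
    (h := fun u => hits E m (ext u)) (a := α * m) (fun u => len_pos m (ext u)) hpos₁ hpos₀
    hZ₁' hZ₀' hW₁ hW₀
  have hprob := isProbabilityMeasure_wordLaw (fun u _ => hw u) hw1
  refine ⟨⟨blockAverage hm (wordLaw (W₁ ∪ W₀) w), inferInstance⟩, ?_,
    le_trans ?_ (le_freeEnergy_blockAverage hm (fun u _ => hw u) hw1)⟩
  · change (blockAverage hm (wordLaw (W₁ ∪ W₀) w)).real _ = α
    rw [blockAverage_zero_mem hm (fun u _ => hw u), hwa, mul_div_cancel_right₀ _ hm'.ne']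
  · rw [EReal.coe_le_coe_iff]
    refine hcm.le.trans (div_le_div_of_nonneg_right ?_ hm'.le)
    have := Real.log_le_log (half_pos htail) hZ₁.le
    have := Real.log_le_log (by norm_num) hZ₀.le
    linarith

/-- The infimum of the rate function over the measures giving mass `α` to `{x | x 0 ∈ E}`. -/
lemma iInf_rateOf_eq {E : Set ℕ} (hE : E.Nonempty) {α : ℝ} (hα : freq E < α) (h1 : α ≤ 1) :
    ⨅ (μ : ProbabilityMeasure (ℕ → ℕ)) (_ : (μ : Measure (ℕ → ℕ)).real {x | x 0 ∈ E} = α),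
      rateOf (freeEnergy fullShift gaussPotential 0) μ = ((-rate E α : ℝ) : EReal) := by
  apply le_antisymm
  · refine EReal.le_of_forall_lt_iff_le.1 fun z hz => ?_
    rw [EReal.coe_lt_coe_iff] at hz
    obtain ⟨ν, hν, hF⟩ := exists_freeEnergy_ge hE hα h1 (c := -z) (by linarith)
    refine (iInf₂_le ν hν).trans ((rateOf_le_neg _ ν).trans ?_)
    rw [EReal.neg_le, ← EReal.coe_neg]
    exact hF
  · exact le_iInf₂ fun μ hμ => hμ ▸ neg_rate_le_rateOf hE μ

lemma map_cfPi_Ioo {k : ℕ} (hk : 1 ≤ k) (μ : Measure (ℕ → ℕ)) :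
    ((Measure.map cfPi μ) (Ioo (((k : ℝ) + 1)⁻¹) ((k : ℝ)⁻¹))).toReal
      = μ.real {x | x 0 ∈ ({k - 1} : Set ℕ)} := by
  rw [Measure.map_apply measurable_cfPi measurableSet_Ioo, Measure.real]
  congr 2
  ext u
  exact cfPi_mem_Ioo_iff u hk

lemma cfRateInf_eq {k : ℕ} (hk : 1 ≤ k) {α : ℝ} (hα : freq {k - 1} < α) (h1 : α ≤ 1) :
    cfRateInf k α = ((-rate {k - 1} α : ℝ) : EReal) := by
  rw [← iInf_rateOf_eq (singleton_nonempty _) hα h1, cfRateInf]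
  simp only [map_cfPi_Ioo hk]

lemma measureReal_zero_mem_compl (E : Set ℕ) (μ : Measure (ℕ → ℕ)) [IsProbabilityMeasure μ] :
    μ.real {x | x 0 ∈ Eᶜ} = 1 - μ.real {x | x 0 ∈ E} :=
  probReal_compl_eq_one_sub (measurableSet_zero_mem E)

lemma compl_singleton_nonempty (a : ℕ) : ({a}ᶜ : Set ℕ).Nonempty :=
  ⟨a + 1, Nat.succ_ne_self a⟩

lemma cfRateInf_eq_compl {k : ℕ} (hk : 1 ≤ k) {α : ℝ} (hα : α < freq {k - 1}) (h0 : 0 ≤ α) :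
    cfRateInf k α = ((-rate {k - 1}ᶜ (1 - α) : ℝ) : EReal) := by
  rw [← iInf_rateOf_eq (compl_singleton_nonempty _) (by rw [freq_compl]; linarith) (by linarith),
    cfRateInf]
  have : ∀ μ : ProbabilityMeasure (ℕ → ℕ),
      ((μ : Measure (ℕ → ℕ)).real {x | x 0 ∈ ({k - 1}ᶜ : Set ℕ)} = 1 - α) =
        (((Measure.map cfPi (μ : Measure (ℕ → ℕ)))
          (Ioo (((k : ℝ) + 1)⁻¹) ((k : ℝ)⁻¹))).toReal = α) := fun μ => by
    rw [map_cfPi_Ioo hk, measureReal_zero_mem_compl, sub_right_inj]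
  simp only [this]

lemma tendsto_inv_mul_log {E : Set ℕ} (hE : E.Nonempty) {β : ℝ} (hβ : β ≤ 1) :
    Tendsto (fun n : ℕ => (((n : ℝ)⁻¹ : ℝ) : EReal) *
      ENNReal.log (lebLaw {u | β * n ≤ hits E n u})) atTop (𝓝 ((rate E β : ℝ) : EReal)) := by
  refine (continuous_coe_real_ereal.tendsto _).comp (tendsto_rate hE hβ) |>.congr fun n => ?_
  have hpos := tail_pos hE n (mul_le_of_le_one_left (Nat.cast_nonneg n) hβ)
  have h : lebLaw {u | β * n ≤ hits E n u} = ENNReal.ofReal (tail E n (β * n)) :=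
    (ofReal_measureReal).symm
  rw [h, ENNReal.log_ofReal_of_pos hpos, ← EReal.coe_mul, Function.comp_apply, div_eq_inv_mul]

lemma volume_digitCount {k : ℕ} (hk : 1 ≤ k) (n : ℕ) {p : ℝ → Prop}
    (hp : MeasurableSet {u | p (hits {k - 1} n u)}) :
    (volume.restrict (Ioo (0 : ℝ) 1)) {x : ℝ | Irrational x ∧ p (digitCount k n x)}
      = lebLaw {u | p (hits {k - 1} n u)} := by
  rw [lebLaw, Measure.map_apply measurable_digits hp]
  apply measure_congr
  filter_upwards [ae_restrict_mem measurableSet_Ioo, ae_restrict_of_ae irrational_ae] with x hx hi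
  apply propext
  change (Irrational x ∧ p (digitCount k n x)) ↔ p (hits {k - 1} n (digits x))
  rw [digitCount_eq hk n hx hi, and_iff_right hi]

lemma tendsto_digitCount_ge {k : ℕ} (hk : 1 ≤ k) {α : ℝ} (h1 : α ≤ 1) :
    Tendsto (fun n : ℕ => (((n : ℝ)⁻¹ : ℝ) : EReal) *
      ENNReal.log ((volume.restrict (Ioo (0 : ℝ) 1))
        {x : ℝ | Irrational x ∧ α ≤ (digitCount k n x : ℝ) / n}))
      atTop (𝓝 ((rate {k - 1} α : ℝ) : EReal)) := by
  refine (tendsto_inv_mul_log (singleton_nonempty _) h1).congr' ?_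
  filter_upwards [eventually_gt_atTop 0] with n hn
  have hn' : (0 : ℝ) < n := by exact_mod_cast hn
  have h := volume_digitCount hk n (p := fun t => α * n ≤ t) (measurableSet_le_hits _ _ _)
  simp only [le_div_iff₀ hn']
  rw [h]

lemma tendsto_digitCount_le {k : ℕ} (hk : 1 ≤ k) {α : ℝ} (h0 : 0 ≤ α) :
    Tendsto (fun n : ℕ => (((n : ℝ)⁻¹ : ℝ) : EReal) *
      ENNReal.log ((volume.restrict (Ioo (0 : ℝ) 1))
        {x : ℝ | Irrational x ∧ (digitCount k n x : ℝ) / n ≤ α}))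
      atTop (𝓝 ((rate {k - 1}ᶜ (1 - α) : ℝ) : EReal)) := by
  refine (tendsto_inv_mul_log (compl_singleton_nonempty _) (by linarith)).congr' ?_
  filter_upwards [eventually_gt_atTop 0] with n hn
  have hn' : (0 : ℝ) < n := by exact_mod_cast hn
  have h := volume_digitCount hk n (p := fun t => t ≤ α * n)
    (measurableSet_le (measurable_hits _ _) measurable_const)
  have e : ∀ u, ((1 - α) * n ≤ hits {k - 1}ᶜ n u) = (hits {k - 1} n u ≤ α * n) := fun u => by
    rw [hits_compl, sub_mul, one_mul, sub_le_sub_iff_left]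
  simp only [div_le_iff₀ hn', e]
  rw [h]

end GaussLDP

/-- **Level-1 LDP for digit frequencies of continued fractions** (Lebesgue-measure part):
for digit frequencies `α` above (resp. below) the Gauss-measure frequency
`(1/log 2) log((k+1)²/(k(k+2)))` of the digit `k`, the exponential rate of
`Leb {x ∈ (0,1)\ℚ : (1/n) F_{k,n}(x) ≥ α}` (resp. `≤ α`) exists, equals
`-inf {I(μ) : ∫ 1_{(1/(k+1),1/k)} d(μ∘π⁻¹) = α}` and lies in `(-∞, 0)`. -/
theorem continued_fraction_digit_LDP (k : ℕ) (hk : 1 ≤ k) :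
    (∀ α : ℝ,
      Real.log (((k : ℝ) + 1) ^ 2 / ((k : ℝ) * ((k : ℝ) + 2))) / Real.log 2 < α → α ≤ 1 →
      Tendsto
        (fun n : ℕ => (((n : ℝ)⁻¹ : ℝ) : EReal) *
          ENNReal.log ((volume.restrict (Set.Ioo (0 : ℝ) 1))
            {x : ℝ | Irrational x ∧ α ≤ (digitCount k n x : ℝ) / n}))
        atTop (nhds (-cfRateInf k α)) ∧
      (⊥ : EReal) < -cfRateInf k α ∧ -cfRateInf k α < 0) ∧
    ∀ α : ℝ, 0 ≤ α →
      α < Real.log (((k : ℝ) + 1) ^ 2 / ((k : ℝ) * ((k : ℝ) + 2))) / Real.log 2 →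
      Tendsto
        (fun n : ℕ => (((n : ℝ)⁻¹ : ℝ) : EReal) *
          ENNReal.log ((volume.restrict (Set.Ioo (0 : ℝ) 1))
            {x : ℝ | Irrational x ∧ (digitCount k n x : ℝ) / n ≤ α}))
        atTop (nhds (-cfRateInf k α)) ∧
      (⊥ : EReal) < -cfRateInf k α ∧ -cfRateInf k α < 0 := by
  rw [← GaussLDP.freq_singleton hk]
  refine ⟨fun α hα h1 => ?_, fun α h0 hα => ?_⟩
  · rw [GaussLDP.cfRateInf_eq hk hα h1, ← EReal.coe_neg, neg_neg]
    exact ⟨GaussLDP.tendsto_digitCount_ge hk h1, EReal.bot_lt_coe _,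
      EReal.coe_neg'.2 (GaussLDP.rate_neg (singleton_nonempty _) hα h1)⟩
  · have hα' : GaussLDP.freq {k - 1}ᶜ < 1 - α := by rw [GaussLDP.freq_compl]; linarith
    rw [GaussLDP.cfRateInf_eq_compl hk hα h0, ← EReal.coe_neg, neg_neg]
    exact ⟨GaussLDP.tendsto_digitCount_le hk h0, EReal.bot_lt_coe _,
      EReal.coe_neg'.2 (GaussLDP.rate_neg (GaussLDP.compl_singleton_nonempty _) hα'
        (by linarith))⟩
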